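/- arXiv:2309.03757 — 2 statements merged into one kernel-verified Lean document; each statement's English description precedes it below -/
import Mathlib

section
/- For every k ∈ ℕ there exists a simplicially metrized game space (X,d) whose underlying topological space is homeomorphic to the 3-sphere 𝕊³ = {x ∈ ℝ⁴ : |x| = 1} and whose cop number satisfies c(X) > k. (In particular, since all homology groups of 𝕊³ in degrees 1,2,3 are trivial, the cop number of a simplicial complex homeomorphic to a 3-manifold cannot be bounded in terms of the ranks of its homology groups.) -/
/-!
Game of Cops and Robber on metric spaces, following Mohar, formalized relative to an
explicit distance function `d : Y → Y → ℝ`.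
-/

open Set Filter Topology

/-- The length of (the restriction to `[0,1]` of) a map `p : ℝ → Y` with respect to an
extended-real-valued cost function `c`, defined as the supremum over all finite monotone
partitions of `[0,1]` of the sums of the costs of consecutive points. -/
noncomputable def elen {Y : Type*} (c : Y → Y → ENNReal) (p : ℝ → Y) : ENNReal :=
  ⨆ q : ℕ × {u : ℕ → ℝ // Monotone u ∧ ∀ i, u i ∈ Set.Icc (0 : ℝ) 1},
    ∑ i ∈ Finset.range q.1, c (p (q.2.1 i)) (p (q.2.1 (i + 1)))

/-- Continuity on `[0,1]` of a map `p : ℝ → Y` with respect to a cost function `c`,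
stated in `ε`-`δ` form. -/
def econt {Y : Type*} (c : Y → Y → ENNReal) (p : ℝ → Y) : Prop :=
  ∀ t ∈ Set.Icc (0 : ℝ) 1, ∀ ε : ENNReal, 0 < ε →
    ∃ δ : ℝ, 0 < δ ∧ ∀ t' ∈ Set.Icc (0 : ℝ) 1, |t' - t| < δ → c (p t) (p t') < ε

/-- `d` is a metric on `Y`. -/
def IsMetricD (Y : Type*) (d : Y → Y → ℝ) : Prop :=
  (∀ x, d x x = 0) ∧ (∀ x y, d x y = 0 → x = y) ∧
    (∀ x y, d x y = d y x) ∧ (∀ x y z, d x z ≤ d x y + d y z)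

/-- Compactness of the metric space `(Y,d)`, in its sequential form: every sequence has a
convergent subsequence. -/
def CompactD (Y : Type*) (d : Y → Y → ℝ) : Prop :=
  ∀ u : ℕ → Y, ∃ (x : Y) (φ : ℕ → ℕ), StrictMono φ ∧
    Filter.Tendsto (fun n => d (u (φ n)) x) Filter.atTop (nhds 0)

/-- `(Y,d)` is a geodesic metric space: any two points `x, y` are joined by a continuous
path `p : [0,1] → Y` whose length equals `d x y`. -/
def IsGeodesicD (Y : Type*) (d : Y → Y → ℝ) : Prop :=
  ∀ x y : Y, ∃ p : ℝ → Y,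
    econt (fun a b => ENNReal.ofReal (d a b)) p ∧ p 0 = x ∧ p 1 = y ∧
      elen (fun a b => ENNReal.ofReal (d a b)) p = ENNReal.ofReal (d x y)

/-- A game space is a (nonempty) compact geodesic metric space. -/
def GameSpaceD (Y : Type*) (d : Y → Y → ℝ) : Prop :=
  Nonempty Y ∧ IsMetricD Y d ∧ CompactD Y d ∧ IsGeodesicD Y d

/-- An agility function: positive, with divergent sum. -/
def IsAgility (τ : ℕ → ℝ) : Prop := (∀ n, 0 < τ n) ∧ ¬ Summable τ

/-- The trajectory of the `k` cops determined by initial positions `c0`, a cop strategy `σ`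
(where `σ n` computes the cops' positions at step `n+1` from the robber's positions
`r^0, …, r^(n+1)`), and a robber trajectory `r`. -/
def copTraj {Y : Type*} {k : ℕ} (c0 : Fin k → Y)
    (σ : (n : ℕ) → (Fin (n + 2) → Y) → Fin k → Y) (r : ℕ → Y) : ℕ → Fin k → Y
  | 0 => c0
  | n + 1 => σ n fun i => r i

/-- The trajectory of the robber determined by his initial position `r0`, a robber strategy
`ρ` (where `ρ n` computes the robber's position at step `n+1` from the cops' positions
`c^0, …, c^n`), and a cop trajectory `c`. -/
def robTraj {Y : Type*} {k : ℕ} (r0 : Y)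
    (ρ : (n : ℕ) → (Fin (n + 1) → Fin k → Y) → Y) (c : ℕ → Fin k → Y) : ℕ → Y
  | 0 => r0
  | n + 1 => ρ n fun i => c i

/-- `k` cops have a winning strategy on `(Y,d)`: for every agility function and every initial
position chosen by the robber there is a cop strategy `σ`, assigning legal cop moves to every
history, such that against every legal robber trajectory the cops come arbitrarily close to
the robber. -/
def CopsWinWith (Y : Type*) (d : Y → Y → ℝ) (k : ℕ) : Prop :=
  ∀ τ : ℕ → ℝ, IsAgility τ → ∀ r0 : Y, ∀ c0 : Fin k → Y,
    ∃ σ : (n : ℕ) → (Fin (n + 2) → Y) → Fin k → Y,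
      ∀ r : ℕ → Y, r 0 = r0 → (∀ n, d (r n) (r (n + 1)) ≤ τ (n + 1)) →
        (∀ n i, d (copTraj c0 σ r n i) (copTraj c0 σ r (n + 1) i) ≤ τ (n + 1)) ∧
          (∀ ε : ℝ, 0 < ε → ∃ n i, d (r n) (copTraj c0 σ r n i) < ε)

/-- The cop number of `(Y,d)`, as an extended natural number: the least `k` such that `k`
cops have a winning strategy (`⊤` if there is no such `k`). -/
noncomputable def copNumber (Y : Type*) (d : Y → Y → ℝ) : ℕ∞ :=
  sInf {m : ℕ∞ | ∃ k : ℕ, m = (k : ℕ∞) ∧ CopsWinWith Y d k}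

/-- The robber has a strategy against `k` cops on `(Y,d)` with agility function `τ` which
guarantees that his moves are legal and that every cop always stays at distance `> ε` from
him, against every legal cop play. -/
def RobberWins (Y : Type*) (d : Y → Y → ℝ) (k : ℕ) (τ : ℕ → ℝ) (ε : ℝ) : Prop :=
  ∃ (r0 : Y) (c0 : Fin k → Y) (ρ : (n : ℕ) → (Fin (n + 1) → Fin k → Y) → Y),
    ∀ c : ℕ → Fin k → Y, c 0 = c0 → (∀ n i, d (c n i) (c (n + 1) i) ≤ τ (n + 1)) →
      (∀ n, d (robTraj r0 ρ c n) (robTraj r0 ρ c (n + 1)) ≤ τ (n + 1)) ∧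
        (∀ n i, ε < d (robTraj r0 ρ c n) (c n i))

/-!
Simplicially metrized spaces: metric spaces isometric to the underlying space `|K|` of a
finite geometric simplicial complex all of whose simplices are regular with edge length 1
(equivalently, all pairwise distances between the vertices of a simplex equal 1), equipped
with the intrinsic length metric induced by the Euclidean metric.
-/

/-- The intrinsic (extended-real-valued) distance between two points of a subset `A` of a
metric space: the infimum of the lengths of continuous paths joining them within `A`. -/
noncomputable def intrinsicDistE {E : Type*} [MetricSpace E] (A : Set E) (a b : ↥A) :
    ENNReal :=
  ⨅ p : {p : ℝ → ↥A // ContinuousOn p (Set.Icc (0:ℝ) 1) ∧ p 0 = a ∧ p 1 = b},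
    eVariationOn (fun t => ((p.1 t : E))) (Set.Icc (0:ℝ) 1)

/-- A metric space `(X, dist)` is simplicially metrized if it is isometric to the underlying
space `|K|` of a finite geometric simplicial complex `K` in some Euclidean space, all of
whose simplices are regular with edge length `1`, equipped with the intrinsic length metric
induced by the Euclidean metric. -/
def SimpliciallyMetrized (X : Type*) [MetricSpace X] : Prop :=
  ∃ (N : ℕ) (K : Geometry.SimplicialComplex ℝ (EuclideanSpace ℝ (Fin N))),
    K.faces.Finite ∧
    (∀ f ∈ K.faces, ∀ x ∈ f, ∀ y ∈ f, x ≠ y → dist x y = 1) ∧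
    ∃ e : X ≃ ↥(K.space),
      ∀ x y : X, ENNReal.ofReal (dist x y) = intrinsicDistE K.space (e x) (e y)

namespace CopSphere

/-- `K` is an abstract simplicial complex: a down-closed family of nonempty finite sets. -/
structure IsComplex {V : Type*} (K : Set (Finset V)) : Prop where
  nonempty : ∀ s ∈ K, s.Nonempty
  down : ∀ s ∈ K, ∀ t ⊆ s, t.Nonempty → t ∈ K

/-- The support of a function on a finite type, as a finset. -/
noncomputable def supp {V : Type*} [Fintype V] (x : V → ℝ) : Finset V :=
  Finset.univ.filter fun i => x i ≠ 0

@[simp] lemma mem_supp {V : Type*} [Fintype V] {x : V → ℝ} {i : V} : i ∈ supp x ↔ x i ≠ 0 := by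
  simp [supp]

/-- The geometric realization of `K` in barycentric coordinates. -/
def realization {V : Type*} [Fintype V] (K : Set (Finset V)) : Set (V → ℝ) :=
  {x | (∀ i, 0 ≤ x i) ∧ ∑ i, x i = 1 ∧ supp x ∈ K}

/-! ### Relabelling vertices -/

section Relabel

variable {V W : Type*}

/-- The complex obtained by relabelling the vertices along an embedding. -/
def relabel (K : Set (Finset V)) (e : V ↪ W) : Set (Finset W) :=
  {s | ∃ t ∈ K, t.map e = s}

lemma map_mem_relabel {K : Set (Finset V)} {e : V ↪ W} {s : Finset V} :
    s.map e ∈ relabel K e ↔ s ∈ K := by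
  constructor
  · rintro ⟨t, ht, h⟩
    rwa [← Finset.map_injective e h]
  · exact fun h => ⟨s, h, rfl⟩

lemma IsComplex.relabel {K : Set (Finset V)} (hK : IsComplex K) (e : V ↪ W) :
    IsComplex (relabel K e) := by
  constructor
  · rintro _ ⟨t, ht, rfl⟩
    simpa using hK.nonempty t ht
  · rintro _ ⟨t, ht, rfl⟩ s hs hne
    obtain ⟨u, hu, rfl⟩ := Finset.subset_map_iff.1 hs
    exact ⟨u, hK.down t ht u hu (by simpa using hne), rfl⟩

variable [Fintype V] [Fintype W]

lemma nonempty_homeomorph_relabel (K : Set (Finset V)) (e : V ↪ W) :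
    Nonempty (realization (relabel K e) ≃ₜ realization K) := by
  classical
  let F : (W → ℝ) → V → ℝ := fun y i => y (e i)
  let G : (V → ℝ) → W → ℝ := fun x j => ∑ i, if e i = j then x i else 0
  have hGe : ∀ x i, G x (e i) = x i := fun x i => by simp [G]
  have hG0 : ∀ x j, j ∉ Set.range e → G x j = 0 := fun x j hj =>
    Finset.sum_eq_zero fun i _ => if_neg fun h => hj ⟨i, h⟩
  have hsG : ∀ x, supp (G x) = (supp x).map e := by
    intro x
    ext j
    by_cases hj : j ∈ Set.range e
    · obtain ⟨i, rfl⟩ := hj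
      simp [hGe]
    · simp only [mem_supp, hG0 x j hj, Finset.mem_map]
      simp only [ne_eq, not_true_eq_false, false_iff]
      rintro ⟨i, -, rfl⟩
      exact hj ⟨i, rfl⟩
  have hzero : ∀ y ∈ realization (relabel K e), ∀ j, j ∉ Set.range e → y j = 0 := by
    rintro y ⟨-, -, t, -, h⟩ j hj
    by_contra h0
    have : j ∈ t.map e := by rw [h]; simpa using h0
    obtain ⟨i, -, rfl⟩ := Finset.mem_map.1 this
    exact hj ⟨i, rfl⟩
  have hGF : ∀ y ∈ realization (relabel K e), G (F y) = y := by
    intro y hy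
    funext j
    by_cases hj : j ∈ Set.range e
    · obtain ⟨i, rfl⟩ := hj
      rw [hGe]
    · rw [hG0 _ j hj, hzero y hy j hj]
  have hsum : ∀ x, ∑ j, G x j = ∑ i, x i := by
    intro x
    simp only [G]
    rw [Finset.sum_comm]
    simp
  refine ⟨⟨⟨fun y => ⟨F y, ?_⟩, fun x => ⟨G x, ?_⟩, ?_, ?_⟩, ?_, ?_⟩⟩
  · obtain ⟨y, hy⟩ := y
    have h := hGF y hy
    refine ⟨fun i => hy.1 _, ?_, ?_⟩
    · rw [← hsum, h]
      exact hy.2.1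
    · rw [← map_mem_relabel (e := e), ← hsG, h]
      exact hy.2.2
  · obtain ⟨x, hx⟩ := x
    refine ⟨fun j => ?_, ?_, ?_⟩
    · refine Finset.sum_nonneg fun i _ => ?_
      split_ifs
      exacts [hx.1 i, le_rfl]
    · rw [hsum]
      exact hx.2.1
    · rw [hsG, map_mem_relabel]
      exact hx.2.2
  · rintro ⟨y, hy⟩
    exact Subtype.ext (hGF y hy)
  · rintro ⟨x, hx⟩
    exact Subtype.ext (funext fun i => hGe x i)
  · refine Continuous.subtype_mk ?_ _
    fun_prop
  · refine Continuous.subtype_mk ?_ _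
    refine continuous_pi fun j => continuous_finsetSum _ fun i _ => ?_
    split_ifs
    · exact (continuous_apply i).comp continuous_subtype_val
    · exact continuous_const

end Relabel

/-! ### Stellar subdivision -/

section Stellar

variable {V : Type*} [DecidableEq V]

/-- The stellar subdivision of `K` at the face `f`, with new vertex `x`. -/
def stellar (K : Set (Finset V)) (f : Finset V) (x : V) : Set (Finset V) :=
  {s | (x ∉ s ∧ s ∈ K ∧ ¬ f ⊆ s) ∨ (x ∈ s ∧ s.erase x ∪ f ∈ K ∧ ¬ f ⊆ s.erase x)}

lemma IsComplex.stellar {K : Set (Finset V)} (hK : IsComplex K) {f : Finset V} {x : V}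
    (hfne : f.Nonempty) :
    IsComplex (stellar K f x) := by
  constructor
  · rintro s (⟨-, h, -⟩ | ⟨h, -⟩)
    exacts [hK.nonempty s h, ⟨x, h⟩]
  · rintro s (⟨hx, h, hf⟩ | ⟨hx, h, hf⟩) t hts hne
    · exact Or.inl ⟨fun h' => hx (hts h'), hK.down s h t hts hne, fun h' => hf (h'.trans hts)⟩
    · by_cases hxt : x ∈ t
      · exact Or.inr ⟨hxt, hK.down _ h _
          (Finset.union_subset_union_left (Finset.erase_subset_erase x hts))
          (hfne.mono Finset.subset_union_right),
          fun h' => hf (h'.trans (Finset.erase_subset_erase x hts))⟩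
      · have : t ⊆ s.erase x := fun i hi =>
          Finset.mem_erase.2 ⟨fun h => hxt (h ▸ hi), hts hi⟩
        exact Or.inl ⟨hxt, hK.down _ h _ (this.trans Finset.subset_union_left) hne,
          fun h' => hf (h'.trans this)⟩

lemma card_le_of_mem_stellar {K : Set (Finset V)} {n : ℕ} (hn : ∀ s ∈ K, s.card ≤ n)
    {f : Finset V} {x : V} {s : Finset V} (hs : s ∈ stellar K f x) : s.card ≤ n := by
  obtain ⟨-, h, -⟩ | ⟨hx, h, hf⟩ := hs
  · exact hn s h
  · have h1 : (s.erase x).card < (s.erase x ∪ f).card :=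
      Finset.card_lt_card ⟨Finset.subset_union_left, fun h' => hf (Finset.subset_union_right.trans h')⟩
    have := hn _ h
    have := Finset.card_erase_add_one hx
    omega

variable [Fintype V]

lemma nonempty_homeomorph_stellar {K : Set (Finset V)} (hK : IsComplex K) {f : Finset V} {x : V}
    (hf : f ∈ K) (hx : ∀ s ∈ K, x ∉ s) :
    Nonempty (realization (stellar K f x) ≃ₜ realization K) := by
  have hfne := hK.nonempty f hf
  have hxf := hx f hf
  have hc : (0 : ℝ) < f.card := by exact_mod_cast hfne.card_pos
  let F : (V → ℝ) → V → ℝ := fun y i =>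
    if i = x then 0 else y i + if i ∈ f then y x / f.card else 0
  let m : (V → ℝ) → ℝ := fun z => f.inf' hfne z
  let G : (V → ℝ) → V → ℝ := fun z i =>
    if i = x then f.card * m z else z i - if i ∈ f then m z else 0
  have hne : ∀ i ∈ f, i ≠ x := fun i hi h => hxf (h ▸ hi)
  have hsum : ∀ g : V → ℝ, ∀ c : ℝ, ∑ i ∈ Finset.univ.erase x, (g i + if i ∈ f then c else 0) =
      ∑ i ∈ Finset.univ.erase x, g i + f.card * c := by
    intro g c
    rw [Finset.sum_add_distrib, ← Finset.sum_filter]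
    have : (Finset.univ.erase x).filter (· ∈ f) = f := by
      ext i; simp only [Finset.mem_filter, Finset.mem_erase, Finset.mem_univ, and_true]
      exact ⟨fun h => h.2, fun h => ⟨hne i h, h⟩⟩
    rw [this]; simp
  have hF : ∀ y ∈ realization (stellar K f x), F y ∈ realization K := by
    rintro y ⟨h0, h1, h2⟩
    refine ⟨fun i => ?_, ?_, ?_⟩
    · have := h0 i
      have := div_nonneg (h0 x) hc.le
      simp only [F]; split_ifs <;> linarith
    · rw [← Finset.add_sum_erase _ _ (Finset.mem_univ x)] at h1 ⊢
      have : ∑ i ∈ Finset.univ.erase x, F y i =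
          ∑ i ∈ Finset.univ.erase x, (y i + if i ∈ f then y x / f.card else 0) :=
        Finset.sum_congr rfl fun i hi => by simp [F, Finset.ne_of_mem_erase hi]
      rw [this, hsum, mul_div_cancel₀ _ hc.ne']
      simp only [F, if_true]; linarith
    · obtain ⟨hxs, hs, -⟩ | ⟨hxs, hs, -⟩ := h2
      · convert hs using 1
        have hyx : y x = 0 := by simpa using hxs
        ext i
        by_cases hi : i = x
        · simp [F, hi, hyx]
        · simp [F, hi, hyx]
      · convert hs using 1
        have hyx : 0 < y x := lt_of_le_of_ne (h0 x) (by simpa [eq_comm] using hxs)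
        have := div_pos hyx hc
        ext i
        by_cases hi : i = x
        · simp [F, hi, hxf]
        · by_cases hif : i ∈ f
          · have := h0 i
            simp only [mem_supp, F, hi, hif, if_true, if_false, Finset.mem_union, or_true, iff_true]
            positivity
          · simp [F, hi, hif]
  have hzx : ∀ z ∈ realization K, z x = 0 := by
    rintro z ⟨-, -, h⟩
    simpa using hx _ h
  have hm0 : ∀ z ∈ realization K, 0 ≤ m z := fun z hz => Finset.le_inf' _ _ fun i _ => hz.1 i
  have hmle : ∀ z, ∀ i ∈ f, m z ≤ z i := fun z i hi => Finset.inf'_le _ hi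
  have hG : ∀ z ∈ realization K, G z ∈ realization (stellar K f x) := by
    intro z hz
    have hm := hm0 z hz
    have hzx := hzx z hz
    obtain ⟨j, hjf, hj⟩ := Finset.exists_mem_eq_inf' hfne z
    change m z = z j at hj
    obtain ⟨h0, h1, h2⟩ := hz
    refine ⟨fun i => ?_, ?_, ?_⟩
    · have := h0 i
      have := hmle z i
      simp only [G]; split_ifs with h h'
      · positivity
      · linarith [this h']
      · linarith
    · rw [← Finset.add_sum_erase _ _ (Finset.mem_univ x)] at h1 ⊢
      have : ∑ i ∈ Finset.univ.erase x, G z i =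
          ∑ i ∈ Finset.univ.erase x, (z i + if i ∈ f then - m z else 0) :=
        Finset.sum_congr rfl fun i hi => by
          simp only [G, Finset.ne_of_mem_erase hi, if_false]; split_ifs <;> ring
      rw [this, hsum]
      simp only [G, if_true]; linarith
    · rcases hm.eq_or_lt with hm' | hm'
      · left
        have : supp (G z) = supp z := by
          ext i
          by_cases hi : i = x
          · simp [G, hi, ← hm', hzx]
          · simp [G, hi, ← hm']
        rw [this]
        refine ⟨by simp [hzx], h2, fun h => ?_⟩
        have := h hjf
        simp only [mem_supp] at this
        exact this (hj ▸ hm'.symm)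
      · right
        refine ⟨by simp [G, hm'.ne', hc.ne'], ?_, fun h => ?_⟩
        · convert h2 using 1
          ext i
          by_cases hi : i = x
          · simp [hi, hxf, hzx]
          · by_cases hif : i ∈ f
            · simpa [hif] using (hm'.trans_le (hmle z i hif)).ne'
            · simp [G, hi, hif]
        · have := h hjf
          simp [G, hne j hjf, hjf, hj] at this
  have hGF : ∀ y ∈ realization (stellar K f x), G (F y) = y := by
    rintro y ⟨h0, h1, h2⟩
    have hm : m (F y) = y x / f.card := by
      obtain ⟨j, hjf, hj⟩ : ∃ j ∈ f, y j = 0 := by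
        obtain ⟨-, hs, hf'⟩ | ⟨hxs, hs, hf'⟩ := h2
        · obtain ⟨j, hj, hj'⟩ := Finset.not_subset.1 hf'
          exact ⟨j, hj, by simpa using hj'⟩
        · obtain ⟨j, hj, hj'⟩ := Finset.not_subset.1 hf'
          exact ⟨j, hj, by simpa [hne j hj] using hj'⟩
      refine le_antisymm ?_ (Finset.le_inf' _ _ fun i hi => ?_)
      · refine (hmle _ j hjf).trans ?_
        simp [F, hne j hjf, hjf, hj]
      · have := h0 i
        simp [F, hne i hi, hi]
        exact this
    funext i
    by_cases hi : i = x
    · simp only [G, hi, if_true, hm]; field_simp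
    · simp only [G, hi, if_false, hm]
      simp [F, hi]
  have hFG : ∀ z ∈ realization K, F (G z) = z := by
    intro z hz
    funext i
    by_cases hi : i = x
    · simp [F, hi, hzx z hz]
    · by_cases hif : i ∈ f
      · simp [F, G, hi, hif, hc.ne']
      · simp [F, G, hi, hif]
  refine ⟨⟨⟨fun y => ⟨F y, hF y y.2⟩, fun z => ⟨G z, hG z z.2⟩, fun y => Subtype.ext (hGF y y.2),
    fun z => Subtype.ext (hFG z z.2)⟩, ?_, ?_⟩⟩
  · refine Continuous.subtype_mk ?_ _
    refine continuous_pi fun i => ?_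
    have hv : ∀ j, Continuous fun y : realization (stellar K f x) => (y : V → ℝ) j := fun j =>
      (continuous_apply j).comp continuous_subtype_val
    simp only [F]
    split_ifs
    exacts [continuous_const, (hv i).add ((hv x).div_const _), (hv i).add continuous_const]
  · have hmc : Continuous m := Continuous.finset_inf'_apply hfne fun i _ => continuous_apply i
    refine Continuous.subtype_mk ?_ _
    refine continuous_pi fun i => ?_
    have hv : Continuous fun z : realization K => (z : V → ℝ) i :=
      (continuous_apply i).comp continuous_subtype_val
    have hm' : Continuous fun z : realization K => m z := hmc.comp continuous_subtype_val
    simp only [G]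
    split_ifs
    exacts [continuous_const.mul hm', hv.sub hm', hv.sub continuous_const]

end Stellar

/-! ### Relative barycentric subdivision -/

section Subdivision

variable {V : Type*}

/-- The barycentric subdivision of `K` relative to the complement of the up-closed family `H`:
only the faces in `H` are subdivided. -/
def subdivision (K H : Set (Finset V)) : Set (Finset (V ⊕ Finset V)) :=
  {s | s.Nonempty ∧ (s.toLeft.Nonempty → s.toLeft ∈ K ∧ s.toLeft ∉ H) ∧ (∀ σ, .inr σ ∈ s → σ ∈ H) ∧
    (∀ σ τ, .inr σ ∈ s → .inr τ ∈ s → σ ⊆ τ ∨ τ ⊆ σ) ∧ ∀ σ, .inr σ ∈ s → s.toLeft ⊆ σ}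

lemma subdivision_empty {K : Set (Finset V)} (hK : IsComplex K) :
    subdivision K ∅ = relabel K .inl := by
  ext s
  constructor
  · rintro ⟨⟨a, ha⟩, h1, h2, -⟩
    have hs : s.toLeft.map .inl = s := by
      ext (b | σ)
      · simp
      · simpa using fun h => h2 σ h
    refine ⟨s.toLeft, (h1 ?_).1, hs⟩
    rcases a with a | σ
    · exact ⟨a, by simpa using ha⟩
    · exact (h2 σ ha).elim
  · rintro ⟨t, ht, rfl⟩
    have : (t.map (.inl : V ↪ V ⊕ Finset V)).toLeft = t := by ext; simp
    refine ⟨by simpa using hK.nonempty t ht, fun _ => ?_, by simp, by simp, by simp⟩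
    rw [this]
    exact ⟨ht, fun h => h⟩

variable [DecidableEq V]

lemma stellar_subdivision {K H : Set (Finset V)} (hK : IsComplex K) {f : Finset V}
    (hf : f ∈ K) (hfH : f ∉ H) (hH : ∀ σ ∈ H, ∀ τ ∈ K, σ ⊆ τ → τ ∈ H)
    (hfup : ∀ τ ∈ K, f ⊆ τ → τ ≠ f → τ ∈ H) :
    stellar (subdivision K H) (f.map .inl) (.inr f) = subdivision K (insert f H) := by
  have hfne := hK.nonempty f hf
  ext s
  have hsub : ∀ u : Finset (V ⊕ Finset V), f.map .inl ⊆ u ↔ f ⊆ u.toLeft := fun u =>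
    Finset.map_inl_subset_iff_subset_toLeft
  have htl : (s.erase (.inr f)).toLeft = s.toLeft := by ext; simp
  have htl' : (s.erase (.inr f) ∪ f.map .inl).toLeft = s.toLeft ∪ f := by ext; simp
  have hmr : ∀ σ, .inr σ ∈ s.erase (.inr f) ∪ f.map .inl ↔ σ ≠ f ∧ .inr σ ∈ s := by simp
  by_cases hfs : Sum.inr f ∈ s
  · have : s ∈ stellar (subdivision K H) (f.map .inl) (.inr f) ↔
        s.erase (.inr f) ∪ f.map .inl ∈ subdivision K H ∧ ¬ f ⊆ s.toLeft := by
      simp only [stellar, Set.mem_ofPred_eq, hfs, not_true_eq_false, false_and, false_or, true_and,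
        hsub, htl]
    rw [this]
    constructor
    · rintro ⟨⟨-, h1, h2, h3, h4⟩, h5⟩
      rw [htl'] at h1 h4
      simp only [hmr] at h2 h3 h4
      obtain ⟨h1, h1'⟩ := h1 (hfne.mono Finset.subset_union_right)
      have hlf : s.toLeft ∪ f = f := by
        by_contra hne
        exact h1' (hfup _ h1 Finset.subset_union_right hne)
      have hlf : s.toLeft ⊆ f := by rw [← hlf]; exact Finset.subset_union_left
      refine ⟨⟨_, hfs⟩, fun hne => ⟨hK.down f hf _ hlf hne, ?_⟩, fun σ hσ => ?_,
        fun σ τ hσ hτ => ?_, fun σ hσ => ?_⟩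
      · rintro (h | h)
        · exact h5 h.ge
        · exact hfH (hH _ h _ hf hlf)
      · by_cases h : σ = f
        · exact Or.inl h
        · exact Or.inr (h2 σ ⟨h, hσ⟩)
      · by_cases h : σ = f
        · by_cases h' : τ = f
          · exact Or.inl (h.trans h'.symm).le
          · exact Or.inl (h ▸ (Finset.union_subset_right (h4 τ ⟨h', hτ⟩)))
        · by_cases h' : τ = f
          · exact Or.inr (h' ▸ (Finset.union_subset_right (h4 σ ⟨h, hσ⟩)))
          · exact h3 σ τ ⟨h, hσ⟩ ⟨h', hτ⟩
      · by_cases h : σ = f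
        · exact h ▸ hlf
        · exact Finset.union_subset_left (h4 σ ⟨h, hσ⟩)
    · rintro ⟨-, h1, h2, h3, h4⟩
      have hlf : s.toLeft ∪ f = f := Finset.union_eq_right.2 (h4 f hfs)
      refine ⟨⟨?_, ?_, ?_, ?_, ?_⟩, fun h => ?_⟩
      · obtain ⟨a, ha⟩ := hfne
        exact ⟨.inl a, by simp [ha]⟩
      · rw [htl', hlf]
        exact fun _ => ⟨hf, hfH⟩
      · simp only [hmr]
        exact fun σ hσ => (h2 σ hσ.2).resolve_left hσ.1
      · simp only [hmr]
        exact fun σ τ hσ hτ => h3 σ τ hσ.2 hτ.2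
      · rw [htl', hlf]
        simp only [hmr]
        rintro σ ⟨hne, hσ⟩
        exact (h3 f σ hfs hσ).resolve_right fun h =>
          hfH (hH _ ((h2 σ hσ).resolve_left hne) f hf h)
      · exact (h1 (hfne.mono h)).2 (Or.inl (le_antisymm (h4 f hfs) h))
  · have : s ∈ stellar (subdivision K H) (f.map .inl) (.inr f) ↔
        s ∈ subdivision K H ∧ ¬ f ⊆ s.toLeft := by
      simp only [stellar, Set.mem_ofPred_eq, hfs, not_false_eq_true, false_and, or_false, true_and,
        hsub]
    rw [this]
    constructor
    · rintro ⟨⟨h0, h1, h2, h3, h4⟩, h5⟩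
      refine ⟨h0, fun hne => ⟨(h1 hne).1, ?_⟩, fun σ hσ => Or.inr (h2 σ hσ), h3, h4⟩
      rintro (h | h)
      exacts [h5 h.ge, (h1 hne).2 h]
    · rintro ⟨h0, h1, h2, h3, h4⟩
      refine ⟨⟨h0, fun hne => ⟨(h1 hne).1, fun h => (h1 hne).2 (Or.inr h)⟩, fun σ hσ =>
        (h2 σ hσ).resolve_left ?_, h3, h4⟩, fun h => ?_⟩
      · rintro rfl
        exact hfs hσ
      · obtain ⟨h6, h7⟩ := h1 (hfne.mono h)
        by_cases h8 : s.toLeft = f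
        · exact h7 (Or.inl h8)
        · exact h7 (Or.inr (hfup _ h6 h h8))

variable [Fintype V]

theorem subdivision_spec {K : Set (Finset V)} (hK : IsComplex K) {n : ℕ}
    (hn : ∀ s ∈ K, s.card ≤ n) (H : Finset (Finset V)) (hHK : ∀ σ ∈ H, σ ∈ K)
    (hH : ∀ σ ∈ H, ∀ τ ∈ K, σ ⊆ τ → τ ∈ H) :
    IsComplex (subdivision K (H : Set (Finset V))) ∧
      (∀ s ∈ subdivision K (H : Set (Finset V)), s.card ≤ n) ∧
      Nonempty (realization (subdivision K (H : Set (Finset V))) ≃ₜ realization K) := by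
  induction h : H.card generalizing H with
  | zero =>
    rw [Finset.card_eq_zero] at h
    subst h
    rw [Finset.coe_empty, subdivision_empty hK]
    refine ⟨hK.relabel _, ?_, nonempty_homeomorph_relabel _ _⟩
    rintro _ ⟨t, ht, rfl⟩
    simpa using hn t ht
  | succ c ih =>
    obtain ⟨f, hfH, hmin⟩ := Finset.exists_min_image H Finset.card (Finset.card_pos.1 (by omega))
    have hfK := hHK f hfH
    have hfne := hK.nonempty f hfK
    have key : ∀ σ ∈ H.erase f, ∀ τ ∈ K, σ ⊆ τ → τ ∈ H.erase f := by
      intro σ hσ τ hτ hστ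
      refine Finset.mem_erase.2 ⟨?_, hH σ (Finset.mem_of_mem_erase hσ) τ hτ hστ⟩
      rintro rfl
      exact Finset.ne_of_mem_erase hσ
        (Finset.eq_of_subset_of_card_le hστ (hmin σ (Finset.mem_of_mem_erase hσ)))
    obtain ⟨h1, h2, ⟨φ⟩⟩ := ih (H.erase f) (fun σ hσ => hHK σ (Finset.mem_of_mem_erase hσ)) key
      (by rw [Finset.card_erase_of_mem hfH]; omega)
    have heq : subdivision K (H : Set (Finset V)) =
        stellar (subdivision K (H.erase f : Finset (Finset V))) (f.map .inl) (.inr f) := by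
      rw [stellar_subdivision hK hfK (by simp) (by exact_mod_cast key)]
      · rw [← Finset.coe_insert, Finset.insert_erase hfH]
      · intro τ hτ hfτ hne
        exact Finset.mem_coe.2 (Finset.mem_erase.2 ⟨hne, hH f hfH τ hτ hfτ⟩)
    rw [heq]
    have hmem : f.map .inl ∈ subdivision K (H.erase f : Finset (Finset V)) := by
      have : (f.map (.inl : V ↪ V ⊕ Finset V)).toLeft = f := by ext; simp
      refine ⟨by simpa using hfne, fun _ => ?_, by simp, by simp, by simp⟩
      rw [this]
      exact ⟨hfK, by simp⟩
    obtain ⟨ψ⟩ := nonempty_homeomorph_stellar h1 hmem (x := .inr f) (by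
      rintro s ⟨-, -, h, -⟩ hs
      simpa using h f hs)
    exact ⟨h1.stellar (by simpa using hfne), fun s hs => card_le_of_mem_stellar h2 hs,
      ⟨ψ.trans φ⟩⟩

end Subdivision

/-! ### The boundary complex of the cross-polytope -/

section CrossPolytope

/-- The boundary complex of the four-dimensional cross-polytope. -/
def crossPolytope : Set (Finset (Fin 4 × Bool)) :=
  {s | s.Nonempty ∧ ∀ i, ¬ ((i, true) ∈ s ∧ (i, false) ∈ s)}

lemma isComplex_crossPolytope : IsComplex crossPolytope :=
  ⟨fun _ hs => hs.1, fun _ hs _ ht hne => ⟨hne, fun i hi => hs.2 i ⟨ht hi.1, ht hi.2⟩⟩⟩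

lemma card_le_of_mem_crossPolytope {s : Finset (Fin 4 × Bool)} (hs : s ∈ crossPolytope) :
    s.card ≤ 4 := by
  have h : Set.InjOn Prod.fst (s : Set (Fin 4 × Bool)) := by
    rintro ⟨i, b⟩ hb ⟨j, c⟩ hc rfl
    have := hs.2 i
    cases b <;> cases c <;> simp_all
  calc s.card = (s.image Prod.fst).card := (Finset.card_image_of_injOn h).symm
    _ ≤ _ := by simpa using Finset.card_le_univ (s.image Prod.fst)

lemma nonempty_homeomorph_crossPolytope :
    Nonempty (realization crossPolytope ≃ₜ Metric.sphere (0 : EuclideanSpace ℝ (Fin 4)) 1) := by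
  let S : (Fin 4 × Bool → ℝ) → EuclideanSpace ℝ (Fin 4) :=
    fun x => WithLp.toLp 2 fun i => x (i, true) - x (i, false)
  let P : (Fin 4 → ℝ) → Fin 4 × Bool → ℝ :=
    fun y p => max (if p.2 then y p.1 else - y p.1) 0
  have hcS : Continuous S := by fun_prop
  have hcP : Continuous P := by
    refine continuous_pi fun p => ?_
    rcases p with ⟨i, _ | _⟩ <;> simp only [P] <;> simp <;> fun_prop
  have hzero : ∀ x ∈ realization crossPolytope, ∀ i, x (i, true) = 0 ∨ x (i, false) = 0 := by
    rintro x ⟨-, -, -, hx⟩ i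
    simpa [or_iff_not_imp_left] using hx i
  have hPS : ∀ x ∈ realization crossPolytope, P (S x) = x := by
    intro x hx
    funext ⟨i, b⟩
    have := hx.1 (i, true)
    have := hx.1 (i, false)
    rcases hzero x hx i with h | h <;> cases b <;> simp_all [P, S]
  have hSP : ∀ y, S (P y) = WithLp.toLp 2 y := by
    intro y
    ext i
    rcases le_total (y i) 0 with h | h <;> simp [S, P, h]
  have hsumP : ∀ y, ∑ p, P y p = ∑ i, |y i| := by
    intro y
    rw [Fintype.sum_prod_type]
    refine Finset.sum_congr rfl fun i _ => ?_
    rcases le_total (y i) 0 with h | h <;> simp [P, h, abs_of_nonneg, abs_of_nonpos]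
  have hsm : ∀ (c : ℝ) (y : Fin 4 → ℝ), 0 ≤ c → P (c • y) = c • P y := by
    intro c y hc
    funext ⟨i, b⟩
    cases b <;> simp only [P] <;> simp
    · rw [mul_max_of_nonneg _ _ hc]; simp
    · rw [mul_max_of_nonneg _ _ hc]; simp
  have hPmem : ∀ y : Fin 4 → ℝ, ∑ i, |y i| = 1 → P y ∈ realization crossPolytope := by
    intro y hy
    refine ⟨fun p => le_max_right _ _, by rw [hsumP, hy], ?_, fun i => ?_⟩
    · by_contra h
      have h0 : ∀ p, P y p = 0 := by
        intro p
        by_contra hp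
        exact h ⟨p, by simpa using hp⟩
      rw [← hsumP] at hy
      simp [h0] at hy
    · rcases le_total (y i) 0 with h | h <;> simp [P, h]
  have hS0 : ∀ x ∈ realization crossPolytope, S x ≠ 0 := by
    intro x hx h
    have h1 := hx.2.1
    rw [← hPS x hx, hsumP, h] at h1
    simp at h1
  have hl1 : ∀ y : EuclideanSpace ℝ (Fin 4), y ≠ 0 → 0 < ∑ i, |y i| := by
    intro y hy
    refine lt_of_le_of_ne (Finset.sum_nonneg fun i _ => abs_nonneg _) fun h => hy ?_
    ext i
    simpa using (Finset.sum_eq_zero_iff_of_nonneg fun i _ => abs_nonneg _).1 h.symm i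
      (Finset.mem_univ i)
  refine ⟨{ toFun := fun x => ⟨‖S x‖⁻¹ • S x, ?_⟩
            invFun := fun y => ⟨P ((∑ i, |y.1 i|)⁻¹ • WithLp.ofLp y.1), hPmem _ ?_⟩
            left_inv := ?_
            right_inv := ?_
            continuous_toFun := ?_
            continuous_invFun := ?_ }⟩
  · have := norm_pos_iff.2 (hS0 x x.2)
    simp [norm_smul, this.ne']
  · have hy := hl1 y (ne_zero_of_mem_unit_sphere y)
    simp only [Pi.smul_apply, smul_eq_mul, abs_mul, abs_inv, abs_of_pos hy, ← Finset.mul_sum]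
    exact inv_mul_cancel₀ hy.ne'
  · rintro ⟨x, hx⟩
    apply Subtype.ext
    have hn := norm_pos_iff.2 (hS0 x hx)
    have h1 : ∑ i, |S x i| = 1 := by rw [← hsumP, hPS x hx, hx.2.1]
    have h2 : ∑ i, |(‖S x‖⁻¹ • S x) i| = ‖S x‖⁻¹ := by
      simp only [PiLp.smul_apply, smul_eq_mul, abs_mul, ← Finset.mul_sum, h1]
      simp
    have h3 : (‖S x‖⁻¹)⁻¹ • WithLp.ofLp (‖S x‖⁻¹ • S x) = WithLp.ofLp (S x) := by
      rw [WithLp.ofLp_smul, smul_smul, inv_mul_cancel₀ (by positivity), one_smul]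
    simp only [h2, h3, hPS x hx]
  · rintro ⟨y, hy⟩
    apply Subtype.ext
    have h0 := hl1 y (ne_zero_of_mem_unit_sphere ⟨y, hy⟩)
    have hy1 : ‖y‖ = 1 := by simpa using hy
    simp only [hSP, WithLp.toLp_smul, WithLp.toLp_ofLp, norm_smul, hy1, Real.norm_eq_abs,
      abs_of_pos (inv_pos.2 h0), smul_smul]
    rw [mul_one, inv_mul_cancel₀ (by positivity), one_smul]
  · have h : Continuous fun x : realization crossPolytope => S x := hcS.comp continuous_subtype_val
    exact ((h.norm.inv₀ fun x => (norm_pos_iff.2 (hS0 x x.2)).ne').smul h).subtype_mk _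
  · have h : Continuous fun y : Metric.sphere (0 : EuclideanSpace ℝ (Fin 4)) 1 => ∑ i, |y.1 i| := by
      fun_prop
    have h' : Continuous fun y : Metric.sphere (0 : EuclideanSpace ℝ (Fin 4)) 1 =>
        WithLp.ofLp y.1 := by fun_prop
    exact (hcP.comp ((h.inv₀ fun y => (hl1 y (ne_zero_of_mem_unit_sphere y)).ne').smul
      h')).subtype_mk _

end CrossPolytope

/-! ### Neighbourly triangulations of the 3-sphere -/

section Growth

/-- A triangulated 3-sphere with two disjoint sets of vertices `A`, `B` such that all edges between
them are present, together with a tetrahedron spanned by `p, q ∈ A` and `p', q' ∈ B`. -/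
structure IsCrossComplete {V : Type*} [Fintype V] [DecidableEq V] (K : Set (Finset V))
    (A B : Finset V) (p q p' q' : V) : Prop where
  isComplex : IsComplex K
  card_le : ∀ s ∈ K, s.card ≤ 4
  homeo : Nonempty (realization K ≃ₜ Metric.sphere (0 : EuclideanSpace ℝ (Fin 4)) 1)
  disj : ∀ a ∈ A, a ∉ B
  cross : ∀ a ∈ A, ∀ b ∈ B, {a, b} ∈ K
  hp : p ∈ A
  hq : q ∈ A
  hpq : p ≠ q
  hp' : p' ∈ B
  hq' : q' ∈ B
  hpq' : p' ≠ q'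
  left : ∀ a ∈ A, {a, p', q'} ∈ K
  right : ∀ b ∈ B, {b, p, q} ∈ K
  both : {p, q, p', q'} ∈ K

variable {V W : Type*} [Fintype V] [DecidableEq V] [Fintype W] [DecidableEq W]
  {K : Set (Finset V)} {A B : Finset V} {p q p' q' : V}

lemma IsCrossComplete.swap (h : IsCrossComplete K A B p q p' q') :
    IsCrossComplete K B A p' q' p q where
  isComplex := h.isComplex
  card_le := h.card_le
  homeo := h.homeo
  disj b hb ha := h.disj b ha hb
  cross b hb a ha := by rw [Finset.pair_comm]; exact h.cross a ha b hb
  hp := h.hp'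
  hq := h.hq'
  hpq := h.hpq'
  hp' := h.hp
  hq' := h.hq
  hpq' := h.hpq
  left := h.right
  right := h.left
  both := by
    convert h.both using 1
    ext x
    simp only [Finset.mem_insert, Finset.mem_singleton]
    tauto

lemma IsCrossComplete.relabel (h : IsCrossComplete K A B p q p' q') (e : V ↪ W) :
    IsCrossComplete (relabel K e) (A.map e) (B.map e) (e p) (e q) (e p') (e q') where
  isComplex := h.isComplex.relabel e
  card_le := by
    rintro _ ⟨t, ht, rfl⟩
    simpa using h.card_le t ht
  homeo := ⟨(nonempty_homeomorph_relabel K e).some.trans h.homeo.some⟩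
  disj := by simpa using h.disj
  cross := by
    simp only [Finset.mem_map, forall_exists_index, and_imp, forall_apply_eq_imp_iff₂]
    exact fun a ha b hb => ⟨_, h.cross a ha b hb, by simp⟩
  hp := by simpa using h.hp
  hq := by simpa using h.hq
  hpq := by simpa using h.hpq
  hp' := by simpa using h.hp'
  hq' := by simpa using h.hq'
  hpq' := by simpa using h.hpq'
  left := by
    simp only [Finset.mem_map, forall_exists_index, and_imp, forall_apply_eq_imp_iff₂]
    exact fun a ha => ⟨_, h.left a ha, by simp⟩
  right := by
    simp only [Finset.mem_map, forall_exists_index, and_imp, forall_apply_eq_imp_iff₂]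
    exact fun a ha => ⟨_, h.right a ha, by simp⟩
  both := ⟨_, h.both, by simp⟩

lemma IsCrossComplete.stellar (h : IsCrossComplete K A B p q p' q') {x : V}
    (hx : ∀ s ∈ K, x ∉ s) :
    IsCrossComplete (stellar K {p, q} x) (insert x A) B p x p' q' := by
  have hA : ∀ a ∈ A, a ≠ x := fun a ha hax => hx _ (h.cross a ha p' h.hp') (by simp [hax])
  have hB : ∀ b ∈ B, b ≠ x := fun b hb hbx => hx _ (h.cross p h.hp b hb) (by simp [hbx])
  have hAB : ∀ a ∈ A, ∀ b ∈ B, a ≠ b := fun a ha b hb hab => h.disj a ha (hab ▸ hb)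
  have hedge : {p, q} ∈ K := h.isComplex.down _ (h.right p' h.hp') _ (by simp) (by simp)
  have hAp := hA p h.hp
  have hAq := hA q h.hq
  have hBp := hB p' h.hp'
  have hBq := hB q' h.hq'
  have hpp := hAB p h.hp p' h.hp'
  have hpq := hAB p h.hp q' h.hq'
  have hqp := hAB q h.hq p' h.hp'
  have hqq := hAB q h.hq q' h.hq'
  have hne := h.hpq
  refine ⟨h.isComplex.stellar (by simp), fun s => card_le_of_mem_stellar h.card_le,
    ⟨(nonempty_homeomorph_stellar h.isComplex hedge hx).some.trans h.homeo.some⟩, ?_, ?_,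
    by simp [h.hp], by simp, hAp, h.hp', h.hq', h.hpq', ?_, ?_, ?_⟩
  · intro a ha hb
    rcases Finset.mem_insert.1 ha with rfl | ha
    exacts [hB a hb rfl, h.disj a ha hb]
  · intro a ha b hb
    have hb1 := hB b hb
    have := hAB p h.hp b hb
    have := hAB q h.hq b hb
    rcases Finset.mem_insert.1 ha with rfl | ha
    · refine Or.inr ⟨by simp, ?_, ?_⟩
      · convert h.right b hb using 1
        rw [Finset.erase_insert (by simpa using hb1.symm)]
        ext; simp; tauto
      · rw [Finset.erase_insert (by simpa using hb1.symm)]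
        exact fun hs => ‹p ≠ b› (by simpa using hs (Finset.mem_insert_self p _))
    · have := hA a ha
      refine Or.inl ⟨by simp; tauto, h.cross a ha b hb, ?_⟩
      simp [Finset.insert_subset_iff]
      grind
  · intro a ha
    rcases Finset.mem_insert.1 ha with rfl | ha
    · have he : ({a, p', q'} : Finset V).erase a = {p', q'} :=
        Finset.erase_insert (by simp; tauto)
      refine Or.inr ⟨by simp, ?_, ?_⟩ <;> rw [he]
      · convert h.both using 1
        ext; simp; tauto
      · simp [Finset.insert_subset_iff]
        tauto
    · have := hA a ha
      refine Or.inl ⟨by simp; tauto, h.left a ha, ?_⟩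
      simp [Finset.insert_subset_iff]
      grind
  · intro b hb
    have hb1 := hB b hb
    have := hAB p h.hp b hb
    have := hAB q h.hq b hb
    have he : ({b, p, x} : Finset V).erase x = {b, p} := by
      ext; simp; grind
    refine Or.inr ⟨by simp, ?_, ?_⟩ <;> rw [he]
    · convert h.right b hb using 1
      ext; simp
    · simp [Finset.insert_subset_iff]
      grind
  · have he : ({p, x, p', q'} : Finset V).erase x = {p, p', q'} := by
      ext; simp; grind
    refine Or.inr ⟨by simp, ?_, ?_⟩ <;> rw [he]
    · convert h.both using 1
      ext; simp; tauto
    · simp [Finset.insert_subset_iff]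
      grind

lemma IsCrossComplete.exists_card_le {V : Type} [Fintype V] [DecidableEq V] {K : Set (Finset V)}
    {A B : Finset V} {p q p' q' : V} (h : IsCrossComplete K A B p q p' q') (n : ℕ) :
    ∃ (W : Type) (_ : Fintype W) (_ : DecidableEq W) (L : Set (Finset W)) (A' B' : Finset W)
      (p q p' q' : W), IsCrossComplete L A' B' p q p' q' ∧ n ≤ A'.card ∧ B.card ≤ B'.card := by
  induction n with
  | zero => exact ⟨V, _, _, K, A, B, p, q, p', q', h, by simp, le_rfl⟩
  | succ n ih =>
    obtain ⟨W, _, _, L, A', B', p, q, p', q', hL, hA, hB⟩ := ih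
    have hn : ∀ s ∈ CopSphere.relabel L Function.Embedding.some, none ∉ s := by
      rintro _ ⟨t, ht, rfl⟩
      simp
    refine ⟨Option W, _, _, _, _, _, _, _, _, _, (hL.relabel .some).stellar hn, ?_, by simpa⟩
    rw [Finset.card_insert_of_notMem (by simp)]
    simpa

theorem exists_isCrossComplete (n : ℕ) :
    ∃ (V : Type) (_ : Fintype V) (_ : DecidableEq V) (K : Set (Finset V)) (A B : Finset V)
      (p q p' q' : V), IsCrossComplete K A B p q p' q' ∧ n ≤ A.card ∧ n ≤ B.card := by
  have h : IsCrossComplete crossPolytope {(0, true), (1, true)} {(2, true), (3, true)}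
      (0, true) (1, true) (2, true) (3, true) := by
    refine ⟨isComplex_crossPolytope, fun s => card_le_of_mem_crossPolytope,
      nonempty_homeomorph_crossPolytope, ?_, ?_, ?_, ?_, ?_, ?_, ?_, ?_, ?_, ?_, ?_⟩ <;>
    first | decide | simp [crossPolytope]
  obtain ⟨V, _, _, K, A, B, p, q, p', q', h, hA, -⟩ := h.exists_card_le n
  obtain ⟨W, _, _, L, A', B', p, q, p', q', h', hA', hB'⟩ := h.swap.exists_card_le n
  exact ⟨W, _, _, L, _, _, _, _, _, _, h', hA', hA.trans hB'⟩

end Growth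

/-! ### Finite bipartite regular graphs of large girth -/

section Girth

/-- Reduced words in `d` involutions of length at most `r`. -/
abbrev ReducedWord (d r : ℕ) : Type :=
  {l : List (Fin d) // l.length ≤ r ∧ l.IsChain (· ≠ ·)}

noncomputable instance (d r : ℕ) : Fintype (ReducedWord d r) :=
  ((List.finite_length_le (Fin d) r).subset fun _ h => h.1).fintype

/-- Left multiplication of a reduced word by a generator, truncated at length `r`. -/
def ReducedWord.mul {d r : ℕ} (i : Fin d) (l : ReducedWord d r) : ReducedWord d r :=
  if h : l.1.head? = some i then ⟨l.1.tail, (by simp; have := l.2.1; omega), l.2.2.tail⟩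
  else if h' : l.1.length < r then ⟨i :: l.1, by simpa using h',
    List.isChain_cons.2 ⟨fun y hy hi => h (hi ▸ hy), l.2.2⟩⟩
  else l

lemma ReducedWord.mul_involutive {d r : ℕ} (i : Fin d) :
    Function.Involutive (ReducedWord.mul (r := r) i) := by
  rintro ⟨l, hl, hc⟩
  rcases l with _ | ⟨j, l⟩
  · by_cases h : 0 < r <;> simp [ReducedWord.mul, h]
  · by_cases hj : j = i
    · subst hj
      have h1 : l.head? ≠ some j := fun h => (List.isChain_cons.1 hc).1 j h rfl
      have h2 : l.length < r := by simpa using hl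
      simp [ReducedWord.mul, h1, h2]
    · by_cases h : l.length + 1 < r <;> simp [ReducedWord.mul, hj, h]

/-- For every `d` and `r` there are `d` involutions on a finite two-coloured set which exchange the
colours, such that no nontrivial reduced word of length at most `r` has a fixed point. -/
theorem exists_involutions (d r : ℕ) :
    ∃ (A : Type) (_ : Fintype A) (_ : DecidableEq A) (side : A → Bool) (q : Fin d → A → A),
      Nonempty A ∧ (∀ i a, side (q i a) = !side a) ∧ (∀ i a, q i (q i a) = a) ∧
      ∀ w : List (Fin d), w ≠ [] → w.length ≤ r → w.IsChain (· ≠ ·) →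
        ∀ a, w.foldr q a ≠ a := by
  let P : Fin d → Equiv.Perm (ReducedWord d r) := fun i => (ReducedWord.mul_involutive i).toPerm
  refine ⟨Equiv.Perm (ReducedWord d r) × Bool, inferInstance, inferInstance, Prod.snd,
    fun i a => (P i * a.1, !a.2), inferInstance, fun i a => rfl, fun i a => ?_,
    fun w hw hr hc a ha => hw ?_⟩
  · have : P i * (P i * a.1) = a.1 := by
      ext x
      simp [P, Function.Involutive.coe_toPerm, ReducedWord.mul_involutive i _]
    simp [this]
  · have hP : ∀ i x, P i x = ReducedWord.mul i x := fun _ _ => rfl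
    have h1 : ∀ w : List (Fin d), (w.foldr (fun i a => (P i * a.1, !a.2)) a).1 =
        (w.map P).prod * a.1 := by
      intro w
      induction w with
      | nil => simp
      | cons i w ih => simp [ih, mul_assoc]
    have h2 : (w.map P).prod = 1 := by
      have := h1 w
      rw [ha] at this
      simpa using this.symm
    have h3 : ∀ (w : List (Fin d)) (hr : w.length ≤ r) (hc : w.IsChain (· ≠ ·)),
        (w.map P).prod ⟨[], by simp, by simp⟩ = ⟨w, hr, hc⟩ := by
      intro w
      induction w with
      | nil => simp
      | cons i w ih =>
        intro hr hc
        have hi := (List.isChain_cons.1 hc).1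
        have hr' : w.length < r := by simpa using hr
        have h4 : w.head? ≠ some i := fun h => hi i h rfl
        simp [hP, ih hr'.le (List.isChain_cons.1 hc).2, ReducedWord.mul, h4, hr']
    have h4 := h3 w hr hc
    rw [h2] at h4
    simpa using (congrArg Subtype.val h4).symm

end Girth

/-! ### Walks avoiding a vertex -/

section Walks

/-- `y` can be reached from `x` by at most `n` steps along the relation `E`. -/
def StepsWithin {V : Type*} (E : V → V → Prop) : ℕ → V → V → Prop
  | 0, x, y => x = y
  | n + 1, x, y => ∃ z, StepsWithin E n x z ∧ (z = y ∨ E z y)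

lemma StepsWithin.mono {V : Type*} {E : V → V → Prop} {m n : ℕ} {x y : V}
    (h : StepsWithin E m x y) (hmn : m ≤ n) : StepsWithin E n x y := by
  induction hmn with
  | refl => exact h
  | step _ ih => exact ⟨y, ih, .inl rfl⟩

lemma StepsWithin.map {V W : Type*} {E : V → V → Prop} {F : W → W → Prop} (f : V → W)
    (hf : ∀ x y, E x y → F (f x) (f y)) {n : ℕ} {x y : V} (h : StepsWithin E n x y) :
    StepsWithin F n (f x) (f y) := by
  induction n generalizing y with
  | zero => exact congrArg f h
  | succ n ih =>
    obtain ⟨z, hz, rfl | hE⟩ := h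
    exacts [⟨_, ih hz, .inl rfl⟩, ⟨_, ih hz, .inr (hf _ _ hE)⟩]

/-- Adjacency in the 1-skeleton of `K` with the vertex `v` removed. -/
def AdjAvoiding {V : Type*} [DecidableEq V] (K : Set (Finset V)) (v x y : V) : Prop :=
  x ≠ v ∧ y ≠ v ∧ {x, y} ∈ K

variable {A : Type*} {d : ℕ} {q : Fin d → A → A}

/-- Adjacency in the graph generated by the involutions `q i`, with the vertex `v` removed. -/
def OrbitAdjAvoiding (q : Fin d → A → A) (v a b : A) : Prop :=
  a ≠ v ∧ b ≠ v ∧ ∃ i, q i a = b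

lemma exists_word_of_stepsWithin (hq : ∀ i a, q i (q i a) = a) {v : A} {i : Fin d} {n : ℕ} {x : A}
    (hx : q i v ≠ v) (h : StepsWithin (OrbitAdjAvoiding q v) n (q i v) x) :
    ∃ w : List (Fin d), w.IsChain (· ≠ ·) ∧ w.getLast? = some i ∧ w.length ≤ n + 1 ∧
      w.foldr q v = x ∧ x ≠ v := by
  induction n generalizing x with
  | zero => exact ⟨[i], by simp, by simp, by simp, h, by rwa [← show q i v = x from h]⟩
  | succ n ih =>
    obtain ⟨z, hz, h⟩ := h
    obtain ⟨w, h1, h2, h3, h4, h5⟩ := ih hz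
    rcases h with rfl | ⟨-, hxv, j, rfl⟩
    · exact ⟨w, h1, h2, by omega, h4, h5⟩
    rcases w with _ | ⟨l, w⟩
    · simp at h2
    by_cases hl : l = j
    · subst hl
      have h6 : w.foldr q v = q l z := by rw [← h4]; simp [hq]
      refine ⟨w, (List.isChain_cons.1 h1).2, ?_, by simp at h3; omega, h6, hxv⟩
      rcases w with _ | ⟨m, w⟩
      · exact (hxv h6.symm).elim
      · simpa using h2
    · exact ⟨j :: l :: w, List.isChain_cons_cons.2 ⟨fun h => hl h.symm, h1⟩, by simpa using h2,
        by simpa using h3, by simp [← h4], hxv⟩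

lemma not_stepsWithin_orbitAdjAvoiding {r : ℕ} (hq : ∀ i a, q i (q i a) = a)
    (hr : ∀ w : List (Fin d), w ≠ [] → w.length ≤ r → w.IsChain (· ≠ ·) → ∀ a, w.foldr q a ≠ a)
    {v : A} {i j : Fin d} (hij : i ≠ j) {n : ℕ} (hn : n + 2 ≤ r) :
    ¬ StepsWithin (OrbitAdjAvoiding q v) n (q i v) (q j v) := by
  intro h
  have hx : q i v ≠ v := hr [i] (by simp) (by simp; omega) (by simp) v
  obtain ⟨w, h1, h2, h3, h4, h5⟩ := exists_word_of_stepsWithin hq hx h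
  rcases w with _ | ⟨l, w⟩
  · simp at h2
  by_cases hl : l = j
  · subst hl
    refine hr w ?_ (by simp at h3; omega) (List.isChain_cons.1 h1).2 v ?_
    · rintro rfl
      simp at h2
      exact hij h2.symm
    · have := congrArg (q l) h4
      simpa [hq] using this
  · refine hr (j :: l :: w) (by simp) (by simp at h3 ⊢; omega)
      (List.isChain_cons_cons.2 ⟨fun h => hl h.symm, h1⟩) v ?_
    rw [List.foldr_cons, h4, hq]

end Walks

/-! ### Iterated subdivision away from a graph -/

section Iteration

/-- The 1-skeleton of `K` contains the graph generated by the involutions `q i`, in such a way that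
short walks in `K` avoiding a vertex of the graph can be replaced by walks in the graph. -/
structure IsFarEmbedding {V A : Type*} [DecidableEq V] {d : ℕ} (K : Set (Finset V))
    (q : Fin d → A → A) (ι : A ↪ V) (n : ℕ) : Prop where
  edge : ∀ a i, {ι a, ι (q i a)} ∈ K
  steps : ∀ v m a b, m ≤ n → StepsWithin (AdjAvoiding K (ι v)) m (ι a) (ι b) →
    StepsWithin (OrbitAdjAvoiding q v) m a b

variable {V A : Type*} [DecidableEq V] {d : ℕ} {K : Set (Finset V)}
  {q : Fin d → A → A} {ι : A ↪ V} {n : ℕ}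

lemma IsFarEmbedding.subdivision (hK : IsComplex K) (hq : ∀ i a, q i (q i a) = a)
    (h : IsFarEmbedding K q ι n) {H : Set (Finset V)}
    (hH : ∀ σ, σ ∈ H ↔ σ ∈ K ∧ 2 ≤ σ.card ∧ ∀ a i, σ ≠ {ι a, ι (q i a)}) :
    IsFarEmbedding (subdivision K H) q (ι.trans .inl) (n + 1) := by
  have hll : ∀ x y : V, ({.inl x, .inl y} : Finset (V ⊕ Finset V)) ∈ CopSphere.subdivision K H ↔
      {x, y} ∈ K ∧ {x, y} ∉ H := by
    intro x y
    have hL : ({.inl x, .inl y} : Finset (V ⊕ Finset V)).toLeft = {x, y} := by ext; simp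
    simp [CopSphere.subdivision, hL]
  have hlr : ∀ (x : V) (σ : Finset V), ({.inl x, .inr σ} : Finset (V ⊕ Finset V)) ∈
      CopSphere.subdivision K H → σ ∈ H ∧ x ∈ σ := by
    rintro x σ ⟨-, -, h1, -, h2⟩
    exact ⟨h1 σ (by simp), h2 σ (by simp) (by simp)⟩
  have hrr : ∀ (σ τ : Finset V), ({.inr σ, .inr τ} : Finset (V ⊕ Finset V)) ∈
      CopSphere.subdivision K H → τ ∈ H ∧ (σ ⊆ τ ∨ τ ⊆ σ) := by
    rintro σ τ ⟨-, -, h1, h2, -⟩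
    exact ⟨h1 τ (by simp), h2 σ τ (by simp) (by simp)⟩
  have hpair : ∀ σ ∈ H, ∀ x ∈ σ, ∀ y ∈ σ, {x, y} ∈ K := fun σ hσ x hx y hy =>
    hK.down σ ((hH σ).1 hσ).1 _ (by simp [Finset.insert_subset_iff, hx, hy]) (by simp)
  constructor
  · intro a i
    rw [Function.Embedding.trans_apply, Function.Embedding.trans_apply]
    exact (hll _ _).2 ⟨h.edge a i, fun h' => ((hH _).1 h').2.2 a i rfl⟩
  intro v m a b hm hs
  have key : ∀ y, StepsWithin (AdjAvoiding (CopSphere.subdivision K H) (.inl (ι v))) m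
      (.inl (ι a)) y →
      (∃ b, y = .inl (ι b) ∧ StepsWithin (OrbitAdjAvoiding q v) m a b) ∨
      (∃ l x, m = l + 1 ∧ y = .inl x ∧ StepsWithin (AdjAvoiding K (ι v)) l (ι a) x) ∨
      (∃ l σ x, m = l + 1 ∧ y = .inr σ ∧ σ ∈ H ∧ x ∈ σ ∧ x ≠ ι v ∧
        StepsWithin (AdjAvoiding K (ι v)) l (ι a) x) := by
    clear hs hm
    induction m with
    | zero => exact fun y hy => .inl ⟨a, hy.symm, rfl⟩
    | succ m ih =>
      rintro y ⟨z, hz, hzy⟩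
      rcases ih z hz with ⟨b, rfl, hb⟩ | ⟨l, x, rfl, rfl, hx⟩ | ⟨l, σ, x, rfl, rfl, hσ, hxσ, hxv, hx⟩
      · rcases hzy with rfl | ⟨hbv, hyv, hby⟩
        · exact .inl ⟨b, rfl, hb.mono (by omega)⟩
        rcases y with y | σ
        · left
          rw [hll] at hby
          by_cases hby' : ι b = y
          · exact ⟨b, by rw [hby'], hb.mono (by omega)⟩
          have : ∃ c i, ({ι b, y} : Finset V) = {ι c, ι (q i c)} := by
            by_contra! hcon
            exact hby.2 ((hH _).2 ⟨hby.1, by rw [Finset.card_pair hby'], hcon⟩)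
          obtain ⟨c, i, hc⟩ := this
          have h1 : ι b ∈ ({ι c, ι (q i c)} : Finset V) := by rw [← hc]; simp
          have h2 : y ∈ ({ι c, ι (q i c)} : Finset V) := by rw [← hc]; simp
          have hy : y = ι (q i b) := by
            simp only [Finset.mem_insert, Finset.mem_singleton, EmbeddingLike.apply_eq_iff_eq]
              at h1 h2
            rcases h1 with rfl | rfl
            · rcases h2 with h2 | h2
              exacts [(hby' h2.symm).elim, h2]
            · rcases h2 with h2 | h2
              exacts [by rw [hq, h2], (hby' h2.symm).elim]
          refine ⟨q i b, by rw [hy], b, hb, .inr ⟨?_, ?_, i, rfl⟩⟩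
          · rintro rfl; exact hbv rfl
          · rintro h; rw [hy, h] at hyv; exact hyv rfl
        · obtain ⟨hσ, hbσ⟩ := hlr _ _ hby
          refine .inr (.inr ⟨m, σ, ι b, rfl, rfl, hσ, hbσ, fun h => hbv (by rw [h]), ?_⟩)
          refine hb.map ι ?_
          rintro x y ⟨h1, h2, i, rfl⟩
          exact ⟨by simpa using h1, by simpa using h2, h.edge x i⟩
      · rcases hzy with rfl | ⟨hbv, hyv, hby⟩
        · exact .inr (.inl ⟨_, x, rfl, rfl, hx.mono (by omega)⟩)
        rcases y with y | σ
        · rw [hll] at hby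
          exact .inr (.inl ⟨_, y, rfl, rfl, x, hx, .inr
            ⟨fun h => hbv (by rw [h]), fun h => hyv (by rw [h]), hby.1⟩⟩)
        · obtain ⟨hσ, hbσ⟩ := hlr _ _ hby
          exact .inr (.inr ⟨_, σ, x, rfl, rfl, hσ, hbσ, fun h => hbv (by rw [h]),
            hx.mono (by omega)⟩)
      · rcases hzy with rfl | ⟨hbv, hyv, hby⟩
        · exact .inr (.inr ⟨_, σ, x, rfl, rfl, hσ, hxσ, hxv, hx.mono (by omega)⟩)
        rcases y with y | τ
        · rw [Finset.pair_comm] at hby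
          obtain ⟨-, hyσ⟩ := hlr _ _ hby
          exact .inr (.inl ⟨_, y, rfl, rfl, x, hx, .inr
            ⟨hxv, fun h => hyv (by rw [h]), hpair σ hσ x hxσ y hyσ⟩⟩)
        · obtain ⟨hτ, hst⟩ := hrr _ _ hby
          obtain ⟨y, hyτ, hyv⟩ := Finset.exists_mem_ne ((hH τ).1 hτ).2.1 (ι v)
          refine .inr (.inr ⟨_, τ, y, rfl, rfl, hτ, hyτ, hyv, x, hx, .inr ⟨hxv, hyv, ?_⟩⟩)
          rcases hst with hst | hst
          exacts [hpair τ hτ x (hst hxσ) y hyτ, hpair σ hσ x hxσ y (hst hyτ)]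
  rcases key _ hs with ⟨c, hc, hb⟩ | ⟨l, x, rfl, hc, hx⟩ | ⟨l, σ, x, -, hc, -⟩
  · have : c = b := ι.injective (Sum.inl_injective hc.symm)
    rwa [← this]
  · have : x = ι b := Sum.inl_injective hc.symm
    rw [this] at hx
    exact (h.steps v l a b (by omega) hx).mono (by omega)
  · exact (Sum.inl_ne_inr hc).elim

/-- There are triangulations of the 3-sphere with a nonempty set `R` of vertices such that every
vertex in `R` has more than `k` neighbours in `R` which are pairwise far apart in its complement. -/
theorem exists_sphere_far_neighbours (k n : ℕ) :
    ∃ (N : ℕ) (K : Set (Finset (Fin N))), IsComplex K ∧ (∀ s ∈ K, s.card ≤ 4) ∧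
      Nonempty (realization K ≃ₜ Metric.sphere (0 : EuclideanSpace ℝ (Fin 4)) 1) ∧
      ∃ R : Set (Fin N), R.Nonempty ∧ ∀ v ∈ R, ∃ S : Finset (Fin N), k < S.card ∧
        (∀ u ∈ S, u ∈ R ∧ u ≠ v ∧ {v, u} ∈ K) ∧
        ∀ u ∈ S, ∀ u' ∈ S, u ≠ u' → ¬ StepsWithin (AdjAvoiding K v) n u u' := by
  obtain ⟨A, _, _, side, q, hA, hside, hq, hr⟩ := exists_involutions (k + 1) (n + 2)
  have hn : ∀ m, ∃ (V : Type) (_ : Fintype V) (_ : DecidableEq V) (K : Set (Finset V)) (ι : A ↪ V),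
      IsComplex K ∧ (∀ s ∈ K, s.card ≤ 4) ∧
      Nonempty (realization K ≃ₜ Metric.sphere (0 : EuclideanSpace ℝ (Fin 4)) 1) ∧
      IsFarEmbedding K q ι m := by
    intro m
    induction m with
    | zero =>
      obtain ⟨V, _, _, K, B, C, _, _, _, _, h, hB, hC⟩ := exists_isCrossComplete (Fintype.card A)
      obtain ⟨f⟩ : Nonempty (A ↪ B) := Function.Embedding.nonempty_of_card_le (by simpa)
      obtain ⟨g⟩ : Nonempty (A ↪ C) := Function.Embedding.nonempty_of_card_le (by simpa)
      let ι : A → V := fun a => if side a then f a else g a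
      have hι : Function.Injective ι := by
        intro a b hab
        by_cases ha : side a <;> by_cases hb : side b <;> simp only [ι, ha, hb] at hab
        · exact f.injective (Subtype.ext hab)
        · have hab : (f a : V) = g b := by simpa using hab
          exact (h.disj _ (f a).2 (hab ▸ (g b).2)).elim
        · have hab : (g a : V) = f b := by simpa using hab
          exact (h.disj _ (f b).2 (hab ▸ (g a).2)).elim
        · exact g.injective (Subtype.ext (by simpa using hab))
      refine ⟨V, _, _, K, ⟨ι, hι⟩, h.isComplex, h.card_le, h.homeo, ?_, ?_⟩
      · intro a i
        by_cases ha : side a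
        · simpa [ι, hside, ha] using h.cross _ (f a).2 _ (g (q i a)).2
        · rw [Finset.pair_comm]
          simpa [ι, hside, ha] using h.cross _ (f (q i a)).2 _ (g a).2
      · intro v m a b hm hs
        obtain rfl : m = 0 := by omega
        exact hι hs
    | succ m ih =>
      obtain ⟨V, _, _, K, ι, hK, hK4, ⟨φ⟩, hι⟩ := ih
      classical
      let H : Finset (Finset V) := Finset.univ.filter fun σ =>
        σ ∈ K ∧ 2 ≤ σ.card ∧ ∀ a i, σ ≠ {ι a, ι (q i a)}
      have hH : ∀ σ, σ ∈ (H : Set (Finset V)) ↔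
          σ ∈ K ∧ 2 ≤ σ.card ∧ ∀ a i, σ ≠ {ι a, ι (q i a)} := by simp [H]; tauto
      have hup : ∀ σ ∈ H, ∀ τ ∈ K, σ ⊆ τ → τ ∈ H := by
        intro σ hσ τ hτ hστ
        obtain ⟨-, h2, h3⟩ := (hH σ).1 hσ
        refine (hH τ).2 ⟨hτ, h2.trans (Finset.card_le_card hστ), ?_⟩
        rintro a i rfl
        exact h3 a i (Finset.eq_of_subset_of_card_le hστ (Finset.card_le_two.trans h2))
      obtain ⟨h1, h2, ⟨ψ⟩⟩ := subdivision_spec hK hK4 H (fun σ hσ => ((hH σ).1 hσ).1) hup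
      exact ⟨V ⊕ Finset V, inferInstance, inferInstance, subdivision K H, ι.trans .inl, h1, h2,
        ⟨ψ.trans φ⟩, hι.subdivision hK hq hH⟩
  obtain ⟨V, _, _, K, ι, hK, hK4, ⟨φ⟩, hι⟩ := hn n
  let e : V ≃ Fin (Fintype.card V) := Fintype.equivFin V
  refine ⟨Fintype.card V, relabel K e.toEmbedding, hK.relabel _, ?_,
    ⟨(nonempty_homeomorph_relabel K e.toEmbedding).some.trans φ⟩,
    Set.range fun a => e (ι a), Set.range_nonempty _, ?_⟩
  · rintro _ ⟨t, ht, rfl⟩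
    simpa using hK4 t ht
  rintro _ ⟨v, rfl⟩
  have hfar : ∀ i j, i ≠ j → ¬ StepsWithin (AdjAvoiding (relabel K e.toEmbedding) (e (ι v))) n
      (e (ι (q i v))) (e (ι (q j v))) := by
    intro i j hij h
    refine not_stepsWithin_orbitAdjAvoiding hq hr hij le_rfl (hι.steps v n _ _ le_rfl ?_)
    have h2 := h.map (F := AdjAvoiding K (ι v)) e.symm ?_
    · simpa using h2
    · rintro x y ⟨h1, h2, h3⟩
      refine ⟨fun h => h1 (by simp [← h]), fun h => h2 (by simp [← h]), ?_⟩
      rw [← map_mem_relabel (e := e.toEmbedding)]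
      simpa using h3
  have hinj : Function.Injective fun i => e (ι (q i v)) := by
    intro i j hij
    by_contra hne
    refine hfar i j hne ?_
    rw [show e (ι (q j v)) = e (ι (q i v)) from hij.symm]
    exact StepsWithin.mono (m := 0) rfl (Nat.zero_le _)
  refine ⟨Finset.univ.image fun i => e (ι (q i v)), ?_, ?_, ?_⟩
  · rw [Finset.card_image_of_injective _ hinj]
    simp
  · simp only [Finset.mem_image, Finset.mem_univ, true_and, forall_exists_index,
      forall_apply_eq_imp_iff]
    refine fun i => ⟨⟨_, rfl⟩, fun h => ?_, ⟨_, hι.edge v i, by simp⟩⟩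
    exact hr [i] (by simp) (by simp) (by simp) v (by simpa using h)
  · simp only [Finset.mem_image, Finset.mem_univ, true_and, forall_exists_index,
      forall_apply_eq_imp_iff]
    exact fun i j hij => hfar i j fun h => hij (by rw [h])

end Iteration

/-! ### The intrinsic metric of a subset -/

section Intrinsic

variable {E : Type*} [MetricSpace E] {A : Set E}

lemma intrinsicDistE_le (p : ℝ → A) {a b : ℝ} (hab : a ≤ b) (hp : ContinuousOn p (Icc a b)) :
    intrinsicDistE A (p a) (p b) ≤ eVariationOn (fun t => (p t : E)) (Icc a b) := by
  have hm : MapsTo (fun t => a + t * (b - a)) (Icc (0 : ℝ) 1) (Icc a b) := by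
    rintro t ⟨h0, h1⟩
    constructor <;> simp only <;> nlinarith
  refine (iInf_le _ ⟨p ∘ fun t => a + t * (b - a), hp.comp (by fun_prop) hm, by simp, by simp⟩).trans
    (eVariationOn.comp_le_of_monotoneOn (fun t => (p t : E)) (fun t => a + t * (b - a)) ?_ hm)
  intro s _ t _ hst
  simp only
  nlinarith

lemma exists_path_of_intrinsicDistE_lt {x y : A} {c : ENNReal} (h : intrinsicDistE A x y < c) :
    ∃ p : ℝ → A, ContinuousOn p (Icc 0 1) ∧ p 0 = x ∧ p 1 = y ∧
      eVariationOn (fun t => (p t : E)) (Icc 0 1) < c := by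
  obtain ⟨⟨p, h1, h2, h3⟩, h4⟩ := iInf_lt_iff.1 h
  exact ⟨p, h1, h2, h3, h4⟩

lemma intrinsicDistE_self (x : A) : intrinsicDistE A x x = 0 := by
  have := intrinsicDistE_le (fun _ => x) (zero_le_one (α := ℝ)) continuousOn_const
  rwa [eVariationOn.constant_on, nonpos_iff_eq_zero] at this
  rintro _ ⟨_, _, rfl⟩ _ ⟨_, _, rfl⟩
  rfl

lemma edist_le_intrinsicDistE (x y : A) : edist x y ≤ intrinsicDistE A x y := by
  refine le_iInf ?_
  rintro ⟨p, -, rfl, rfl⟩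
  exact eVariationOn.edist_le (fun t => (p t : E)) (by simp) (by simp)

lemma intrinsicDistE_comm_le (x y : A) : intrinsicDistE A x y ≤ intrinsicDistE A y x := by
  refine le_iInf ?_
  rintro ⟨p, hp, rfl, rfl⟩
  have hm : MapsTo (fun t : ℝ => 1 - t) (Icc 0 1) (Icc 0 1) := by
    rintro t ⟨h0, h1⟩
    constructor <;> simp only <;> linarith
  refine (iInf_le _ ⟨p ∘ fun t => 1 - t, hp.comp (by fun_prop) hm, by simp, by simp⟩).trans
    (eVariationOn.comp_le_of_antitoneOn (fun t => (p t : E)) (fun t => 1 - t) ?_ hm)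
  intro s _ t _ hst
  simp only
  linarith

lemma intrinsicDistE_triangle (x y z : A) :
    intrinsicDistE A x z ≤ intrinsicDistE A x y + intrinsicDistE A y z := by
  conv_rhs => simp only [intrinsicDistE, ENNReal.iInf_add, ENNReal.add_iInf]
  refine le_iInf fun ⟨q, hq, hq0, hq1⟩ => le_iInf fun ⟨p, hp, hp0, hp1⟩ => ?_
  let r : ℝ → A := fun t => if t ≤ 1 then p t else q (t - 1)
  have hr1 : EqOn r p (Icc 0 1) := fun t ht => if_pos ht.2
  have hr2 : EqOn r (fun t => q (t - 1)) (Icc 1 2) := by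
    intro t ht
    rcases ht.1.eq_or_lt with rfl | h
    · simp [r, hp1, hq0]
    · simp [r, h]
  have hm : MapsTo (fun t : ℝ => t - 1) (Icc 1 2) (Icc 0 1) := by
    rintro t ⟨h0, h1⟩
    constructor <;> simp only <;> linarith
  have hrc : ContinuousOn r (Icc 0 2) := by
    rw [← Icc_union_Icc_eq_Icc (zero_le_one (α := ℝ)) one_le_two]
    exact (hp.congr hr1).union_of_isClosed ((hq.comp (by fun_prop) hm).congr hr2)
      isClosed_Icc isClosed_Icc
  have h3 := intrinsicDistE_le r zero_le_two hrc
  have h4 := eVariationOn.Icc_add_Icc (fun t => (r t : E)) (zero_le_one (α := ℝ)) one_le_two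
    (mem_univ _)
  simp only [univ_inter] at h4
  rw [show r 0 = x by simp [r, hp0], show r 2 = z by norm_num [r, hq1], ← h4] at h3
  refine h3.trans (add_le_add ?_ ?_)
  · exact (eVariationOn.congr fun t ht => by simp only [hr1 ht]).le
  · rw [eVariationOn.congr (g := fun t => (q (t - 1) : E)) fun t ht => by simp only [hr2 ht]]
    exact eVariationOn.comp_le_of_monotoneOn (fun t => (q t : E)) (fun t => t - 1)
      (fun s _ t _ hst => by simpa using hst) hm

lemma intrinsicDistE_le_edist {E : Type*} [NormedAddCommGroup E] [NormedSpace ℝ E] {A : Set E}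
    {x y : A} (h : segment ℝ (x : E) y ⊆ A) : intrinsicDistE A x y ≤ edist x y := by
  classical
  let f : ℝ → E := AffineMap.lineMap (x : E) (y : E)
  have hf : ∀ t ∈ Icc (0 : ℝ) 1, f t ∈ A := fun t ht => h (by
    rw [segment_eq_image_lineMap]; exact ⟨t, ht, rfl⟩)
  have hfc : Continuous f := AffineMap.lineMap_continuous
  let p : ℝ → A := fun t => if ht : f t ∈ A then ⟨f t, ht⟩ else x
  have hpf : EqOn (fun t => (p t : E)) f (Icc 0 1) := fun t ht => by simp [p, hf t ht]
  have hpf' : ∀ t ∈ Icc (0 : ℝ) 1, (p t : E) = f t := hpf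
  have hp : ContinuousOn p (Icc 0 1) :=
    Topology.IsInducing.subtypeVal.continuousOn_iff.2 (hfc.continuousOn.congr hpf)
  have h0 : p 0 = x := Subtype.ext (by rw [hpf' _ (by simp)]; simp [f])
  have h1 : p 1 = y := Subtype.ext (by rw [hpf' _ (by simp)]; simp [f])
  have h2 := intrinsicDistE_le p zero_le_one hp
  rw [h0, h1, eVariationOn.congr hpf] at h2
  refine h2.trans ?_
  have h3 : LipschitzWith (nndist (x : E) y) f := lipschitzWith_lineMap _ _
  refine ((h3.lipschitzOnWith (s := univ)).comp_eVariationOn_le (g := id) (mapsTo_univ _ _)).trans ?_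
  have h4 := (monotone_id.monotoneOn (Icc (0 : ℝ) 1)).eVariationOn_eq (a := 0) (b := 1)
    (by simp) (by simp)
  simp only [inter_self, id_eq, sub_zero, ENNReal.ofReal_one] at h4
  calc _ ≤ (nndist (x : E) y : ENNReal) * 1 := by rw [h4]
    _ = edist x y := by rw [mul_one, ← edist_nndist]; rfl

end Intrinsic

/-! ### Geodesics in compact length spaces -/

section Geodesic

variable {X : Type*} [MetricSpace X]

/-- Two points of a compact space which are joined by paths of length arbitrarily close to their
distance are joined by a path parametrized proportionally to distance. -/
lemma exists_dist_le_mul [CompactSpace X] {x y : X}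
    (h : ∀ η : ℝ, 0 < η → ∃ p : ℝ → X, ContinuousOn p (Icc 0 1) ∧ p 0 = x ∧ p 1 = y ∧
      ∀ a ∈ Icc (0 : ℝ) 1, ∀ b ∈ Icc (0 : ℝ) 1, a ≤ b →
        dist x (p a) + dist (p a) (p b) + dist (p b) y ≤ dist x y + η) :
    ∃ g : ℝ → X, g 0 = x ∧ g 1 = y ∧
      ∀ s ∈ Icc (0 : ℝ) 1, ∀ t ∈ Icc (0 : ℝ) 1, dist (g s) (g t) ≤ |s - t| * dist x y := by
  have h1 : ∀ η : ℝ, 0 < η → ∃ z : ℝ → X, dist x (z 0) ≤ 0 ∧ dist (z 1) y ≤ η ∧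
      ∀ s ∈ Icc (0 : ℝ) 1, ∀ t ∈ Icc (0 : ℝ) 1, dist (z s) (z t) ≤ |s - t| * dist x y + η := by
    intro η hη
    obtain ⟨p, hp, hp0, hp1, hpd⟩ := h η hη
    have hivt : ∀ s ∈ Icc (0 : ℝ) 1, ∃ σ ∈ Icc (0 : ℝ) 1, dist x (p σ) = s * dist x y := by
      intro s hs
      have hc : ContinuousOn (fun t => dist x (p t)) (Icc 0 1) := (continuous_const.dist continuous_id).comp_continuousOn hp
      obtain ⟨σ, h1, h2⟩ := intermediate_value_Icc zero_le_one hc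
        (show s * dist x y ∈ Icc (dist x (p 0)) (dist x (p 1)) by
          rw [hp0, hp1, dist_self]
          have := dist_nonneg (x := x) (y := y)
          constructor <;> nlinarith [hs.1, hs.2])
      exact ⟨σ, h1, h2⟩
    choose! σ hσ hσd using hivt
    have hle : ∀ s ∈ Icc (0 : ℝ) 1, ∀ t ∈ Icc (0 : ℝ) 1, s ≤ t →
        dist (p (σ s)) (p (σ t)) ≤ (t - s) * dist x y + η := by
      intro s hs t ht hst
      have h0 := dist_nonneg (x := x) (y := y)
      rcases le_total (σ s) (σ t) with hl | hl
      · have h1 := hpd _ (hσ s hs) _ (hσ t ht) hl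
        have h2 := dist_triangle x (p (σ t)) y
        rw [hσd s hs] at h1
        rw [hσd t ht] at h2
        linarith
      · have h1 := hpd _ (hσ t ht) _ (hσ s hs) hl
        have h2 := dist_triangle x (p (σ s)) y
        rw [hσd t ht, dist_comm (p (σ t))] at h1
        rw [hσd s hs] at h2
        nlinarith [mul_nonneg (sub_nonneg.2 hst) h0]
    refine ⟨fun s => p (σ s), ?_, ?_, fun s hs t ht => ?_⟩
    · simp [hσd 0 (by simp)]
    · have h1 := hpd _ (hσ 1 (by simp)) _ (hσ 1 (by simp)) le_rfl
      rw [hσd 1 (by simp), dist_self] at h1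
      linarith
    · rcases le_total s t with hst | hst
      · rw [abs_sub_comm, abs_of_nonneg (sub_nonneg.2 hst)]
        exact hle s hs t ht hst
      · rw [dist_comm, abs_of_nonneg (sub_nonneg.2 hst)]
        exact hle t ht s hs hst
  choose Z hZ0 hZ1 hZ using fun n : ℕ => h1 (1 / ((n : ℝ) + 1)) Nat.one_div_pos_of_nat
  have hlim : Tendsto (fun n : ℕ => 1 / ((n : ℝ) + 1)) (hyperfilter ℕ) (𝓝 0) :=
    tendsto_one_div_add_atTop_nhds_zero_nat.mono_left Nat.hyperfilter_le_atTop
  obtain ⟨g, -, hg⟩ := isCompact_univ.ultrafilter_le_nhds ((hyperfilter ℕ).map Z) (by simp)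
  have hgs : ∀ s, Tendsto (fun n => Z n s) (hyperfilter ℕ) (𝓝 (g s)) :=
    tendsto_pi_nhds.1 hg
  refine ⟨g, ?_, ?_, fun s hs t ht => ?_⟩
  · have := le_of_tendsto (tendsto_const_nhds.dist (hgs 0)) (Eventually.of_forall hZ0)
    exact (dist_le_zero.1 this).symm
  · have := le_of_tendsto_of_tendsto ((hgs 1).dist tendsto_const_nhds) hlim
      (Eventually.of_forall hZ1)
    exact dist_le_zero.1 this
  · have := le_of_tendsto_of_tendsto ((hgs s).dist (hgs t)) (hlim.const_add (|s - t| * dist x y))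
      (Eventually.of_forall fun n => hZ n s hs t ht)
    simpa using this

lemma isGeodesicD_of_exists_dist_le_mul
    (h : ∀ x y : X, ∃ g : ℝ → X, g 0 = x ∧ g 1 = y ∧
      ∀ s ∈ Icc (0 : ℝ) 1, ∀ t ∈ Icc (0 : ℝ) 1, dist (g s) (g t) ≤ |s - t| * dist x y) :
    IsGeodesicD X (fun x y => dist x y) := by
  intro x y
  obtain ⟨g, h0, h1, hg⟩ := h x y
  have hd := dist_nonneg (x := x) (y := y)
  refine ⟨g, ?_, h0, h1, le_antisymm (iSup_le ?_) ?_⟩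
  · intro t ht ε hε
    obtain ⟨δ, hδ, hδε⟩ := ENNReal.lt_iff_exists_nnreal_btwn.1 hε
    have hδ : (0 : ℝ) < δ := by exact_mod_cast hδ
    refine ⟨δ / (dist x y + 1), by positivity, fun t' ht' htt => lt_of_le_of_lt ?_ hδε⟩
    rw [← ENNReal.ofReal_coe_nnreal]
    refine ENNReal.ofReal_le_ofReal ((hg t ht t' ht').trans ?_)
    rw [abs_sub_comm, lt_div_iff₀ (by positivity)] at *
    nlinarith [abs_nonneg (t' - t), abs_sub_comm t t']
  · rintro ⟨n, u, hu, hu'⟩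
    calc ∑ i ∈ Finset.range n, ENNReal.ofReal (dist (g (u i)) (g (u (i + 1))))
        ≤ ∑ i ∈ Finset.range n, ENNReal.ofReal ((u (i + 1) - u i) * dist x y) := by
          refine Finset.sum_le_sum fun i _ => ENNReal.ofReal_le_ofReal ?_
          refine (hg _ (hu' i) _ (hu' (i + 1))).trans_eq ?_
          rw [abs_sub_comm, abs_of_nonneg (sub_nonneg.2 (hu (Nat.le_succ i)))]
      _ = ENNReal.ofReal ((u n - u 0) * dist x y) := by
          rw [← ENNReal.ofReal_sum_of_nonneg, ← Finset.sum_mul, Finset.sum_range_sub]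
          exact fun i _ => mul_nonneg (sub_nonneg.2 (hu (Nat.le_succ i))) hd
      _ ≤ ENNReal.ofReal (dist x y) := by
          refine ENNReal.ofReal_le_ofReal (mul_le_of_le_one_left hd ?_)
          linarith [(hu' n).2, (hu' 0).1]
  · refine le_iSup_of_le ⟨1, fun i => if i = 0 then 0 else 1, ?_, ?_⟩ (by simp [h0, h1])
    · intro i j hij
      by_cases hi : i = 0
      · by_cases hj : j = 0 <;> simp [hi, hj]
      · simp [hi, show j ≠ 0 by omega]
    · intro i
      by_cases hi : i = 0 <;> simp [hi]

end Geodesic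

/-! ### The intrinsic metric space -/

section IntrinsicSpace

/-- A subset of a metric space, to be equipped with its intrinsic metric. -/
structure IntrinsicSpace {E : Type*} (A : Set E) where
  /-- The underlying point. -/
  val : A

variable {E : Type*} [MetricSpace E] {A : Set E}

noncomputable instance : EMetricSpace (IntrinsicSpace A) where
  edist x y := intrinsicDistE A x.val y.val
  edist_self x := intrinsicDistE_self x.val
  edist_comm x y := (intrinsicDistE_comm_le _ _).antisymm (intrinsicDistE_comm_le _ _)
  edist_triangle x y z := intrinsicDistE_triangle _ _ _
  eq_of_edist_eq_zero := by
    rintro ⟨x⟩ ⟨y⟩ h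
    have := (edist_le_intrinsicDistE x y).trans_eq h
    rw [edist_le_zero.1 this]

lemma IntrinsicSpace.edist_def (x y : IntrinsicSpace A) :
    edist x y = intrinsicDistE A x.val y.val := rfl

lemma IntrinsicSpace.continuous_val : Continuous (IntrinsicSpace.val (A := A)) :=
  LipschitzWith.continuous (K := 1) fun x y => by
    rw [ENNReal.coe_one, one_mul]
    exact edist_le_intrinsicDistE x.val y.val

end IntrinsicSpace

/-- A connected finite union of compact convex sets is a game space for its intrinsic metric. -/
theorem exists_intrinsic_gameSpaceD {E : Type} [NormedAddCommGroup E] [NormedSpace ℝ E] {A : Set E}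
    (hconn : IsConnected A) {ι : Type*} [Finite ι] (C : ι → Set E) (hcpt : ∀ i, IsCompact (C i))
    (hconv : ∀ i, Convex ℝ (C i)) (hA : A = ⋃ i, C i) :
    ∃ (X : Type) (_ : MetricSpace X) (e : X ≃ₜ A), GameSpaceD X (fun x y => dist x y) ∧
      (∀ x y, ENNReal.ofReal (dist x y) = intrinsicDistE A (e x) (e y)) ∧
      ∀ x y : X, ∃ g : ℝ → X, g 0 = x ∧ g 1 = y ∧
        ∀ s ∈ Icc (0 : ℝ) 1, ∀ t ∈ Icc (0 : ℝ) 1, dist (g s) (g t) ≤ |s - t| * dist x y := by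
  have hCA : ∀ i, C i ⊆ A := fun i => by rw [hA]; exact subset_iUnion C i
  have hcompact : CompactSpace (IntrinsicSpace A) := by
    have h1 : ∀ i, LipschitzWith 1 fun x : C i => IntrinsicSpace.mk ⟨x.1, hCA i x.2⟩ := by
      intro i x y
      rw [IntrinsicSpace.edist_def, ENNReal.coe_one, one_mul]
      exact intrinsicDistE_le_edist (((hconv i).segment_subset x.2 y.2).trans (hCA i))
    have h2 : (univ : Set (IntrinsicSpace A)) =
        ⋃ i, range fun x : C i => IntrinsicSpace.mk ⟨x.1, hCA i x.2⟩ := by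
      ext ⟨x, hx⟩
      obtain ⟨i, hi⟩ := mem_iUnion.1 (hA ▸ hx)
      simp only [mem_univ, mem_iUnion, mem_range, true_iff]
      exact ⟨i, ⟨x, hi⟩, rfl⟩
    refine ⟨h2 ▸ isCompact_iUnion fun i => ?_⟩
    have := isCompact_iff_compactSpace.1 (hcpt i)
    exact isCompact_range (h1 i).continuous
  let e₀ : IntrinsicSpace A ≃ A := ⟨IntrinsicSpace.val, IntrinsicSpace.mk, fun _ => rfl, fun _ => rfl⟩
  have he₀ : Continuous e₀ := IntrinsicSpace.continuous_val
  let e : IntrinsicSpace A ≃ₜ A := he₀.homeoOfEquivCompactToT2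
  have := isConnected_iff_connectedSpace.1 hconn
  have hfin : ∀ x y : IntrinsicSpace A, edist x y ≠ ⊤ := by
    intro x y
    have : ConnectedSpace (IntrinsicSpace A) := e.symm.surjective.connectedSpace e.symm.continuous
    have h : Metric.eball y ⊤ = univ :=
      IsClopen.eq_univ ⟨Metric.isClosed_eball_top, Metric.isOpen_eball⟩ ⟨y, by simp⟩
    exact (show x ∈ Metric.eball y ⊤ from h ▸ mem_univ x).ne
  let m : MetricSpace (IntrinsicSpace A) := EMetricSpace.toMetricSpace hfin
  have hdist : ∀ x y : IntrinsicSpace A, ENNReal.ofReal (dist x y) = intrinsicDistE A (e x) (e y) :=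
    fun x y => (edist_dist x y).symm
  have : Nonempty (IntrinsicSpace A) := e.surjective.nonempty
  have hgeo : ∀ x y : IntrinsicSpace A, ∃ g : ℝ → IntrinsicSpace A, g 0 = x ∧ g 1 = y ∧
      ∀ s ∈ Icc (0 : ℝ) 1, ∀ t ∈ Icc (0 : ℝ) 1, dist (g s) (g t) ≤ |s - t| * dist x y := by
    refine fun x y => exists_dist_le_mul fun η hη => ?_
    have h1 : intrinsicDistE A (e x) (e y) < ENNReal.ofReal (dist x y + η) := by
      rw [← hdist]
      exact (ENNReal.ofReal_lt_ofReal_iff (by positivity)).2 (by linarith)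
    obtain ⟨p, hp, hp0, hp1, hpv⟩ := exists_path_of_intrinsicDistE_lt h1
    refine ⟨fun t => e.symm (p t), e.symm.continuous.comp_continuousOn hp, by simp [hp0],
      by simp [hp1], fun a ha b hb hab => ?_⟩
    have h2 : ∀ a b, a ∈ Icc (0 : ℝ) 1 → b ∈ Icc (0 : ℝ) 1 → a ≤ b →
        ENNReal.ofReal (dist (e.symm (p a)) (e.symm (p b))) ≤
          eVariationOn (fun t => (p t : E)) (Icc a b) := by
      intro a b ha hb hab
      rw [hdist]
      simpa using intrinsicDistE_le p hab (hp.mono (Icc_subset_Icc ha.1 hb.2))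
    have h3 := eVariationOn.Icc_add_Icc (fun t => (p t : E)) ha.1 hab (mem_univ _)
    have h4 := eVariationOn.Icc_add_Icc (fun t => (p t : E)) hb.1 hb.2 (mem_univ _)
    simp only [univ_inter] at h3 h4
    have h5 := add_le_add (add_le_add (h2 0 a (by simp) ha ha.1) (h2 a b ha hb hab))
      (h2 b 1 hb (by simp) hb.2)
    rw [h3, h4, hp0, hp1, e.symm_apply_apply, e.symm_apply_apply, ← ENNReal.ofReal_add dist_nonneg
      dist_nonneg, ← ENNReal.ofReal_add (by positivity) dist_nonneg] at h5
    exact (ENNReal.ofReal_le_ofReal_iff (by positivity)).1 (h5.trans hpv.le)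
  refine ⟨IntrinsicSpace A, m, e, ⟨inferInstance,
    ⟨dist_self, fun x y => dist_eq_zero.1, dist_comm, dist_triangle⟩, fun u => ?_,
    isGeodesicD_of_exists_dist_le_mul hgeo⟩, hdist, hgeo⟩
  obtain ⟨x, φ, hφ, hx⟩ := CompactSpace.tendsto_subseq u
  exact ⟨x, φ, hφ, tendsto_iff_dist_tendsto_zero.1 hx⟩

/-! ### Piecewise 1-Lipschitz functions -/

section PiecewiseLipschitz

variable {E : Type*} [MetricSpace E] {A : Set E} {ι : Type*} {C : ι → Set E} {F : E → ℝ}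

lemma edist_le_eVariationOn_of_piecewise (hC : ∀ i, IsClosed (C i))
    (hF : ∀ i, LipschitzOnWith 1 F (C i)) {p : ℝ → E} (S : Finset ι) {a b : ℝ} (hab : a ≤ b)
    (hp : ContinuousOn p (Icc a b)) (hS : ∀ t ∈ Icc a b, ∃ i ∈ S, p t ∈ C i) :
    edist (F (p a)) (F (p b)) ≤ eVariationOn p (Icc a b) := by
  classical
  induction S using Finset.strongInduction generalizing a with
  | H S ih =>
    obtain ⟨i, hi, hai⟩ := hS a (left_mem_Icc.2 hab)
    have hcl : IsClosed (Icc a b ∩ p ⁻¹' C i) := hp.preimage_isClosed_of_isClosed isClosed_Icc (hC i)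
    have hbdd : BddAbove (Icc a b ∩ p ⁻¹' C i) := bddAbove_Icc.mono inter_subset_left
    set c := sSup (Icc a b ∩ p ⁻¹' C i) with hc
    obtain ⟨hcm, hci⟩ : c ∈ Icc a b ∩ p ⁻¹' C i :=
      hcl.csSup_mem ⟨a, left_mem_Icc.2 hab, hai⟩ hbdd
    have h1 : edist (F (p a)) (F (p c)) ≤ eVariationOn p (Icc a c) := by
      have := hF i hai hci
      rw [ENNReal.coe_one, one_mul] at this
      exact this.trans (eVariationOn.edist_le p (left_mem_Icc.2 hcm.1) (right_mem_Icc.2 hcm.1))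
    have h2 : edist (F (p c)) (F (p b)) ≤ eVariationOn p (Icc c b) := by
      rcases hcm.2.eq_or_lt with hcb | hcb
      · rw [hcb, edist_self]
        exact zero_le
      have hpc : ContinuousOn p (Icc c b) := hp.mono (Icc_subset_Icc_left hcm.1)
      refine ih (S.erase i) (Finset.erase_ssubset hi) hcm.2 hpc ?_
      have hcl' : IsClosed (Icc c b ∩ p ⁻¹' ⋃ j ∈ S.erase i, C j) :=
        hpc.preimage_isClosed_of_isClosed isClosed_Icc
          (isClosed_biUnion_finset fun j _ => hC j)
      have hsub : Ioc c b ⊆ Icc c b ∩ p ⁻¹' ⋃ j ∈ S.erase i, C j := by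
        intro t ht
        refine ⟨Ioc_subset_Icc_self ht, ?_⟩
        obtain ⟨j, hj, htj⟩ := hS t ⟨hcm.1.trans ht.1.le, ht.2⟩
        refine mem_iUnion₂.2 ⟨j, Finset.mem_erase.2 ⟨?_, hj⟩, htj⟩
        rintro rfl
        exact ht.1.not_ge (le_csSup hbdd ⟨⟨hcm.1.trans ht.1.le, ht.2⟩, htj⟩)
      intro t ht
      have := (closure_minimal hsub hcl' (by rwa [closure_Ioc hcb.ne])).2
      simpa using mem_iUnion₂.1 this
    have h3 := eVariationOn.Icc_add_Icc p hcm.1 hcm.2 (mem_univ _)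
    simp only [univ_inter] at h3
    exact (edist_triangle _ _ _).trans (h3 ▸ add_le_add h1 h2)

lemma edist_le_intrinsicDistE_of_piecewise [Finite ι] (hC : ∀ i, IsClosed (C i))
    (hF : ∀ i, LipschitzOnWith 1 F (C i)) (hA : A = ⋃ i, C i) (x y : A) :
    edist (F x) (F y) ≤ intrinsicDistE A x y := by
  have := Fintype.ofFinite ι
  refine le_iInf ?_
  rintro ⟨p, hp, rfl, rfl⟩
  refine edist_le_eVariationOn_of_piecewise hC hF (p := fun t => (p t : E)) Finset.univ zero_le_one
    (continuous_subtype_val.comp_continuousOn hp) fun t _ => ?_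
  obtain ⟨i, hi⟩ := mem_iUnion.1 (hA.subset (p t).2)
  exact ⟨i, Finset.mem_univ _, hi⟩

end PiecewiseLipschitz

/-! ### The standard geometric realization by regular simplices of edge length one -/

section Polyhedron


variable {V : Type*}

/-- The vertices of the regular simplex of edge length one. -/
noncomputable def vertex [DecidableEq V] (i : V) : EuclideanSpace ℝ V := EuclideanSpace.single i (√2)⁻¹

lemma inv_sqrt_two_pos : (0 : ℝ) < (√2)⁻¹ := by positivity

lemma vertex_apply [DecidableEq V] (i j : V) : vertex i j = if j = i then (√2)⁻¹ else 0 := by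
  simp [vertex]

variable [Fintype V]

/-- The closed simplex spanned by the vertices in `s`. -/
def cell (s : Finset V) : Set (EuclideanSpace ℝ V) :=
  {z | (∀ i, 0 ≤ z i) ∧ ∑ i, z i = (√2)⁻¹ ∧ ∀ i ∉ s, z i = 0}

/-- The union of the closed simplices of `K`. -/
def polyhedron (K : Set (Finset V)) : Set (EuclideanSpace ℝ V) := ⋃ s : K, cell s.1

lemma convex_cell (s : Finset V) : Convex ℝ (cell s) := by
  rintro x ⟨hx0, hx1, hx2⟩ y ⟨hy0, hy1, hy2⟩ a b ha hb hab
  refine ⟨fun i => ?_, ?_, fun i hi => ?_⟩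
  · have := hx0 i
    have := hy0 i
    simp only [PiLp.add_apply, PiLp.smul_apply, smul_eq_mul]
    positivity
  · simp only [PiLp.add_apply, PiLp.smul_apply, smul_eq_mul, Finset.sum_add_distrib,
      ← Finset.mul_sum, hx1, hy1]
    rw [← add_mul, hab, one_mul]
  · simp [hx2 i hi, hy2 i hi]

variable [DecidableEq V]

lemma vertex_mem_cell {i : V} {s : Finset V} : vertex i ∈ cell s ↔ i ∈ s := by
  constructor
  · rintro ⟨-, -, h⟩
    by_contra hi
    have := h i hi
    rw [vertex_apply, if_pos rfl] at this
    exact inv_sqrt_two_pos.ne' this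
  · refine fun hi => ⟨fun j => ?_, ?_, fun j hj => ?_⟩
    · rw [vertex_apply]
      split_ifs
      · exact inv_sqrt_two_pos.le
      · exact le_rfl
    · simp [vertex_apply]
    · rw [vertex_apply, if_neg]
      rintro rfl
      exact hj hi

lemma vertex_injective : Function.Injective (vertex (V := V)) := by
  intro i j h
  have h1 : vertex j ∈ cell {i} := h ▸ vertex_mem_cell.2 (by simp)
  exact (Finset.mem_singleton.1 (vertex_mem_cell.1 h1)).symm

lemma dist_vertex {i j : V} (h : i ≠ j) : dist (vertex i) (vertex j) = 1 := by
  rw [EuclideanSpace.dist_eq]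
  have h2 : ∀ l, dist (vertex i l) (vertex j l) ^ 2
      = (if l = i then (2 : ℝ)⁻¹ else 0) + if l = j then (2 : ℝ)⁻¹ else 0 := by
    intro l
    rw [Real.dist_eq, sq_abs, vertex_apply, vertex_apply]
    by_cases hi : l = i
    · subst hi
      simp [h]
    · by_cases hj : l = j
      · subst hj
        simp [h.symm]
      · simp [hi, hj]
  rw [Finset.sum_congr rfl fun l _ => h2 l]
  simp [Finset.sum_add_distrib]
  norm_num

lemma convexHull_vertex (s : Finset V) : convexHull ℝ (vertex '' (s : Set V)) = cell s := by
  apply Subset.antisymm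
  · refine convexHull_min ?_ (convex_cell s)
    rintro _ ⟨i, hi, rfl⟩
    exact vertex_mem_cell.2 hi
  · rintro z ⟨h0, h1, h2⟩
    have hz : z = ∑ i ∈ s, (√2 * z i) • vertex i := by
      ext j
      simp only [WithLp.ofLp_sum, Finset.sum_apply, PiLp.smul_apply, smul_eq_mul, vertex_apply]
      by_cases hj : j ∈ s
      · rw [Finset.sum_eq_single_of_mem j hj (by intro b _ hb; simp [hb.symm])]
        rw [if_pos rfl]
        field_simp
      · rw [Finset.sum_eq_zero, h2 j hj]
        intro i hi
        rw [if_neg (by rintro rfl; exact hj hi), mul_zero]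
    rw [hz]
    refine (convex_convexHull ℝ _).sum_mem (fun i _ => mul_nonneg (Real.sqrt_nonneg _) (h0 i)) ?_
      fun i hi => subset_convexHull ℝ _ ⟨i, hi, rfl⟩
    rw [← Finset.mul_sum, Finset.sum_subset (Finset.subset_univ s) fun i _ hi => h2 i hi, h1]
    exact mul_inv_cancel₀ (by positivity)

lemma isCompact_cell (s : Finset V) : IsCompact (cell s) := by
  rw [← convexHull_vertex]
  exact (s.finite_toSet.image _).isCompact_convexHull (𝕜 := ℝ)

lemma affineIndependent_vertex : AffineIndependent ℝ (vertex (V := V)) := by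
  suffices h : LinearIndependent ℝ (vertex (V := V)) from h.affineIndependent (k := ℝ)
  rw [Fintype.linearIndependent_iff]
  intro g hg i
  have := congrArg (fun z : EuclideanSpace ℝ V => z i) hg
  simp only [WithLp.ofLp_sum, Finset.sum_apply, PiLp.smul_apply, smul_eq_mul, vertex_apply,
    mul_ite, mul_zero, Finset.sum_ite_eq, Finset.mem_univ, if_true] at this
  simpa using this

lemma exists_simplicialComplex {K : Set (Finset V)} (hK : IsComplex K) :
    ∃ G : Geometry.SimplicialComplex ℝ (EuclideanSpace ℝ V), G.faces.Finite ∧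
      (∀ f ∈ G.faces, ∀ x ∈ f, ∀ y ∈ f, x ≠ y → dist x y = 1) ∧ G.space = polyhedron K := by
  classical
  let P : PreAbstractSimplicialComplex (EuclideanSpace ℝ V) :=
    { faces := {s | ∃ t ∈ K, t.map ⟨vertex, vertex_injective⟩ = s}
      isRelLowerSet_faces := by
        have h := hK.relabel ⟨vertex, vertex_injective⟩
        exact fun s hs => ⟨h.nonempty s hs, fun t hts hne => h.down s hs t hts hne⟩ }
  refine ⟨Geometry.SimplicialComplex.ofAffineIndependent P ?_, ?_, ?_, ?_⟩
  · refine affineIndependent_vertex.range.mono fun x hx => ?_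
    simp only [Set.mem_iUnion, Finset.mem_coe] at hx
    obtain ⟨_, ⟨t, _, rfl⟩, hx⟩ := hx
    obtain ⟨i, -, rfl⟩ := Finset.mem_map.1 hx
    exact ⟨i, rfl⟩
  · exact (toFinite ((fun t : Finset V => t.map ⟨vertex, vertex_injective⟩) '' K)).subset
      fun s hs => hs
  · rintro _ ⟨t, ht, rfl⟩ x hx y hy hxy
    obtain ⟨i, -, rfl⟩ := Finset.mem_map.1 hx
    obtain ⟨j, -, rfl⟩ := Finset.mem_map.1 hy
    exact dist_vertex fun h => hxy (by rw [h])
  · ext z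
    rw [Geometry.SimplicialComplex.mem_space_iff, polyhedron, mem_iUnion]
    constructor
    · rintro ⟨_, ⟨t, ht, rfl⟩, hz⟩
      refine ⟨⟨t, ht⟩, ?_⟩
      rw [← convexHull_vertex]
      simpa using hz
    · rintro ⟨⟨t, ht⟩, hz⟩
      refine ⟨_, ⟨t, ht, rfl⟩, ?_⟩
      rw [← convexHull_vertex] at hz
      simpa using hz

lemma mem_polyhedron {K : Set (Finset V)} (hK : IsComplex K) {z : EuclideanSpace ℝ V} :
    z ∈ polyhedron K ↔
      (∀ i, 0 ≤ z i) ∧ ∑ i, z i = (√2)⁻¹ ∧ supp (fun i => z i) ∈ K := by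
  rw [polyhedron, mem_iUnion]
  constructor
  · rintro ⟨⟨s, hs⟩, h0, h1, h2⟩
    refine ⟨h0, h1, hK.down s hs _ (fun i hi => ?_) ?_⟩
    · by_contra h
      exact mem_supp.1 hi (h2 i h)
    · by_contra hne
      rw [Finset.not_nonempty_iff_eq_empty] at hne
      have : ∀ i, z i = 0 := fun i => by
        by_contra h
        have := (mem_supp (x := fun i => z i)).2 h
        simp [hne] at this
      rw [Finset.sum_eq_zero fun i _ => this i] at h1
      exact inv_sqrt_two_pos.ne h1
  · rintro ⟨h0, h1, h2⟩
    refine ⟨⟨_, h2⟩, h0, h1, fun i hi => ?_⟩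
    by_contra h
    exact hi (mem_supp.2 h)

lemma nonempty_homeomorph_polyhedron {K : Set (Finset V)} (hK : IsComplex K) :
    Nonempty (polyhedron K ≃ₜ realization K) := by
  have h2 : (√2 : ℝ) ≠ 0 := by positivity
  refine ⟨{ toFun := fun z => ⟨fun i => √2 * z.1 i, ?_⟩
            invFun := fun x => ⟨WithLp.toLp 2 fun i => (√2)⁻¹ * x.1 i, ?_⟩
            left_inv := ?_
            right_inv := ?_
            continuous_toFun := ?_
            continuous_invFun := ?_ }⟩
  · obtain ⟨a, b, c⟩ := (mem_polyhedron hK).1 z.2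
    refine ⟨fun i => mul_nonneg (Real.sqrt_nonneg _) (a i), ?_, ?_⟩
    · rw [← Finset.mul_sum, b, mul_inv_cancel₀ h2]
    · convert c using 1
      ext i
      simp [h2]
  · obtain ⟨a, b, c⟩ := x.2
    refine (mem_polyhedron hK).2 ⟨fun i => mul_nonneg (by positivity) (a i), ?_, ?_⟩
    · simp only
      rw [← Finset.mul_sum, b, mul_one]
    · convert c using 1
      ext i
      simp [h2]
  · intro z
    ext i
    simp [h2]
  · intro x
    ext i
    simp [h2]
  · fun_prop
  · refine Continuous.subtype_mk ((PiLp.continuous_toLp 2 _).comp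
      (continuous_pi fun i => ?_)) _
    exact continuous_const.mul ((continuous_apply i).comp continuous_subtype_val)

end Polyhedron

/-! ### An escape strategy for the robber -/

section Escape

variable {X : Type*}

lemma copTraj_congr {k : ℕ} (c0 : Fin k → X) (σ : (n : ℕ) → (Fin (n + 2) → X) → Fin k → X)
    {r r' : ℕ → X} {n : ℕ} (h : ∀ m ≤ n, r m = r' m) : copTraj c0 σ r n = copTraj c0 σ r' n := by
  cases n with
  | zero => rfl
  | succ n =>
    rw [copTraj, copTraj]
    congr 1
    funext i
    exact h i (Nat.le_of_lt_succ i.2)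

lemma exists_reply {k : ℕ} (c0 : Fin k → X) (σ : (n : ℕ) → (Fin (n + 2) → X) → Fin k → X)
    (r0 : X) (next : X → (Fin k → X) → X) :
    ∃ r : ℕ → X, r 0 = r0 ∧ ∀ n, r (n + 1) = next (r n) (copTraj c0 σ r n) := by
  let H : ℕ → ℕ → X := fun n => Nat.rec (fun _ => r0)
    (fun n h => Function.update h (n + 1) (next (h n) (copTraj c0 σ h n))) n
  have hH : ∀ n, H (n + 1) = Function.update (H n) (n + 1) (next (H n n) (copTraj c0 σ (H n) n)) :=
    fun n => rfl
  have hstab : ∀ n m, n ≤ m → H m n = H n n := by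
    intro n m hnm
    induction m, hnm using Nat.le_induction with
    | base => rfl
    | succ m hm ih => rw [hH, Function.update_of_ne (by omega), ih]
  refine ⟨fun n => H n n, rfl, fun n => ?_⟩
  have : copTraj c0 σ (fun n => H n n) n = copTraj c0 σ (H n) n :=
    copTraj_congr c0 σ fun m hm => (hstab m n hm).symm
  simp only [this]
  rw [hH, Function.update_self]

lemma lt_copNumber [MetricSpace X] {k : ℕ} {R : Set X} (hR : R.Nonempty) {ε : ℝ} (hε : 0 < ε)
    (hstart : ∀ v ∈ R, ∃ c, ε < dist v c)
    (hstep : ∀ v ∈ R, ∀ l ≤ k, ∀ c : Fin l → X, (∀ i, ε < dist v (c i)) →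
      ∃ u ∈ R, dist v u ≤ 1 ∧ ∀ i, 1 + ε < dist u (c i)) :
    (k : ℕ∞) < copNumber X (fun x y => dist x y) := by
  classical
  have hlose : ∀ l ≤ k, ¬ CopsWinWith X (fun x y => dist x y) l := by
    intro l hl hwin
    obtain ⟨v, hv⟩ := hR
    obtain ⟨c, hc⟩ := hstart v hv
    obtain ⟨σ, hσ⟩ := hwin (fun _ => 1)
      ⟨fun _ => one_pos, fun h => one_ne_zero ((summable_const_iff (1 : ℝ)).1 h)⟩ v (fun _ => c)
    let good : X → (Fin l → X) → X → Prop :=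
      fun x c u => u ∈ R ∧ dist x u ≤ 1 ∧ ∀ i, 1 + ε < dist u (c i)
    let next : X → (Fin l → X) → X :=
      fun x c => if h : ∃ u, good x c u then h.choose else x
    obtain ⟨r, hr0, hr⟩ := exists_reply (fun _ => c) σ v next
    have hlegal : ∀ n, dist (r n) (r (n + 1)) ≤ 1 := by
      intro n
      rw [hr]
      simp only [next]
      split_ifs with h
      · exact h.choose_spec.2.1
      · simp
    obtain ⟨hcop, hclose⟩ := hσ r hr0 hlegal
    have hinv : ∀ n, r n ∈ R ∧ ∀ i, ε < dist (r n) (copTraj (fun _ => c) σ r n i) := by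
      intro n
      induction n with
      | zero => exact ⟨hr0 ▸ hv, fun i => hr0 ▸ hc⟩
      | succ n ih =>
        have h : ∃ u, good (r n) (copTraj (fun _ => c) σ r n) u := hstep _ ih.1 l hl _ ih.2
        have hn : r (n + 1) = h.choose := by
          rw [hr]
          simp only [next]
          rw [dif_pos h]
        have hs := h.choose_spec
        rw [← hn] at hs
        refine ⟨hs.1, fun i => ?_⟩
        have h1 := hs.2.2 i
        have h2 := hcop n i
        have h3 := dist_triangle (r (n + 1)) (copTraj (fun _ => c) σ r (n + 1) i)
          (copTraj (fun _ => c) σ r n i)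
        rw [dist_comm (copTraj (fun _ => c) σ r (n + 1) i)] at h3
        linarith
    obtain ⟨n, i, h⟩ := hclose ε hε
    exact lt_asymm h ((hinv n).2 i)
  refine lt_of_lt_of_le (b := ((k + 1 : ℕ) : ℕ∞)) (by exact_mod_cast Nat.lt_succ_self k) ?_
  refine le_sInf ?_
  rintro _ ⟨l, rfl, hl⟩
  by_contra h
  refine hlose l ?_ hl
  have : l < k + 1 := by exact_mod_cast not_le.1 h
  omega

end Escape

/-! ### A 1-Lipschitz function measuring the angle around a vertex -/

lemma mul_cos_sub_mul_cos_sq_le {a b : ℝ} (ha : 0 ≤ a) (hb : 0 ≤ b) (x y : ℝ) :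
    (a * Real.cos x - b * Real.cos y) ^ 2 ≤ (a - b) ^ 2 + a * b * (x - y) ^ 2 := by
  have h1 : 1 - (x - y) ^ 2 / 2 ≤ Real.cos (x - y) := Real.one_sub_sq_div_two_le_cos
  rw [Real.cos_sub] at h1
  have h2 := mul_le_mul_of_nonneg_left h1 (mul_nonneg ha hb)
  have h3 : (a * Real.cos x) ^ 2 = a ^ 2 - (a * Real.sin x) ^ 2 := by
    rw [mul_pow, mul_pow, Real.sin_sq]
    ring
  have h4 : (b * Real.cos y) ^ 2 = b ^ 2 - (b * Real.sin y) ^ 2 := by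
    rw [mul_pow, mul_pow, Real.sin_sq]
    ring
  nlinarith [sq_nonneg (a * Real.sin x - b * Real.sin y)]

lemma mul_sub_le_two_mul_sub {a b c g : ℝ} (ha : 0 ≤ a) (ha1 : a ≤ 1) (hb : 0 ≤ b) (hb1 : b ≤ 1)
    (hc : 0 ≤ c) (hcab : c ^ 2 ≤ a * b) (hg : 0 ≤ g) (hg2 : g ^ 2 = (1 + a) * (1 + b)) :
    g * (4 / 25 * (a + b - 2 * c)) ≤ 2 * (g - 1 - c) := by
  have hg' : g ≤ 2 := by nlinarith
  have hc1 : c ≤ 1 := by nlinarith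
  have hD : 0 ≤ a + b - 2 * c := by
    have : (2 * c) ^ 2 ≤ (a + b) ^ 2 := by nlinarith [sq_nonneg (a - b)]
    have := abs_le_of_sq_le_sq this (by positivity)
    linarith [(abs_le.1 this).2]
  have h1 : a + b - 2 * c ≤ (g - 1 - c) * (g + 1 + c) := by nlinarith
  have h2 : 0 ≤ g - 1 - c := by
    by_contra h
    nlinarith
  nlinarith

section Angle

variable {V : Type*} [Fintype V] [DecidableEq V]

/-- The average of `φ` at the projection of `z` to the simplex opposite to `v`. -/
noncomputable def angle (v : V) (φ : V → ℝ) (z : EuclideanSpace ℝ V) : ℝ :=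
  (∑ i ∈ Finset.univ.erase v, φ i * z i) / ((√2)⁻¹ - z v)

/-- The horizontal coordinate of `z` in truncated polar coordinates around `v`. -/
noncomputable def polar (v : V) (φ : V → ℝ) (z : EuclideanSpace ℝ V) : ℝ :=
  min (dist z (vertex v)) (1 / 2) * Real.cos (angle v φ z)

variable {v : V} {s : Finset V} {z z' : EuclideanSpace ℝ V} {φ : V → ℝ}

lemma sum_erase_of_mem_cell (hz : z ∈ cell s) (v : V) :
    ∑ i ∈ Finset.univ.erase v, z i = (√2)⁻¹ - z v := by
  rw [← hz.2.1, ← Finset.add_sum_erase _ _ (Finset.mem_univ v)]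
  ring

lemma apply_le_of_mem_cell (hz : z ∈ cell s) (v : V) : z v ≤ (√2)⁻¹ := by
  have h := sum_erase_of_mem_cell hz v
  have h2 : 0 ≤ ∑ i ∈ Finset.univ.erase v, z i := Finset.sum_nonneg fun i _ => hz.1 i
  linarith

lemma dist_sq_eq (z z' : EuclideanSpace ℝ V) (v : V) :
    dist z z' ^ 2 = (∑ i ∈ Finset.univ.erase v, (z i - z' i) ^ 2) + (z v - z' v) ^ 2 := by
  rw [EuclideanSpace.dist_eq, Real.sq_sqrt (Finset.sum_nonneg fun i _ => by positivity),
    ← Finset.add_sum_erase _ _ (Finset.mem_univ v), add_comm]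
  simp [Real.dist_eq, sq_abs]

lemma dist_vertex_sq (z : EuclideanSpace ℝ V) (v : V) :
    dist z (vertex v) ^ 2 = (∑ i ∈ Finset.univ.erase v, z i ^ 2) + ((√2)⁻¹ - z v) ^ 2 := by
  rw [dist_sq_eq z (vertex v) v, vertex_apply, if_pos rfl]
  congr 1
  · refine Finset.sum_congr rfl fun i hi => ?_
    rw [vertex_apply, if_neg (Finset.ne_of_mem_erase hi), sub_zero]
  · ring

lemma eq_vertex_of_mem_cell (hz : z ∈ cell s) (h : z v = (√2)⁻¹) : z = vertex v := by
  have h1 := sum_erase_of_mem_cell hz v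
  rw [h, sub_self, Finset.sum_eq_zero_iff_of_nonneg fun i _ => hz.1 i] at h1
  rw [← dist_eq_zero, ← sq_eq_zero_iff, dist_vertex_sq, h]
  rw [Finset.sum_eq_zero fun i hi => by rw [h1 i hi]; ring]
  ring

lemma half_lt_dist_vertex (h : z v = 0) : 1 / 2 < dist z (vertex v) := by
  have h1 : ((1 : ℝ) / 2) ^ 2 < dist z (vertex v) ^ 2 := by
    rw [dist_vertex_sq, h, sub_zero, inv_pow, Real.sq_sqrt (by norm_num)]
    have : 0 ≤ ∑ i ∈ Finset.univ.erase v, z i ^ 2 := Finset.sum_nonneg fun i _ => by positivity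
    linarith [show ((1 : ℝ) / 2) ^ 2 < 2⁻¹ by norm_num]
  exact lt_of_pow_lt_pow_left₀ 2 dist_nonneg h1

lemma angle_sub_sq_le (hs : s.card ≤ 4)
    (hφ : ∀ i ∈ s, ∀ j ∈ s, i ≠ v → j ≠ v → |φ i - φ j| ≤ 1 / 5)
    (hz : z ∈ cell s) (hz' : z' ∈ cell s) (h : z v < (√2)⁻¹) (h' : z' v < (√2)⁻¹) :
    (angle v φ z - angle v φ z') ^ 2 ≤ 4 / 25 * ∑ i ∈ Finset.univ.erase v,
      (z i / ((√2)⁻¹ - z v) - z' i / ((√2)⁻¹ - z' v)) ^ 2 := by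
  have hS := sum_erase_of_mem_cell hz v
  have hS' := sum_erase_of_mem_cell hz' v
  set S := (√2)⁻¹ - z v with hSdef
  set S' := (√2)⁻¹ - z' v with hSdef'
  have hpos : 0 < S := sub_pos.2 h
  have hpos' : 0 < S' := sub_pos.2 h'
  obtain ⟨j, hj, hjs⟩ : ∃ j ≠ v, j ∈ s := by
    by_contra! hne
    rw [Finset.sum_eq_zero fun i hi => hz.2.2 i (hne i (Finset.ne_of_mem_erase hi))] at hS
    exact hpos.ne hS
  have h1 : angle v φ z - angle v φ z' =
      ∑ i ∈ s.erase v, (φ i - φ j) * (z i / S - z' i / S') := by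
    have h2 : ∑ i ∈ s.erase v, (φ i - φ j) * (z i / S - z' i / S') =
        ∑ i ∈ Finset.univ.erase v, (φ i - φ j) * (z i / S - z' i / S') := by
      refine Finset.sum_subset (Finset.erase_subset_erase v (Finset.subset_univ s)) ?_
      intro i hi his
      have : i ∉ s := fun h => his (Finset.mem_erase.2 ⟨Finset.ne_of_mem_erase hi, h⟩)
      rw [hz.2.2 i this, hz'.2.2 i this]
      simp
    have h3 : ∑ i ∈ Finset.univ.erase v, (φ i - φ j) * (z i / S - z' i / S') =
        (∑ i ∈ Finset.univ.erase v, φ i * z i) / S - (∑ i ∈ Finset.univ.erase v, φ i * z' i) / S'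
        - φ j * ((∑ i ∈ Finset.univ.erase v, z i) / S -
          (∑ i ∈ Finset.univ.erase v, z' i) / S') := by
      simp only [Finset.sum_div, ← Finset.sum_sub_distrib, Finset.mul_sum]
      exact Finset.sum_congr rfl fun i _ => by ring
    rw [h2, h3, hS, hS', div_self hpos.ne', div_self hpos'.ne']
    simp [angle, ← hSdef, ← hSdef']
  rw [h1]
  refine (Finset.sum_mul_sq_le_sq_mul_sq _ _ _).trans ?_
  refine mul_le_mul ?_ ?_ (Finset.sum_nonneg fun i _ => by positivity) (by norm_num)
  · have h4 : ∀ i ∈ s.erase v, (φ i - φ j) ^ 2 ≤ 1 / 25 := by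
      intro i hi
      have := hφ i (Finset.mem_of_mem_erase hi) j hjs (Finset.ne_of_mem_erase hi) hj
      rw [← sq_abs]
      have h0 := abs_nonneg (φ i - φ j)
      nlinarith
    have h5 : ((s.erase v).card : ℝ) ≤ 4 := by
      exact_mod_cast (Finset.card_erase_le).trans hs
    have h6 := Finset.sum_le_card_nsmul _ _ _ h4
    rw [nsmul_eq_mul] at h6
    linarith
  · exact Finset.sum_le_sum_of_subset_of_nonneg
      (Finset.erase_subset_erase v (Finset.subset_univ s)) fun i _ _ => by positivity

lemma dist_mul_angle_sub_sq_le (hs : s.card ≤ 4)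
    (hφ : ∀ i ∈ s, ∀ j ∈ s, i ≠ v → j ≠ v → |φ i - φ j| ≤ 1 / 5)
    (hz : z ∈ cell s) (hz' : z' ∈ cell s) (h : z v < (√2)⁻¹) (h' : z' v < (√2)⁻¹) :
    (dist z (vertex v) - dist z' (vertex v)) ^ 2 + dist z (vertex v) * dist z' (vertex v) *
      (angle v φ z - angle v φ z') ^ 2 ≤ dist z z' ^ 2 := by
  have hθ := angle_sub_sq_le hs hφ hz hz' h h'
  have hS := sum_erase_of_mem_cell hz v
  have hS' := sum_erase_of_mem_cell hz' v
  have hr := dist_vertex_sq z v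
  have hr' := dist_vertex_sq z' v
  have hd := dist_sq_eq z z' v
  have hv : z v - z' v = ((√2)⁻¹ - z' v) - ((√2)⁻¹ - z v) := by ring
  rw [hv] at hd
  set S := (√2)⁻¹ - z v with hSdef
  set S' := (√2)⁻¹ - z' v with hSdef'
  have hpos : 0 < S := sub_pos.2 h
  have hpos' : 0 < S' := sub_pos.2 h'
  set r := dist z (vertex v)
  set r' := dist z' (vertex v)
  have hr0 : 0 ≤ r := dist_nonneg
  have hr0' : 0 ≤ r' := dist_nonneg
  set a := ∑ i ∈ Finset.univ.erase v, (z i / S) ^ 2 with ha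
  set b := ∑ i ∈ Finset.univ.erase v, (z' i / S') ^ 2 with hb
  set c := ∑ i ∈ Finset.univ.erase v, (z i / S) * (z' i / S') with hc
  have hA : ∑ i ∈ Finset.univ.erase v, z i ^ 2 = S ^ 2 * a := by
    rw [ha, Finset.mul_sum]
    exact Finset.sum_congr rfl fun i _ => by field_simp
  have hB : ∑ i ∈ Finset.univ.erase v, z' i ^ 2 = S' ^ 2 * b := by
    rw [hb, Finset.mul_sum]
    exact Finset.sum_congr rfl fun i _ => by field_simp
  have hC : ∑ i ∈ Finset.univ.erase v, z i * z' i = S * S' * c := by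
    rw [hc, Finset.mul_sum]
    exact Finset.sum_congr rfl fun i _ => by field_simp
  have hD : ∑ i ∈ Finset.univ.erase v, (z i / S - z' i / S') ^ 2 = a + b - 2 * c := by
    rw [ha, hb, hc, Finset.mul_sum, ← Finset.sum_add_distrib, ← Finset.sum_sub_distrib]
    exact Finset.sum_congr rfl fun i _ => by ring
  have hE : ∑ i ∈ Finset.univ.erase v, (z i - z' i) ^ 2 =
      S ^ 2 * a + S' ^ 2 * b - 2 * (S * S' * c) := by
    rw [← hA, ← hB, ← hC, Finset.mul_sum, ← Finset.sum_add_distrib, ← Finset.sum_sub_distrib]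
    exact Finset.sum_congr rfl fun i _ => by ring
  rw [hD] at hθ
  rw [hE] at hd
  rw [hA] at hr
  rw [hB] at hr'
  have hle : ∀ {x : EuclideanSpace ℝ V}, x ∈ cell s → 0 < (√2)⁻¹ - x v →
      ∑ i ∈ Finset.univ.erase v, (x i / ((√2)⁻¹ - x v)) ^ 2 ≤ 1 := by
    intro x hx hxv
    refine (Finset.sum_sq_le_sq_sum_of_nonneg ?_).trans ?_
    · exact fun i _ => div_nonneg (hx.1 i) hxv.le
    · rw [← Finset.sum_div, sum_erase_of_mem_cell hx v, div_self hxv.ne']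
      norm_num
  have key := mul_sub_le_two_mul_sub (a := a) (b := b) (c := c) (g := r * r' / (S * S'))
    (Finset.sum_nonneg fun i _ => by positivity) (hle hz hpos)
    (Finset.sum_nonneg fun i _ => by positivity) (hle hz' hpos')
    (Finset.sum_nonneg fun i _ => mul_nonneg (div_nonneg (hz.1 i) hpos.le)
      (div_nonneg (hz'.1 i) hpos'.le))
    (Finset.sum_mul_sq_le_sq_mul_sq _ _ _) (by positivity) (by
      rw [div_pow, mul_pow, hr, hr']
      field_simp
      ring)
  have key2 := mul_le_mul_of_nonneg_left key (mul_pos hpos hpos').le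
  have e1 : S * S' * (r * r' / (S * S') * (4 / 25 * (a + b - 2 * c))) =
      r * r' * (4 / 25 * (a + b - 2 * c)) := by field_simp
  have e2 : S * S' * (2 * (r * r' / (S * S') - 1 - c)) = 2 * (r * r' - S * S' - S * S' * c) := by
    field_simp
  rw [e1, e2] at key2
  have key3 := mul_le_mul_of_nonneg_left hθ (mul_nonneg hr0 hr0')
  rw [hd]
  linarith

lemma lipschitzOnWith_polar (hs : s.card ≤ 4)
    (hφ : ∀ i ∈ s, ∀ j ∈ s, i ≠ v → j ≠ v → |φ i - φ j| ≤ 1 / 5) :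
    LipschitzOnWith 1 (polar v φ) (cell s) := by
  have hvert : ∀ y, dist (polar v φ (vertex v)) (polar v φ y) ≤ dist (vertex v) y := by
    intro y
    have h0 : polar v φ (vertex v) = 0 := by simp [polar]
    rw [h0, dist_comm, Real.dist_eq, sub_zero, dist_comm, polar, abs_mul]
    have h1 := Real.abs_cos_le_one (angle v φ y)
    have h2 : 0 ≤ min (dist y (vertex v)) (1 / 2) := le_min dist_nonneg (by norm_num)
    rw [abs_of_nonneg h2]
    calc _ ≤ min (dist y (vertex v)) (1 / 2) * 1 := by gcongr
      _ ≤ _ := by rw [mul_one]; exact min_le_left _ _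
  refine LipschitzOnWith.of_dist_le_mul fun z hz z' hz' => ?_
  rw [NNReal.coe_one, one_mul]
  rcases (apply_le_of_mem_cell hz v).eq_or_lt with h | h
  · rw [eq_vertex_of_mem_cell hz h]
    exact hvert z'
  rcases (apply_le_of_mem_cell hz' v).eq_or_lt with h' | h'
  · rw [eq_vertex_of_mem_cell hz' h', dist_comm, dist_comm z]
    exact hvert z
  have h1 := dist_mul_angle_sub_sq_le hs hφ hz hz' h h'
  rw [Real.dist_eq]
  refine abs_le_of_sq_le_sq ?_ dist_nonneg
  refine le_trans ?_ h1
  have hr0 : 0 ≤ dist z (vertex v) := dist_nonneg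
  have hr0' : 0 ≤ dist z' (vertex v) := dist_nonneg
  have hm : 0 ≤ min (dist z (vertex v)) (1 / 2) := le_min hr0 (by norm_num)
  have hm' : 0 ≤ min (dist z' (vertex v)) (1 / 2) := le_min hr0' (by norm_num)
  refine (mul_cos_sub_mul_cos_sq_le hm hm' _ _).trans (add_le_add ?_ ?_)
  · refine sq_le_sq.2 ?_
    have := abs_min_sub_min_le_max (dist z (vertex v)) (1 / 2) (dist z' (vertex v)) (1 / 2)
    simpa using this
  · gcongr
    · exact min_le_left _ _
    · exact min_le_left _ _

end Angle

/-! ### Distances in graphs, truncated -/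

section StepDist

variable {V : Type*} {E : V → V → Prop}

lemma StepsWithin.trans {m n : ℕ} {x y z : V} (h : StepsWithin E m x y) (h' : StepsWithin E n y z) :
    StepsWithin E (m + n) x z := by
  induction n generalizing z with
  | zero => exact h' ▸ h
  | succ n ih =>
    obtain ⟨w, hw, hwz⟩ := h'
    exact ⟨w, ih hw, hwz⟩

lemma StepsWithin.symm (hE : ∀ x y, E x y → E y x) {n : ℕ} {x y : V} (h : StepsWithin E n x y) :
    StepsWithin E n y x := by
  induction n generalizing y with
  | zero => exact Eq.symm h
  | succ n ih =>
    obtain ⟨w, hw, hwy⟩ := h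
    have h1 : StepsWithin E 1 y w := ⟨y, rfl, hwy.imp Eq.symm (hE _ _)⟩
    rw [add_comm]
    exact h1.trans (ih hw)

/-- The distance from `u` to `w` in the graph `E`, truncated at `17`. -/
noncomputable def stepDist (E : V → V → Prop) (u w : V) : ℕ :=
  sInf {m | StepsWithin E m u w ∨ m = 17}

lemma stepDist_spec (E : V → V → Prop) (u w : V) :
    StepsWithin E (stepDist E u w) u w ∨ stepDist E u w = 17 :=
  Nat.sInf_mem (s := {m | StepsWithin E m u w ∨ m = 17}) ⟨17, Or.inr rfl⟩

lemma stepDist_le (E : V → V → Prop) (u w : V) : stepDist E u w ≤ 17 :=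
  Nat.sInf_le (Or.inr rfl)

lemma stepDist_le_of_stepsWithin {m : ℕ} {u w : V} (h : StepsWithin E m u w) :
    stepDist E u w ≤ m :=
  Nat.sInf_le (Or.inl h)

lemma stepDist_le_succ {u w w' : V} (h : w = w' ∨ E w w') :
    stepDist E u w' ≤ stepDist E u w + 1 := by
  rcases stepDist_spec E u w with h1 | h1
  · exact stepDist_le_of_stepsWithin ⟨w, h1, h⟩
  · have := stepDist_le E u w'
    omega

/-- A slowly varying function which vanishes near `u` and equals `π` far away from `u`. -/
noncomputable def slope (E : V → V → Prop) (u w : V) : ℝ :=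
  min Real.pi (((stepDist E u w - 1 : ℕ) : ℝ) / 5)

lemma slope_eq_zero {u w : V} (h : u = w ∨ E u w) : slope E u w = 0 := by
  have h1 : stepDist E u w ≤ 1 := stepDist_le_of_stepsWithin ⟨u, rfl, h⟩
  rw [slope, Nat.sub_eq_zero_of_le h1]
  simp [Real.pi_pos.le]

lemma slope_le_add {u w w' : V} (h : w = w' ∨ E w w') : slope E u w' ≤ slope E u w + 1 / 5 := by
  have h1 := stepDist_le_succ (u := u) h
  have h2 : ((stepDist E u w' - 1 : ℕ) : ℝ) ≤ ((stepDist E u w - 1 : ℕ) : ℝ) + 1 := by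
    exact_mod_cast (by omega : stepDist E u w' - 1 ≤ stepDist E u w - 1 + 1)
  unfold slope
  rcases min_choice Real.pi (((stepDist E u w - 1 : ℕ) : ℝ) / 5) with h3 | h3 <;> rw [h3]
  · exact (min_le_left _ _).trans (by norm_num)
  · exact (min_le_right _ _).trans (by linarith)

lemma abs_slope_sub_le (hE : ∀ x y, E x y → E y x) {u w w' : V} (h : w = w' ∨ E w w') :
    |slope E u w - slope E u w'| ≤ 1 / 5 := by
  have h1 := slope_le_add (u := u) h
  have h2 := slope_le_add (u := u) (h.imp Eq.symm (hE _ _))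
  rw [abs_le]
  constructor <;> linarith

lemma stepsWithin_of_slope_ne {u w : V} (h : slope E u w ≠ Real.pi) : StepsWithin E 17 u w := by
  rcases stepDist_spec E u w with h1 | h1
  · exact h1.mono (stepDist_le E u w)
  · refine absurd ?_ h
    rw [slope, h1]
    refine min_eq_left ?_
    have := Real.pi_lt_d2
    norm_num
    linarith

end StepDist

lemma AdjAvoiding.symm {V : Type*} [DecidableEq V] {K : Set (Finset V)} {v x y : V}
    (h : AdjAvoiding K v x y) : AdjAvoiding K v y x :=
  ⟨h.2.1, h.1, Finset.pair_comm x y ▸ h.2.2⟩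

lemma IsComplex.adjAvoiding {V : Type*} [DecidableEq V] {K : Set (Finset V)} {s : Finset V} {v : V}
    (hK : IsComplex K) (hs : s ∈ K) {i j : V} (hi : i ∈ s) (hj : j ∈ s) (hiv : i ≠ v) (hjv : j ≠ v) :
    AdjAvoiding K v i j :=
  ⟨hiv, hjv, hK.down s hs _ (Finset.insert_subset hi (Finset.singleton_subset_iff.2 hj))
    (Finset.insert_nonempty _ _)⟩

section Angle

variable {V : Type*} [Fintype V] [DecidableEq V] {K : Set (Finset V)} {s : Finset V} {u v : V}
  {z : EuclideanSpace ℝ V}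

lemma mem_of_mem_cell (hz : z ∈ cell s) {i : V} (h : z i ≠ 0) : i ∈ s := by
  by_contra hi
  exact h (hz.2.2 i hi)

lemma angle_slope_eq_zero (hK : IsComplex K) (hz : z ∈ polyhedron K) (huv : u ≠ v) (h : z u ≠ 0) :
    angle v (slope (AdjAvoiding K v) u) z = 0 := by
  obtain ⟨⟨s, hs⟩, hzs⟩ := mem_iUnion.1 hz
  rw [angle, Finset.sum_eq_zero, zero_div]
  intro i hi
  by_cases his : z i = 0
  · rw [his, mul_zero]
  rw [slope_eq_zero, zero_mul]
  exact Or.inr (hK.adjAvoiding hs (mem_of_mem_cell hzs h) (mem_of_mem_cell hzs his) huv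
    (Finset.ne_of_mem_erase hi))

lemma exists_stepsWithin_of_angle_ne (hzs : z ∈ cell s) (hzv : z ≠ vertex v)
    (h : angle v (slope (AdjAvoiding K v) u) z ≠ Real.pi) :
    ∃ w ∈ s, w ≠ v ∧ StepsWithin (AdjAvoiding K v) 17 u w := by
  by_contra! hne
  refine h ?_
  have hsum := sum_erase_of_mem_cell hzs v
  have h0 : (√2)⁻¹ - z v ≠ 0 := fun h0 => hzv (eq_vertex_of_mem_cell hzs (sub_eq_zero.1 h0).symm)
  have h1 : ∑ i ∈ Finset.univ.erase v, slope (AdjAvoiding K v) u i * z i =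
      ∑ i ∈ Finset.univ.erase v, Real.pi * z i := by
    refine Finset.sum_congr rfl fun i hi => ?_
    by_cases his : z i = 0
    · rw [his, mul_zero, mul_zero]
    by_contra hi'
    refine hne i (mem_of_mem_cell hzs his) (Finset.ne_of_mem_erase hi) (stepsWithin_of_slope_ne ?_)
    exact fun h => hi' (by rw [h])
  rw [angle, h1, ← Finset.mul_sum, hsum, mul_div_assoc, div_self h0, mul_one]

lemma angle_slope_eq_pi_or (hK : IsComplex K) {u' : V} (hz : z ∈ polyhedron K) (hzv : z ≠ vertex v)
    (h : ¬ StepsWithin (AdjAvoiding K v) 40 u u') :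
    angle v (slope (AdjAvoiding K v) u) z = Real.pi ∨
      angle v (slope (AdjAvoiding K v) u') z = Real.pi := by
  by_contra! hne
  obtain ⟨⟨s, hs⟩, hzs⟩ := mem_iUnion.1 hz
  obtain ⟨w, hw, hwv, h1⟩ := exists_stepsWithin_of_angle_ne hzs hzv hne.1
  obtain ⟨w', hw', hwv', h2⟩ := exists_stepsWithin_of_angle_ne hzs hzv hne.2
  have h3 : StepsWithin (AdjAvoiding K v) 1 w w' :=
    ⟨w, rfl, Or.inr (hK.adjAvoiding hs hw hw' hwv hwv')⟩
  exact h (((h1.trans h3).trans (h2.symm fun _ _ => AdjAvoiding.symm)).mono (by norm_num))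

lemma half_le_dist_of_dist_le (huv : u ≠ v)
    (h : dist z (vertex u) ≤ 1 / 2) : 1 / 2 ≤ dist z (vertex v) := by
  have h1 := dist_triangle (vertex u) z (vertex v)
  rw [dist_vertex huv, dist_comm (vertex u)] at h1
  linarith

end Angle

section Intrinsic

variable {V : Type} [Fintype V] {K : Set (Finset V)} {X : Type} [MetricSpace X]
  {e : X ≃ₜ polyhedron K} {u v : V}

lemma dist_coe_le (he : ∀ x y, ENNReal.ofReal (dist x y) = intrinsicDistE (polyhedron K) (e x) (e y))
    (x y : X) : dist (e x : EuclideanSpace ℝ V) (e y) ≤ dist x y := by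
  have h := edist_le_intrinsicDistE (e x) (e y)
  rw [← he, edist_dist] at h
  exact (ENNReal.ofReal_le_ofReal_iff dist_nonneg).1 h

lemma dist_le_dist_coe
    (he : ∀ x y, ENNReal.ofReal (dist x y) = intrinsicDistE (polyhedron K) (e x) (e y))
    {s : Finset V} (hs : s ∈ K) {x y : X} (hx : (e x : EuclideanSpace ℝ V) ∈ cell s)
    (hy : (e y : EuclideanSpace ℝ V) ∈ cell s) :
    dist x y ≤ dist (e x : EuclideanSpace ℝ V) (e y) := by
  have h := intrinsicDistE_le_edist (A := polyhedron K) (x := e x) (y := e y)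
    (((convex_cell s).segment_subset hx hy).trans (subset_iUnion (fun s : K => cell s.1) ⟨s, hs⟩))
  rw [← he, edist_dist] at h
  exact (ENNReal.ofReal_le_ofReal_iff dist_nonneg).1 h

variable [DecidableEq V]

lemma abs_polar_slope_sub_le (hK : IsComplex K) (hcard : ∀ s ∈ K, s.card ≤ 4)
    (he : ∀ x y, ENNReal.ofReal (dist x y) = intrinsicDistE (polyhedron K) (e x) (e y)) (x y : X) :
    |polar v (slope (AdjAvoiding K v) u) (e x) - polar v (slope (AdjAvoiding K v) u) (e y)|
      ≤ dist x y := by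
  have h := edist_le_intrinsicDistE_of_piecewise (F := polar v (slope (AdjAvoiding K v) u))
    (C := fun s : K => cell s.1) (A := polyhedron K) (fun s => (isCompact_cell s.1).isClosed)
    (fun s => lipschitzOnWith_polar (hcard _ s.2) fun i hi j hj hiv hjv =>
      abs_slope_sub_le (fun _ _ => AdjAvoiding.symm)
        (Or.inr (hK.adjAvoiding s.2 hi hj hiv hjv))) rfl (e x) (e y)
  rw [← he, edist_dist, Real.dist_eq] at h
  exact (ENNReal.ofReal_le_ofReal_iff dist_nonneg).1 h

lemma one_add_le_dist (hK : IsComplex K) (hcard : ∀ s ∈ K, s.card ≤ 4)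
    (he : ∀ x y, ENNReal.ofReal (dist x y) = intrinsicDistE (polyhedron K) (e x) (e y))
    (hgeo : ∀ x y : X, ∃ g : ℝ → X, g 0 = x ∧ g 1 = y ∧
      ∀ s ∈ Icc (0 : ℝ) 1, ∀ t ∈ Icc (0 : ℝ) 1, dist (g s) (g t) ≤ |s - t| * dist x y)
    (huv : u ≠ v) {x y : X} (hy : (e y : EuclideanSpace ℝ V) = vertex u)
    (hx : angle v (slope (AdjAvoiding K v) u) (e x) = Real.pi) :
    1 + min (dist (e x : EuclideanSpace ℝ V) (vertex v)) (1 / 2) ≤ dist x y := by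
  have hnear : ∀ q, dist q y ≤ 1 / 2 → dist (e q : EuclideanSpace ℝ V) (vertex u) ≤ 1 / 2 ∧
      angle v (slope (AdjAvoiding K v) u) (e q) = 0 := by
    intro q hq
    have h1 : dist (e q : EuclideanSpace ℝ V) (vertex u) ≤ 1 / 2 :=
      hy ▸ (dist_coe_le he q y).trans hq
    refine ⟨h1, angle_slope_eq_zero hK (e q).2 huv fun h => ?_⟩
    exact h1.not_gt (half_lt_dist_vertex h)
  have hD : 1 / 2 < dist x y := by
    by_contra! h
    rw [(hnear x h).2] at hx
    exact Real.pi_pos.ne hx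
  obtain ⟨g, hg0, hg1, hg⟩ := hgeo x y
  set D := dist x y with hDdef
  have hD0 : 0 < D := by linarith
  have ht : 1 - 1 / (2 * D) ∈ Icc (0 : ℝ) 1 := by
    constructor
    · rw [sub_nonneg, div_le_one (by positivity)]
      linarith
    · have : 0 ≤ 1 / (2 * D) := by positivity
      linarith
  set t := 1 - 1 / (2 * D) with htdef
  have hq1 : dist x (g t) ≤ D - 1 / 2 := by
    have := hg 0 (by simp) t ht
    rw [hg0, zero_sub, abs_neg, abs_of_nonneg ht.1, htdef] at this
    refine this.trans_eq ?_
    field_simp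
  have hq2 : dist (g t) y ≤ 1 / 2 := by
    have := hg t ht 1 (by simp)
    rw [hg1, abs_sub_comm, abs_of_nonneg (sub_nonneg.2 ht.2), htdef] at this
    refine this.trans_eq ?_
    field_simp
    ring
  obtain ⟨h1, h2⟩ := hnear _ hq2
  have h3 : (1 : ℝ) / 2 ≤ dist (e (g t) : EuclideanSpace ℝ V) (vertex v) :=
    half_le_dist_of_dist_le huv h1
  have h4 := abs_polar_slope_sub_le (u := u) (v := v) hK hcard he x (g t)
  rw [polar, polar, hx, h2, min_eq_right h3, Real.cos_pi, Real.cos_zero] at h4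
  have h5 := (abs_le.1 h4).1
  linarith

lemma quarter_lt_min_dist
    (he : ∀ x y, ENNReal.ofReal (dist x y) = intrinsicDistE (polyhedron K) (e x) (e y))
    {x y : X} (hy : (e y : EuclideanSpace ℝ V) = vertex v) (h : 1 / 4 < dist x y) :
    1 / 4 < min (dist (e x : EuclideanSpace ℝ V) (vertex v)) (1 / 2) := by
  refine lt_min ?_ (by norm_num)
  by_cases hv : (e x : EuclideanSpace ℝ V) v = 0
  · exact lt_trans (by norm_num) (half_lt_dist_vertex hv)
  · obtain ⟨⟨s, hs⟩, hxs⟩ := mem_iUnion.1 (e x).2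
    have hys : (e y : EuclideanSpace ℝ V) ∈ cell s :=
      hy ▸ vertex_mem_cell.2 (mem_of_mem_cell hxs hv)
    exact hy ▸ h.trans_le (dist_le_dist_coe he hs hxs hys)

lemma lt_copNumber_of_far_neighbours (hK : IsComplex K) (hcard : ∀ s ∈ K, s.card ≤ 4)
    (he : ∀ x y, ENNReal.ofReal (dist x y) = intrinsicDistE (polyhedron K) (e x) (e y))
    (hgeo : ∀ x y : X, ∃ g : ℝ → X, g 0 = x ∧ g 1 = y ∧
      ∀ s ∈ Icc (0 : ℝ) 1, ∀ t ∈ Icc (0 : ℝ) 1, dist (g s) (g t) ≤ |s - t| * dist x y)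
    {k : ℕ} {R : Set V} (hne : R.Nonempty) (hR : ∀ v ∈ R, ∃ S : Finset V, k < S.card ∧
      (∀ u ∈ S, u ∈ R ∧ u ≠ v ∧ {v, u} ∈ K) ∧
      ∀ u ∈ S, ∀ u' ∈ S, u ≠ u' → ¬ StepsWithin (AdjAvoiding K v) 40 u u') :
    (k : ℕ∞) < copNumber X (fun x y => dist x y) := by
  have hedge : ∀ x y : X, ∀ v u, u ≠ v → {v, u} ∈ K → (e x : EuclideanSpace ℝ V) = vertex v →
      (e y : EuclideanSpace ℝ V) = vertex u → dist x y = 1 := by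
    intro x y v u huv hvu hx hy
    rw [← dist_vertex huv.symm, ← hx, ← hy]
    refine le_antisymm (dist_le_dist_coe he hvu ?_ ?_) (dist_coe_le he x y)
    · exact hx ▸ vertex_mem_cell.2 (by simp)
    · exact hy ▸ vertex_mem_cell.2 (by simp)
  have hpoint : ∀ u v : V, {v, u} ∈ K → ∃ y : X, (e y : EuclideanSpace ℝ V) = vertex u := by
    intro u v hvu
    have : vertex u ∈ polyhedron K :=
      mem_iUnion.2 ⟨⟨_, hvu⟩, vertex_mem_cell.2 (by simp)⟩
    exact ⟨e.symm ⟨_, this⟩, by simp⟩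
  refine lt_copNumber (R := {x | ∃ v ∈ R, (e x : EuclideanSpace ℝ V) = vertex v}) ?_
    (ε := 1 / 4) (by norm_num) ?_ ?_
  · obtain ⟨v, hv⟩ := hne
    obtain ⟨S, hS, hSR, -⟩ := hR v hv
    obtain ⟨u, hu⟩ := Finset.card_pos.1 (Nat.zero_lt_of_lt hS)
    obtain ⟨y, hy⟩ := hpoint u v (hSR u hu).2.2
    exact ⟨y, u, (hSR u hu).1, hy⟩
  · rintro x ⟨v, hv, hx⟩
    obtain ⟨S, hS, hSR, -⟩ := hR v hv
    obtain ⟨u, hu⟩ := Finset.card_pos.1 (Nat.zero_lt_of_lt hS)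
    obtain ⟨-, huv, hvu⟩ := hSR u hu
    obtain ⟨y, hy⟩ := hpoint u v hvu
    refine ⟨y, ?_⟩
    rw [hedge x y v u huv hvu hx hy]
    norm_num
  · rintro x ⟨v, hv, hx⟩ l hl c hc
    obtain ⟨S, hS, hSR, hfar⟩ := hR v hv
    by_contra! hne
    have hblock : ∀ u : S, ∃ i, ∀ y, (e y : EuclideanSpace ℝ V) = vertex u.1 →
        dist y (c i) ≤ 1 + 1 / 4 := by
      rintro ⟨u, hu⟩
      obtain ⟨huR, huv, hvu⟩ := hSR u hu
      obtain ⟨y, hy⟩ := hpoint u v hvu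
      obtain ⟨i, hi⟩ := hne y ⟨u, huR, hy⟩ (hedge x y v u huv hvu hx hy).le
      refine ⟨i, fun y' hy' => ?_⟩
      rwa [e.injective (Subtype.ext (hy'.trans hy.symm))]
    choose b hb using hblock
    obtain ⟨u, u', huu', hbu⟩ : ∃ u u' : S, u ≠ u' ∧ b u = b u' :=
      Fintype.exists_ne_map_eq_of_card_lt b (by simpa using hl.trans_lt hS)
    have hci : 1 / 4 < dist (c (b u)) x := dist_comm x _ ▸ hc (b u)
    have hmin := quarter_lt_min_dist he hx hci
    have hcv : (e (c (b u)) : EuclideanSpace ℝ V) ≠ vertex v := by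
      intro h
      rw [h, dist_self] at hmin
      norm_num at hmin
    have hpi : ∀ w : S, b w = b u →
        angle v (slope (AdjAvoiding K v) w.1) (e (c (b u))) ≠ Real.pi := by
      intro w hw h
      obtain ⟨-, hwv, hvw⟩ := hSR w w.2
      obtain ⟨y, hy⟩ := hpoint w v hvw
      have h1 := one_add_le_dist hK hcard he hgeo hwv hy h
      have h2 := hb w y hy
      rw [hw, dist_comm] at h2
      linarith
    rcases angle_slope_eq_pi_or hK (e (c (b u))).2 hcv
      (hfar u u.2 u' u'.2 fun h => huu' (Subtype.ext h)) with h | h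
    · exact hpi u rfl h
    · exact hpi u' hbu.symm h

end Intrinsic

end CopSphere

/-- Counterexample 2 of the paper, simplicial version. For every `k`
there is a simplicially metrized game space `(X,d)` homeomorphic to the `3`-sphere whose
cop number exceeds `k`. (Since all homology groups of `𝕊³` in degrees `1,2,3` vanish, this
disproves Mohar's conjecture bounding the cop number of a simplicial pseudomanifold in
terms of the ranks of its homology groups.) -/
theorem exists_simplicial_sphere3_large_cop_number (k : ℕ) :
    ∃ (X : Type) (_ : MetricSpace X),
      GameSpaceD X (fun x y => dist x y) ∧
      SimpliciallyMetrized X ∧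
      Nonempty (X ≃ₜ ↥(Metric.sphere (0 : EuclideanSpace ℝ (Fin 4)) 1)) ∧
      (k : ℕ∞) < copNumber X (fun x y => dist x y) := by
  obtain ⟨N, K, hK, hcard, ⟨f⟩, R, hne, hR⟩ := CopSphere.exists_sphere_far_neighbours k 40
  obtain ⟨f'⟩ := CopSphere.nonempty_homeomorph_polyhedron hK
  have hsphere : IsConnected (Metric.sphere (0 : EuclideanSpace ℝ (Fin 4)) 1) :=
    isConnected_sphere (by simp [← Module.finrank_eq_rank]) _ zero_le_one
  have hconn : IsConnected (CopSphere.polyhedron K) := by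
    rw [isConnected_iff_connectedSpace] at hsphere ⊢
    exact (f'.trans f).symm.surjective.connectedSpace (f'.trans f).symm.continuous
  obtain ⟨X, _, e, hX, he, hgeo⟩ := CopSphere.exists_intrinsic_gameSpaceD hconn
    (fun s : K => CopSphere.cell s.1) (fun s => CopSphere.isCompact_cell s.1)
    (fun s => CopSphere.convex_cell s.1) rfl
  obtain ⟨G, hG, hGd, hGs⟩ := CopSphere.exists_simplicialComplex hK
  refine ⟨X, inferInstance, hX, ⟨N, G, hG, hGd, ?_⟩, ⟨(e.trans f').trans f⟩,
    CopSphere.lt_copNumber_of_far_neighbours hK hcard he hgeo hne hR⟩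
  rw [hGs]
  exact ⟨e.toEquiv, he⟩
end

section
/- Let (X,d) be a game space, S ⊆ X a nonempty compact subset, k ∈ ℕ, M > 0 and ε ∈ (0, h], where h ≥ M + diam(X). Suppose the robber has a strategy in the game against k cops on X, with an agility function τ satisfying τ(n) ≤ M for all n (and Σ_n τ(n)=∞), which guarantees d(r^n, c^n_i) > ε for all n and all i ≤ k against every cop play. Let d⁺ be any metric on the underlying set of X_{h,S} such that (A) d⁺(x,y) ≥ d'(x,y) for all x,y ∈ X_{h,S}, (B) d⁺(x,y) = d(x,y) for all x,y ∈ X, and (C) d⁺ induces the same topology as d', and suppose (X_{h,S}, d⁺) is a game space. Then the robber has a strategy against k cops on (X_{h,S}, d⁺), with the same agility function τ, which guarantees d⁺(r^n, c^n_i) > ε/3 for all n and all i ≤ k against every cop play; in particular k cops do not have a winning strategy on (X_{h,S}, d⁺). -/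
/-!
Game of Cops and Robber on metric spaces, following Mohar, formalized relative to an
explicit distance function `d : Y → Y → ℝ`.
-/

open Set Filter Topology

/-!
The hat construction `X_{h,S}` of the paper: given a metric space `X`, a subset `S ⊆ X` and
`h > 0`, we glue onto `X` the hat over `S`, consisting of the cylinder `S × [0,h]` with the
`ℓ₁` metric and the top, a cone over `S` of height `H = h + diam S`.  The resulting space is
equipped with the induced length metric: distances are infima of lengths of piecewise paths,
each piece lying in one part and measured with that part's metric.
-/

section Hat

variable {X : Type*} [MetricSpace X]

/-- Points of the cylinder `S × [0,h]`. -/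
abbrev CylPt (S : Set X) (h : ℝ) : Type _ := ↥S × ↥(Set.Icc (0 : ℝ) h)

/-- Points of the (un-collapsed) top `S × [0, h + diam S]`. -/
abbrev TopPt (S : Set X) (h : ℝ) : Type _ := ↥S × ↥(Set.Icc (0 : ℝ) (h + Metric.diam S))

/-- The disjoint union of the three parts of `X_{h,S}`: the space `X`, the cylinder, and
the top. -/
abbrev PrePt (S : Set X) (h : ℝ) : Type _ := X ⊕ (CylPt S h ⊕ TopPt S h)

/-- The `ℓ₁` metric `d₁` on the cylinder. -/
noncomputable def cylDist {S : Set X} {h : ℝ} (p q : CylPt S h) : ℝ :=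
  dist (p.1 : X) (q.1 : X) + |(p.2 : ℝ) - (q.2 : ℝ)|

/-- The metric `d₂` on the top: the quotient pseudometric of the `ℓ₁` metric on
`S × [0,H]`, `H = h + diam S`, under collapsing the layer `S × {H}` to a point. -/
noncomputable def topDist {S : Set X} {h : ℝ} (p q : TopPt S h) : ℝ :=
  min (dist (p.1 : X) (q.1 : X) + |(p.2 : ℝ) - (q.2 : ℝ)|)
    ((h + Metric.diam S - (p.2 : ℝ)) + (h + Metric.diam S - (q.2 : ℝ)))

/-- The part-wise cost on the disjoint union: within one part, the metric of that part;
`⊤` across different parts. -/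
noncomputable def preDist (S : Set X) (h : ℝ) : PrePt S h → PrePt S h → ENNReal
  | Sum.inl x, Sum.inl y => ENNReal.ofReal (dist x y)
  | Sum.inr (Sum.inl p), Sum.inr (Sum.inl q) => ENNReal.ofReal (cylDist p q)
  | Sum.inr (Sum.inr p), Sum.inr (Sum.inr q) => ENNReal.ofReal (topDist p q)
  | _, _ => ⊤

/-- The gluing relation defining `X_{h,S}`: each `s ∈ S` is identified with the point
`(s,0)` of the cylinder; the layer `S × {h}` of the cylinder is identified with the layer
`S × {0}` of the top; and the whole layer `S × {H}` of the top is collapsed to one point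
(the cone point `z`). -/
inductive Glue (S : Set X) (h : ℝ) : PrePt S h → PrePt S h → Prop
  | base (s : ↥S) (t : ↥(Set.Icc (0 : ℝ) h)) (ht : (t : ℝ) = 0) :
      Glue S h (Sum.inl (s : X)) (Sum.inr (Sum.inl (s, t)))
  | mid (s : ↥S) (t : ↥(Set.Icc (0 : ℝ) h)) (u : ↥(Set.Icc (0 : ℝ) (h + Metric.diam S)))
      (ht : (t : ℝ) = h) (hu : (u : ℝ) = 0) :
      Glue S h (Sum.inr (Sum.inl (s, t))) (Sum.inr (Sum.inr (s, u)))
  | apex (p q : TopPt S h) (hp : (p.2 : ℝ) = h + Metric.diam S)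
      (hq : (q.2 : ℝ) = h + Metric.diam S) :
      Glue S h (Sum.inr (Sum.inr p)) (Sum.inr (Sum.inr q))

/-- The underlying set of `X_{h,S}`: the quotient of the disjoint union by the gluing. -/
abbrev GlueSp (S : Set X) (h : ℝ) : Type _ := Quot (Glue S h)

end Hat

/-- A piecewise path between two points of a glued space `Quot R`: a finite sequence of
paths, each continuous within a single part (with respect to the part-wise cost `c`), with
consecutive endpoints glued. -/
structure PiecewisePath {Y : Type*} (c : Y → Y → ENNReal) (R : Y → Y → Prop)
    (a b : Quot R) where
  m : ℕ
  piece : Fin (m + 1) → ℝ → Y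
  cont : ∀ i, econt c (piece i)
  first : Quot.mk R (piece 0 0) = a
  last : Quot.mk R (piece (Fin.last m) 1) = b
  link : ∀ i : Fin m, Quot.mk R (piece i.castSucc 1) = Quot.mk R (piece i.succ 0)

/-- The length of a piecewise path: the sum of the lengths of its pieces, each measured with
the corresponding part's metric. -/
noncomputable def PiecewisePath.len {Y : Type*} {c : Y → Y → ENNReal} {R : Y → Y → Prop}
    {a b : Quot R} (P : PiecewisePath c R a b) : ENNReal :=
  ∑ i : Fin (P.m + 1), elen c (P.piece i)

/-- The induced length metric on a glued space: the infimum of lengths of piecewise paths. -/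
noncomputable def glueDist {Y : Type*} (c : Y → Y → ENNReal) (R : Y → Y → Prop)
    (a b : Quot R) : ENNReal :=
  ⨅ P : PiecewisePath c R a b, P.len

section Hat2

variable {X : Type*} [MetricSpace X]

/-- The induced length metric `d'` on `X_{h,S}`, with values in `[0,∞]`. -/
noncomputable def hatDistE (S : Set X) (h : ℝ) (a b : GlueSp S h) : ENNReal :=
  glueDist (preDist S h) (Glue S h) a b

/-- The induced length metric `d'` on `X_{h,S}`, as a real-valued function. -/
noncomputable def hatDist (S : Set X) (h : ℝ) (a b : GlueSp S h) : ℝ :=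
  (hatDistE S h a b).toReal

/-- The canonical inclusion `X ↪ X_{h,S}`. -/
def iotaX (S : Set X) (h : ℝ) (x : X) : GlueSp S h := Quot.mk _ (Sum.inl x)

end Hat2

/-- The topology generated by the open balls of a distance function `d`. For a metric `d`
this is the metric topology. -/
def ballTopOf {Y : Type*} (d : Y → Y → ℝ) : TopologicalSpace Y :=
  TopologicalSpace.generateFrom {B | ∃ (a : Y) (ε : ℝ), B = {b | d a b < ε}}

section GeneralGame

variable {Y : Type*} {d : Y → Y → ℝ} {k : ℕ}

/-- A robber strategy depends only on the cop moves made so far. -/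
lemma robTraj_congr (r0 : Y) (ρ : (n : ℕ) → (Fin (n + 1) → Fin k → Y) → Y)
    {c c' : ℕ → Fin k → Y} {n : ℕ} (hc : ∀ m < n, c m = c' m) :
    robTraj r0 ρ c n = robTraj r0 ρ c' n := by
  cases n with
  | zero => rfl
  | succ n =>
    simp only [robTraj]
    congr 1
    funext i
    exact hc i i.2

/-- A cop strategy depends only on the robber moves made so far. -/
lemma copTraj_congr (c0 : Fin k → Y) (σ : (n : ℕ) → (Fin (n + 2) → Y) → Fin k → Y)
    {r r' : ℕ → Y} {n : ℕ} (hr : ∀ m ≤ n, r m = r' m) :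
    copTraj c0 σ r n = copTraj c0 σ r' n := by
  cases n with
  | zero => rfl
  | succ n =>
    simp only [copTraj]
    congr 1
    funext i
    exact hr i (Nat.lt_succ_iff.1 i.2)

/-- The history of a play of a robber strategy against a cop strategy: `playHist n m` is the
position at time `min m n`. -/
def playHist (r0 : Y) (c0 : Fin k → Y) (ρ : (n : ℕ) → (Fin (n + 1) → Fin k → Y) → Y)
    (σ : (n : ℕ) → (Fin (n + 2) → Y) → Fin k → Y) : ℕ → ℕ → Y × (Fin k → Y)
  | 0 => fun _ => (r0, c0)
  | n + 1 => fun m =>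
    if m ≤ n then playHist r0 c0 ρ σ n m
    else
      (ρ n fun i => (playHist r0 c0 ρ σ n i).2,
        σ n fun i => if (i : ℕ) ≤ n then (playHist r0 c0 ρ σ n i).1
          else ρ n fun j => (playHist r0 c0 ρ σ n j).2)

lemma playHist_of_le (r0 : Y) (c0 : Fin k → Y)
    (ρ : (n : ℕ) → (Fin (n + 1) → Fin k → Y) → Y)
    (σ : (n : ℕ) → (Fin (n + 2) → Y) → Fin k → Y) {m n : ℕ} (hmn : m ≤ n) :
    playHist r0 c0 ρ σ n m = playHist r0 c0 ρ σ m m := by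
  induction n, hmn using Nat.le_induction with
  | base => rfl
  | succ n hn ih => simp only [playHist, if_pos hn, ih]

/-- Any robber strategy and any cop strategy can be played against each other. -/
lemma exists_play (r0 : Y) (c0 : Fin k → Y)
    (ρ : (n : ℕ) → (Fin (n + 1) → Fin k → Y) → Y)
    (σ : (n : ℕ) → (Fin (n + 2) → Y) → Fin k → Y) :
    ∃ (r : ℕ → Y) (c : ℕ → Fin k → Y), robTraj r0 ρ c = r ∧ copTraj c0 σ r = c := by
  refine ⟨fun n => (playHist r0 c0 ρ σ n n).1, fun n => (playHist r0 c0 ρ σ n n).2, ?_, ?_⟩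
  · funext n
    cases n with
    | zero => rfl
    | succ n =>
      simp only [robTraj, playHist, Nat.not_succ_le_self, if_false]
      congr 1
      funext i
      rw [playHist_of_le r0 c0 ρ σ (Nat.lt_succ_iff.1 i.2)]
  · funext n
    cases n with
    | zero => rfl
    | succ n =>
      simp only [copTraj]
      rw [playHist]
      simp only [Nat.not_succ_le_self, if_false]
      congr 1
      funext i
      split_ifs with hi
      · rw [playHist_of_le r0 c0 ρ σ hi]
      · have hi' : (i : ℕ) = n + 1 := by have := i.2; omega
        rw [hi', playHist]
        simp only [Nat.not_succ_le_self, if_false]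

/-- A robber strategy keeping the cops at a positive distance refutes the existence of a
winning cop strategy. -/
lemma RobberWins.not_copsWinWith (hd : ∀ x, d x x = 0) {τ : ℕ → ℝ} (hτ : IsAgility τ)
    {ε : ℝ} (hε : 0 < ε) (hrob : RobberWins Y d k τ ε) : ¬ CopsWinWith Y d k := by
  intro hcop
  obtain ⟨r0, c0, ρ, hρ⟩ := hrob
  obtain ⟨σ, hσ⟩ := hcop τ hτ r0 c0
  obtain ⟨r, c, hr, hc⟩ := exists_play r0 c0 ρ σ
  have hr0 : r 0 = r0 := by rw [← hr]; rfl
  have hc0 : c 0 = c0 := by rw [← hc]; rfl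
  have robLegal : ∀ n, (∀ m < n, ∀ i, d (c m i) (c (m + 1) i) ≤ τ (m + 1)) →
      d (r n) (r (n + 1)) ≤ τ (n + 1) := by
    intro n hn
    have key := (hρ (fun m => c (min m n)) (by simpa using hc0) ?_).1 n
    · rw [robTraj_congr r0 ρ (c' := c), robTraj_congr r0 ρ (c' := c) (n := n + 1), hr] at key
      · exact key
      · intro m hm
        simp only [min_eq_left (Nat.lt_succ_iff.1 hm)]
      · intro m hm
        simp only [min_eq_left hm.le]
    · intro m i
      rcases lt_or_ge m n with hm | hm
      · simp only [min_eq_left hm.le, min_eq_left (Nat.succ_le_of_lt hm)]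
        exact hn m hm i
      · simp only [min_eq_right hm, min_eq_right (hm.trans m.le_succ), hd]
        exact (hτ.1 _).le
  have copLegal : ∀ n, (∀ m ≤ n, d (r m) (r (m + 1)) ≤ τ (m + 1)) →
      ∀ i, d (c n i) (c (n + 1) i) ≤ τ (n + 1) := by
    intro n hn i
    have key := (hσ (fun m => r (min m (n + 1))) (by simpa using hr0) ?_).1 n i
    · rw [copTraj_congr c0 σ (r' := r), copTraj_congr c0 σ (r' := r) (n := n + 1), hc] at key
      · exact key
      · intro m hm
        simp only [min_eq_left hm]
      · intro m hm
        simp only [min_eq_left (hm.trans n.le_succ)]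
    · intro m
      rcases lt_or_ge m (n + 1) with hm | hm
      · simp only [min_eq_left hm.le, min_eq_left (Nat.succ_le_of_lt hm)]
        exact hn m (Nat.lt_succ_iff.1 hm)
      · simp only [min_eq_right hm, min_eq_right (hm.trans m.le_succ), hd]
        exact (hτ.1 _).le
  have legal : ∀ n, (∀ i, d (c n i) (c (n + 1) i) ≤ τ (n + 1)) ∧
      d (r n) (r (n + 1)) ≤ τ (n + 1) := by
    intro n
    induction n using Nat.strong_induction_on with
    | _ n ih =>
      have hrn := robLegal n fun m hm => (ih m hm).1
      refine ⟨copLegal n fun m hm => ?_, hrn⟩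
      rcases hm.lt_or_eq with hm | rfl
      · exact (ih m hm).2
      · exact hrn
  obtain ⟨n, i, hlt⟩ := (hσ r hr0 fun n => (legal n).2).2 ε hε
  have hgt := (hρ c hc0 fun n => (legal n).1).2 n i
  rw [hr] at hgt
  rw [hc] at hlt
  exact lt_asymm hlt hgt

/-- Transfer of a robber strategy along an isometric inclusion `ι : X → Y`, provided every cop
on `Y` has a legally moving shadow on `X`: `Sh a y` says that `a` is an admissible shadow of
`y`. -/
lemma RobberWins.of_shadow {X : Type*} {dX : X → X → ℝ} (hdX : ∀ x, dX x x = 0)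
    {τ : ℕ → ℝ} (hτ : ∀ n, 0 < τ n) {ε ε' : ℝ} (ι : X → Y)
    (hι : ∀ x y, d (ι x) (ι y) = dX x y) (Sh : X → Y → Prop) (hSh : ∀ x, Sh x (ι x))
    (hstep : ∀ a y y' δ, 0 < δ → Sh a y → d y y' ≤ δ → ∃ a', dX a a' ≤ δ ∧ Sh a' y')
    (hfar : ∀ r a y, Sh a y → ε < dX r a → ε' < d (ι r) y)
    (hrob : RobberWins X dX k τ ε) : RobberWins Y d k τ ε' := by
  classical
  obtain ⟨r0, c0, ρ, hρ⟩ := hrob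
  have hnext : ∀ (a : X) (y' : Y) (δ : ℝ), ∃ a', 0 < δ → dX a a' ≤ δ ∧
      ((∃ b, dX a b ≤ δ ∧ Sh b y') → Sh a' y') := by
    intro a y' δ
    by_cases hex : ∃ b, dX a b ≤ δ ∧ Sh b y'
    · obtain ⟨b, hb⟩ := hex
      exact ⟨b, fun _ => ⟨hb.1, fun _ => hb.2⟩⟩
    · exact ⟨a, fun hδ => ⟨by rw [hdX]; exact hδ.le, fun hex' => absurd hex' hex⟩⟩
  choose next hnext using hnext
  let shadow : (ℕ → Fin k → Y) → ℕ → Fin k → X := fun c n =>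
    Nat.rec c0 (fun m a i => next (a i) (c (m + 1) i) (τ (m + 1))) n
  have shadow_succ : ∀ c n i,
      shadow c (n + 1) i = next (shadow c n i) (c (n + 1) i) (τ (n + 1)) := fun _ _ _ => rfl
  have shadow_congr : ∀ c c' n, (∀ m ≤ n, c m = c' m) → shadow c n = shadow c' n := by
    intro c c' n
    induction n with
    | zero => intro _; rfl
    | succ n ih =>
      intro hcc
      funext i
      rw [shadow_succ, shadow_succ, ih fun m hm => hcc m (hm.trans n.le_succ), hcc _ le_rfl]
  refine ⟨ι r0, fun i => ι (c0 i), fun n hist => ι (ρ n fun j =>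
    shadow (fun m => hist ⟨min m n, Nat.lt_succ_iff.2 (min_le_right m n)⟩) j), ?_⟩
  intro c hc0 hc
  have htraj : ∀ n, robTraj (ι r0) (fun n hist => ι (ρ n fun j =>
      shadow (fun m => hist ⟨min m n, Nat.lt_succ_iff.2 (min_le_right m n)⟩) j)) c n =
      ι (robTraj r0 ρ (shadow c) n) := by
    intro n
    cases n with
    | zero => rfl
    | succ n =>
      simp only [robTraj]
      congr 2
      funext j
      refine shadow_congr (fun m => c (min m n)) c j fun m hm => ?_
      have hmn : m ≤ n := hm.trans (Nat.lt_succ_iff.1 j.2)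
      simp only [min_eq_left hmn]
  have hlegal : ∀ n i, dX (shadow c n i) (shadow c (n + 1) i) ≤ τ (n + 1) := fun n i =>
    (hnext (shadow c n i) (c (n + 1) i) (τ (n + 1)) (hτ _)).1
  have hinv : ∀ n i, Sh (shadow c n i) (c n i) := by
    intro n i
    induction n with
    | zero =>
      rw [hc0]
      exact hSh _
    | succ n ih =>
      exact (hnext (shadow c n i) (c (n + 1) i) (τ (n + 1)) (hτ _)).2
        (hstep _ _ _ _ (hτ _) ih (hc n i))
  obtain ⟨hmove, hdist⟩ := hρ (shadow c) rfl hlegal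
  refine ⟨fun n => ?_, fun n i => ?_⟩
  · rw [htraj, htraj, hι]
    exact hmove n
  · rw [htraj]
    exact hfar _ _ _ (hinv n i) (hdist n i)

end GeneralGame

section Length

variable {Y : Type*} {c : Y → Y → ENNReal} {R : Y → Y → Prop}

/-- The sum of the costs along `0 ≤ t ≤ 1` is at most the length. -/
lemma cost_add_cost_le_elen (p : ℝ → Y) {t : ℝ} (ht : t ∈ Set.Icc (0 : ℝ) 1) :
    c (p 0) (p t) + c (p t) (p 1) ≤ elen c p := by
  let u : ℕ → ℝ := fun n => if n = 0 then 0 else if n = 1 then t else 1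
  have hu : Monotone u := by
    refine monotone_nat_of_le_succ fun n => ?_
    rcases n with _ | _ | n <;> simp [u, ht.1, ht.2]
  have hmem : ∀ i, u i ∈ Set.Icc (0 : ℝ) 1 := by
    intro i
    rcases i with _ | _ | i <;> simp [u, ht.1, ht.2]
  refine le_trans (le_of_eq ?_) (le_iSup (fun q : ℕ × {u : ℕ → ℝ // Monotone u ∧
    ∀ i, u i ∈ Set.Icc (0 : ℝ) 1} =>
    ∑ i ∈ Finset.range q.1, c (p (q.2.1 i)) (p (q.2.1 (i + 1)))) (2, ⟨u, hu, hmem⟩))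
  simp [Finset.sum_range_succ, u]

lemma cost_le_elen (p : ℝ → Y) : c (p 0) (p 1) ≤ elen c p :=
  le_add_self.trans (cost_add_cost_le_elen p (t := 0) (by simp))

/-- The length of a path which is Lipschitz with respect to the cost. -/
lemma elen_le_of_lipschitz {p : ℝ → Y} {K : ℝ} (hK : 0 ≤ K)
    (hp : ∀ t ∈ Set.Icc (0 : ℝ) 1, ∀ t' ∈ Set.Icc (0 : ℝ) 1,
      c (p t) (p t') ≤ ENNReal.ofReal (K * |t' - t|)) :
    elen c p ≤ ENNReal.ofReal K := by
  refine iSup_le ?_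
  rintro ⟨n, u, hu, hmem⟩
  calc ∑ i ∈ Finset.range n, c (p (u i)) (p (u (i + 1)))
      ≤ ∑ i ∈ Finset.range n, ENNReal.ofReal (K * (u (i + 1) - u i)) := by
        refine Finset.sum_le_sum fun i _ => ?_
        have := hp _ (hmem i) _ (hmem (i + 1))
        rwa [abs_of_nonneg (sub_nonneg.2 (hu i.le_succ))] at this
    _ = ENNReal.ofReal (∑ i ∈ Finset.range n, K * (u (i + 1) - u i)) :=
        (ENNReal.ofReal_sum_of_nonneg fun i _ =>
          mul_nonneg hK (sub_nonneg.2 (hu i.le_succ))).symm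
    _ ≤ ENNReal.ofReal K := by
        refine ENNReal.ofReal_le_ofReal ?_
        rw [← Finset.mul_sum, Finset.sum_range_sub]
        have h0 := (hmem 0).1
        have h1 := (hmem n).2
        nlinarith

lemma econt_of_lipschitz {p : ℝ → Y} {K : ℝ}
    (hp : ∀ t ∈ Set.Icc (0 : ℝ) 1, ∀ t' ∈ Set.Icc (0 : ℝ) 1,
      c (p t) (p t') ≤ ENNReal.ofReal (K * |t' - t|)) : econt c p := by
  intro t ht ε hε
  have hlim : Tendsto (fun t' : ℝ => ENNReal.ofReal (K * |t' - t|)) (𝓝 t) (𝓝 0) := by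
    have hcont : Continuous fun t' : ℝ => ENNReal.ofReal (K * |t' - t|) :=
      ENNReal.continuous_ofReal.comp (by fun_prop)
    simpa using hcont.tendsto t
  obtain ⟨δ, hδ, hball⟩ := Metric.eventually_nhds_iff.1 (hlim.eventually (gt_mem_nhds hε))
  exact ⟨δ, hδ, fun t' ht' htt => (hp t ht t' ht').trans_lt (hball htt)⟩

lemma ofReal_sub_le_sum {n : ℕ} {u v : Fin (n + 1) → ℝ} {w : Fin (n + 1) → ENNReal}
    (hlink : ∀ i : Fin n, v i.castSucc = u i.succ)
    (hw : ∀ i, ENNReal.ofReal (v i - u i) ≤ w i) :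
    ENNReal.ofReal (v (Fin.last n) - u 0) ≤ ∑ i, w i := by
  induction n with
  | zero => simpa using hw 0
  | succ n ih =>
    rw [Fin.sum_univ_castSucc]
    have hinit := ih (u := fun i => u i.castSucc) (v := fun i => v i.castSucc)
      (w := fun i => w i.castSucc) (fun i => by simpa using hlink i.castSucc)
      (fun i => hw i.castSucc)
    have hlast := hlink (Fin.last n)
    rw [Fin.succ_last] at hlast
    calc ENNReal.ofReal (v (Fin.last (n + 1)) - u 0)
        = ENNReal.ofReal ((v (Fin.last n).castSucc - u 0) +
            (v (Fin.last (n + 1)) - u (Fin.last (n + 1)))) := by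
          rw [hlast]; congr 1; ring
      _ ≤ _ := ENNReal.ofReal_add_le.trans (add_le_add hinit (hw _))

/-- A function on a glued space which is `1`-Lipschitz on every part is `1`-Lipschitz for the
induced length metric. -/
lemma ofReal_sub_le_glueDist (f : Quot R → ℝ)
    (hf : ∀ p q, ENNReal.ofReal (f (Quot.mk R q) - f (Quot.mk R p)) ≤ c p q) (a b : Quot R) :
    ENNReal.ofReal (f b - f a) ≤ glueDist c R a b := by
  refine le_iInf fun P => ?_
  have := ofReal_sub_le_sum (u := fun i => f (Quot.mk R (P.piece i 0)))
    (v := fun i => f (Quot.mk R (P.piece i 1))) (w := fun i => elen c (P.piece i))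
    (fun i => congrArg f (P.link i)) (fun i => (hf _ _).trans (cost_le_elen _))
  simp only [P.first, P.last] at this
  exact this

lemma glueDist_ne_top_of_piece {p : ℝ → Y} (hp : econt c p) (hlen : elen c p ≠ ⊤)
    {a b : Quot R} (h0 : Quot.mk R (p 0) = a) (h1 : Quot.mk R (p 1) = b) :
    glueDist c R a b ≠ ⊤ := by
  let P : PiecewisePath c R a b :=
    { m := 0
      piece := fun _ => p
      cont := fun _ => hp
      first := h0
      last := h1
      link := fun i => i.elim0 }
  refine ne_top_of_le_ne_top ?_ (iInf_le _ P)
  simpa [PiecewisePath.len, P] using hlen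

lemma glueDist_ne_top_of_cons {p : ℝ → Y} (hp : econt c p) (hlen : elen c p ≠ ⊤)
    {a b b' : Quot R} (h0 : Quot.mk R (p 0) = a) (h1 : Quot.mk R (p 1) = b)
    (hb : glueDist c R b b' ≠ ⊤) : glueDist c R a b' ≠ ⊤ := by
  obtain ⟨P, hP⟩ := iInf_lt_top.1 (lt_top_iff_ne_top.2 hb)
  let Q : PiecewisePath c R a b' :=
    { m := P.m + 1
      piece := Fin.cons p P.piece
      cont := fun i => by
        refine Fin.cases ?_ (fun j => ?_) i
        · simpa using hp
        · simpa using P.cont j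
      first := by simpa using h0
      last := by
        rw [← Fin.succ_last, Fin.cons_succ]
        exact P.last
      link := fun i => by
        refine Fin.cases ?_ (fun j => ?_) i
        · rw [Fin.castSucc_zero, Fin.cons_zero, Fin.cons_succ, h1, P.first]
        · rw [← Fin.succ_castSucc, Fin.cons_succ, Fin.cons_succ]
          exact P.link j }
  refine ne_top_of_le_ne_top ?_ (iInf_le _ Q)
  have hQ : Q.len = elen c p + P.len := by
    simp only [PiecewisePath.len, Q]
    rw [Fin.sum_univ_succ]
    simp
  rw [hQ]
  exact ENNReal.add_ne_top.2 ⟨hlen, hP.ne⟩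

end Length

section Geodesic

variable {X : Type*} [MetricSpace X]

lemma CompactD.compactSpace (hX : CompactD X fun x y => dist x y) : CompactSpace X := by
  refine ⟨IsSeqCompact.isCompact fun u _ => ?_⟩
  obtain ⟨x, φ, hφ, hlim⟩ := hX u
  exact ⟨x, Set.mem_univ x, φ, hφ, tendsto_iff_dist_tendsto_zero.2 hlim⟩

/-- In a geodesic space, one can move by `δ` to decrease the distance to a given point by
`δ`. -/
lemma IsGeodesicD.exists_dist_le (hX : IsGeodesicD X fun x y => dist x y) (a s : X)
    {t δ : ℝ} (ht : 0 ≤ t) (hδ : 0 ≤ δ) (hts : dist a s ≤ t + δ) :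
    ∃ a', dist a a' ≤ δ ∧ dist a' s ≤ t := by
  rcases le_or_gt (dist a s) δ with hle | hlt
  · exact ⟨s, hle, by simpa using ht⟩
  obtain ⟨p, hp, rfl, rfl, hlen⟩ := hX a s
  have hcont : ContinuousOn (fun x => dist (p 0) (p x)) (Set.Icc 0 1) := by
    intro x hx
    refine (tendsto_const_nhds (x := p 0)).dist ?_
    rw [tendsto_iff_dist_tendsto_zero, Metric.tendsto_nhdsWithin_nhds]
    intro e he
    obtain ⟨η, hη, hball⟩ := hp x hx (ENNReal.ofReal e) (ENNReal.ofReal_pos.2 he)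
    refine ⟨η, hη, fun {y} hy hyx => ?_⟩
    have := (ENNReal.ofReal_lt_ofReal_iff he).1 (hball y hy hyx)
    simpa [dist_comm] using this
  obtain ⟨x, hx, hxδ⟩ := intermediate_value_Icc zero_le_one hcont
    (show δ ∈ Set.Icc (dist (p 0) (p 0)) (dist (p 0) (p 1)) from ⟨by simpa using hδ, hlt.le⟩)
  refine ⟨p x, hxδ.le, ?_⟩
  have hsum := cost_add_cost_le_elen (c := fun a b => ENNReal.ofReal (dist a b)) p hx
  rw [hlen, ← ENNReal.ofReal_add dist_nonneg dist_nonneg,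
    ENNReal.ofReal_le_ofReal_iff dist_nonneg] at hsum
  simp only at hxδ
  linarith

end Geodesic

section HatMetric

variable {X : Type*} [MetricSpace X] {S : Set X} {h : ℝ}

lemma lineMap_mem_Icc {H a b : ℝ} (ha : a ∈ Set.Icc 0 H) (hb : b ∈ Set.Icc 0 H) {t : ℝ}
    (ht : t ∈ Set.Icc (0 : ℝ) 1) : a + (b - a) * t ∈ Set.Icc 0 H := by
  constructor <;> nlinarith [ha.1, ha.2, hb.1, hb.2, ht.1, ht.2]

/-- Vertical segments in the cylinder or in the top have finite length. -/
lemma exists_vertical_piece {H : ℝ} (mk : ↥(Set.Icc (0 : ℝ) H) → PrePt S h)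
    (hmk : ∀ u v, preDist S h (mk u) (mk v) ≤ ENNReal.ofReal |(u : ℝ) - v|)
    (u v : ↥(Set.Icc (0 : ℝ) H)) :
    ∃ p : ℝ → PrePt S h, econt (preDist S h) p ∧ elen (preDist S h) p ≠ ⊤ ∧
      p 0 = mk u ∧ p 1 = mk v := by
  have hH : (0 : ℝ) ≤ H := u.2.1.trans u.2.2
  let p : ℝ → PrePt S h := fun t => mk (Set.projIcc 0 H hH (u + (v - u) * t))
  have hp : ∀ t ∈ Set.Icc (0 : ℝ) 1, ∀ t' ∈ Set.Icc (0 : ℝ) 1,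
      preDist S h (p t) (p t') ≤ ENNReal.ofReal (|(v : ℝ) - u| * |t' - t|) := by
    intro t ht t' ht'
    refine (hmk _ _).trans (ENNReal.ofReal_le_ofReal (le_of_eq ?_))
    rw [Set.projIcc_of_mem hH (lineMap_mem_Icc u.2 v.2 ht),
      Set.projIcc_of_mem hH (lineMap_mem_Icc u.2 v.2 ht'), ← abs_mul, abs_sub_comm]
    congr 1
    simp only
    ring
  refine ⟨p, econt_of_lipschitz hp,
    ne_top_of_le_ne_top ENNReal.ofReal_ne_top (elen_le_of_lipschitz (abs_nonneg _) hp), ?_, ?_⟩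
  · simp only [p, mul_zero, add_zero, Set.projIcc_val]
  · simp only [p, mul_one, add_sub_cancel, Set.projIcc_val]

lemma exists_cyl_piece (s : S) (u v : ↥(Set.Icc (0 : ℝ) h)) :
    ∃ p : ℝ → PrePt S h, econt (preDist S h) p ∧ elen (preDist S h) p ≠ ⊤ ∧
      p 0 = Sum.inr (Sum.inl (s, u)) ∧ p 1 = Sum.inr (Sum.inl (s, v)) :=
  exists_vertical_piece (fun u => Sum.inr (Sum.inl (s, u)))
    (fun u v => by simp [preDist, cylDist]) u v

lemma exists_top_piece (s : S) (u v : ↥(Set.Icc (0 : ℝ) (h + Metric.diam S))) :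
    ∃ p : ℝ → PrePt S h, econt (preDist S h) p ∧ elen (preDist S h) p ≠ ⊤ ∧
      p 0 = Sum.inr (Sum.inr (s, u)) ∧ p 1 = Sum.inr (Sum.inr (s, v)) :=
  exists_vertical_piece (fun u => Sum.inr (Sum.inr (s, u)))
    (fun u v => ENNReal.ofReal_le_ofReal (by simp [topDist])) u v

lemma exists_base_piece (hX : IsGeodesicD X fun x y => dist x y) (x y : X) :
    ∃ p : ℝ → PrePt S h, econt (preDist S h) p ∧ elen (preDist S h) p ≠ ⊤ ∧
      p 0 = Sum.inl x ∧ p 1 = Sum.inl y := by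
  obtain ⟨p, hp, h0, h1, hlen⟩ := hX x y
  refine ⟨fun t => Sum.inl (p t), hp, ?_, congrArg Sum.inl h0, congrArg Sum.inl h1⟩
  change elen (fun a b => ENNReal.ofReal (dist a b)) p ≠ ⊤
  rw [hlen]
  exact ENNReal.ofReal_ne_top

/-- Any two points of `X_{h,S}` are at finite distance. -/
lemma hatDistE_ne_top (hX : IsGeodesicD X fun x y => dist x y) (hh : 0 ≤ h)
    (a b : GlueSp S h) : hatDistE S h a b ≠ ⊤ := by
  have hH : 0 ≤ h + Metric.diam S := add_nonneg hh Metric.diam_nonneg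
  let zc : ↥(Set.Icc (0 : ℝ) h) := ⟨0, le_rfl, hh⟩
  let hc : ↥(Set.Icc (0 : ℝ) h) := ⟨h, hh, le_rfl⟩
  let zt : ↥(Set.Icc (0 : ℝ) (h + Metric.diam S)) := ⟨0, le_rfl, hH⟩
  have gbase : ∀ s : S, (Quot.mk (Glue S h) (Sum.inl (s : X)) : GlueSp S h) =
      Quot.mk _ (Sum.inr (Sum.inl (s, zc))) := fun s => Quot.sound (Glue.base s zc rfl)
  have gmid : ∀ s : S, (Quot.mk (Glue S h) (Sum.inr (Sum.inl (s, hc))) : GlueSp S h) =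
      Quot.mk _ (Sum.inr (Sum.inr (s, zt))) := fun s => Quot.sound (Glue.mid s hc zt rfl rfl)
  have fromBase : ∀ (x : X) (q : PrePt S h),
      hatDistE S h (Quot.mk _ (Sum.inl x)) (Quot.mk _ q) ≠ ⊤ := by
    rintro x (y | ⟨s, t⟩ | ⟨s, u⟩)
    · obtain ⟨p, hp, hl, h0, h1⟩ := exists_base_piece (S := S) (h := h) hX x y
      exact glueDist_ne_top_of_piece hp hl (by rw [h0]) (by rw [h1])
    · obtain ⟨p, hp, hl, h0, h1⟩ := exists_base_piece (S := S) (h := h) hX x s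
      obtain ⟨p', hp', hl', h0', h1'⟩ := exists_cyl_piece s zc t
      exact glueDist_ne_top_of_cons hp hl (by rw [h0]) (by rw [h1])
        (glueDist_ne_top_of_piece hp' hl' (by rw [h0', gbase]) (by rw [h1']))
    · obtain ⟨p, hp, hl, h0, h1⟩ := exists_base_piece (S := S) (h := h) hX x s
      obtain ⟨p', hp', hl', h0', h1'⟩ := exists_cyl_piece s zc hc
      obtain ⟨p'', hp'', hl'', h0'', h1''⟩ := exists_top_piece (h := h) s zt u
      exact glueDist_ne_top_of_cons hp hl (by rw [h0]) (by rw [h1])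
        (glueDist_ne_top_of_cons hp' hl' (by rw [h0', gbase]) (by rw [h1'])
          (glueDist_ne_top_of_piece hp'' hl'' (by rw [h0'', gmid]) (by rw [h1''])))
  induction b using Quot.ind with | _ q
  induction a using Quot.ind with | _ p
  rcases p with x | ⟨s, t⟩ | ⟨s, u⟩
  · exact fromBase x q
  · obtain ⟨p', hp', hl', h0', h1'⟩ := exists_cyl_piece s t zc
    exact glueDist_ne_top_of_cons hp' hl' (by rw [h0']) (by rw [h1', ← gbase])
      (fromBase s q)
  · obtain ⟨p', hp', hl', h0', h1'⟩ := exists_cyl_piece s hc zc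
    obtain ⟨p'', hp'', hl'', h0'', h1''⟩ := exists_top_piece (h := h) s u zt
    exact glueDist_ne_top_of_cons hp'' hl'' (by rw [h0'']) (by rw [h1'', ← gmid])
      (glueDist_ne_top_of_cons hp' hl' (by rw [h0']) (by rw [h1', ← gbase]) (fromBase s q))

/-- A real function on the disjoint union which is compatible with the gluing and
`1`-Lipschitz on each part is `1`-Lipschitz for `d'`. -/
lemma sub_le_hatDist (hX : IsGeodesicD X fun x y => dist x y) (hh : 0 ≤ h)
    (F : PrePt S h → ℝ) (hglue : ∀ p q, Glue S h p q → F p = F q)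
    (hbase : ∀ x y : X, F (Sum.inl y) - F (Sum.inl x) ≤ dist x y)
    (hcyl : ∀ p q : CylPt S h, F (Sum.inr (Sum.inl q)) - F (Sum.inr (Sum.inl p)) ≤ cylDist p q)
    (htop : ∀ p q : TopPt S h, F (Sum.inr (Sum.inr q)) - F (Sum.inr (Sum.inr p)) ≤ topDist p q)
    (p q : PrePt S h) : F q - F p ≤ hatDist S h (Quot.mk _ p) (Quot.mk _ q) := by
  refine (ENNReal.ofReal_le_iff_le_toReal (hatDistE_ne_top hX hh _ _)).1 ?_
  refine ofReal_sub_le_glueDist (c := preDist S h) (Quot.lift F hglue) ?_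
    (Quot.mk _ p) (Quot.mk _ q)
  rintro (x | p | p) (y | q | q)
  · exact ENNReal.ofReal_le_ofReal (hbase x y)
  · exact le_top
  · exact le_top
  · exact le_top
  · exact ENNReal.ofReal_le_ofReal (hcyl p q)
  · exact le_top
  · exact le_top
  · exact le_top
  · exact ENNReal.ofReal_le_ofReal (htop p q)

lemma topDist_nonneg (p q : TopPt S h) : 0 ≤ topDist p q :=
  le_min (add_nonneg dist_nonneg (abs_nonneg _))
    (add_nonneg (sub_nonneg.2 p.2.2.2) (sub_nonneg.2 q.2.2.2))

/-- How far `a : X` is from being an admissible shadow of a point of `X_{h,S}`: the point `a`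
should coincide with points of `X`, be at distance at most `t` from `s` for points `(s,t)` of
the cylinder, and is unconstrained for points of the top. -/
noncomputable def shadowGap (a : X) : PrePt S h → ℝ
  | Sum.inl x => dist a x
  | Sum.inr (Sum.inl p) => max 0 (dist a (p.1 : X) - p.2)
  | Sum.inr (Sum.inr _) => 0

lemma shadowGap_sub_le (hX : IsGeodesicD X fun x y => dist x y) (hh : 0 ≤ h)
    (hdiam : ∀ x y : X, dist x y ≤ h) (a : X) (p q : PrePt S h) :
    shadowGap a q - shadowGap a p ≤ hatDist S h (Quot.mk _ p) (Quot.mk _ q) := by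
  refine sub_le_hatDist hX hh (shadowGap a) ?_ ?_ ?_ ?_ p q
  · rintro _ _ (⟨s, t, ht⟩ | ⟨s, t, u, ht, hu⟩ | _)
    · simp [shadowGap, ht]
    · simp [shadowGap, ht, hdiam]
    · rfl
  · intro x y
    have := dist_triangle a x y
    simp only [shadowGap]
    linarith
  · intro p q
    have h1 := dist_triangle a (p.1 : X) q.1
    have h2 := le_abs_self ((p.2 : ℝ) - q.2)
    have h3 := abs_nonneg ((p.2 : ℝ) - q.2)
    have h4 : 0 ≤ dist (p.1 : X) q.1 := dist_nonneg
    have h5 := le_max_left 0 (dist a (p.1 : X) - p.2)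
    have h6 := le_max_right 0 (dist a (p.1 : X) - p.2)
    simp only [shadowGap, cylDist, tsub_le_iff_right]
    exact max_le (by linarith) (by linarith)
  · intro p q
    simpa [shadowGap] using topDist_nonneg p q

/-- The distance from a point `r : X`, truncated at `h`. -/
noncomputable def truncDist (r : X) : PrePt S h → ℝ
  | Sum.inl x => dist r x
  | Sum.inr (Sum.inl p) => min h (dist r (p.1 : X) + p.2)
  | Sum.inr (Sum.inr _) => h

lemma truncDist_le (hX : IsGeodesicD X fun x y => dist x y) (hh : 0 ≤ h)
    (hdiam : ∀ x y : X, dist x y ≤ h) (r : X) (q : PrePt S h) :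
    truncDist r q ≤ hatDist S h (iotaX S h r) (Quot.mk _ q) := by
  have key := sub_le_hatDist hX hh (truncDist r) ?_ ?_ ?_ ?_ (Sum.inl r : PrePt S h) q
  · simpa [truncDist, iotaX] using key
  · rintro _ _ (⟨s, t, ht⟩ | ⟨s, t, u, ht, hu⟩ | _)
    · simp [truncDist, ht, hdiam]
    · simp [truncDist, ht]
    · rfl
  · intro x y
    have := dist_triangle r x y
    simp only [truncDist]
    linarith
  · intro p q
    have h1 := dist_triangle r (p.1 : X) q.1
    have h2 := neg_abs_le ((p.2 : ℝ) - q.2)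
    have h3 := abs_nonneg ((p.2 : ℝ) - q.2)
    have h4 : 0 ≤ dist (p.1 : X) q.1 := dist_nonneg
    have h5 := min_le_left h (dist r (q.1 : X) + q.2)
    have h6 := min_le_right h (dist r (q.1 : X) + q.2)
    simp only [truncDist, cylDist]
    rw [sub_le_comm]
    exact le_min (by linarith) (by linarith)
  · intro p q
    simpa [truncDist] using topDist_nonneg p q

/-- Admissible shadows can follow the points of `X_{h,S}`. -/
lemma exists_shadowGap_eq_zero (hX : IsGeodesicD X fun x y => dist x y) {a : X} {δ : ℝ}
    (hδ : 0 ≤ δ) (q : PrePt S h) (hq : shadowGap a q ≤ δ) :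
    ∃ a', dist a a' ≤ δ ∧ shadowGap a' q = 0 := by
  rcases q with x | ⟨s, t⟩ | q
  · exact ⟨x, hq, dist_self x⟩
  · have hst := (le_max_right 0 (dist a (s : X) - t)).trans hq
    obtain ⟨a', ha, hs⟩ := hX.exists_dist_le a s t.2.1 hδ (by linarith)
    exact ⟨a', ha, max_eq_left (by simpa using hs)⟩
  · exact ⟨a, by simpa using hδ, rfl⟩

/-- A point of `X_{h,S}` is at least as far from `r : X` as its admissible shadows. -/
lemma dist_le_truncDist (hdiam : ∀ x y : X, dist x y ≤ h) {r a : X} {q : PrePt S h}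
    (hq : shadowGap a q = 0) : dist r a ≤ truncDist r q := by
  rcases q with x | ⟨s, t⟩ | q
  · rw [dist_eq_zero.1 (show dist a x = 0 from hq)]
    rfl
  · have hst : dist a (s : X) - t ≤ 0 := (le_max_right 0 _).trans_eq hq
    have := dist_triangle_right r a (s : X)
    exact le_min (hdiam r a) (by simp only; linarith)
  · exact hdiam r a

end HatMetric

/-- Remark 3 of the paper. In the situation of Statement 2, the
conclusion remains valid for any `inflated' metric `d⁺` on `X_{h,S}`, i.e. any metric with
(A) `d⁺ ≥ d'`, (B) `d⁺ = d` on `X`, and (C) generating the same topology as `d'`, such that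
`(X_{h,S},d⁺)` is a game space: the robber has a strategy against `k` cops on
`(X_{h,S},d⁺)` with the same agility function guaranteeing `d⁺(rⁿ,cⁿᵢ) > ε/3`; in
particular `k` cops do not have a winning strategy on `(X_{h,S},d⁺)`. -/
theorem robberWins_hat_inflated {X : Type*} [MetricSpace X]
    (hX : GameSpaceD X (fun x y => dist x y)) (S : Set X) (hS : IsCompact S)
    (hSne : S.Nonempty) (k : ℕ) (M ε h : ℝ) (hM : 0 < M) (hε : 0 < ε) (hεh : ε ≤ h)
    (hh : M + Metric.diam (Set.univ : Set X) ≤ h) (τ : ℕ → ℝ) (hτ : IsAgility τ)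
    (hτM : ∀ n, τ n ≤ M) (hrob : RobberWins X (fun x y => dist x y) k τ ε)
    (dplus : GlueSp S h → GlueSp S h → ℝ)
    (hA : ∀ a b, hatDist S h a b ≤ dplus a b)
    (hB : ∀ x y : X, dplus (iotaX S h x) (iotaX S h y) = dist x y)
    (hC : ballTopOf dplus = ballTopOf (hatDist S h))
    (hgame : GameSpaceD (GlueSp S h) dplus) :
    RobberWins (GlueSp S h) dplus k τ (ε / 3) ∧
      ¬ CopsWinWith (GlueSp S h) dplus k := by
  have hcs : CompactSpace X := hX.2.2.1.compactSpace
  have hgeo : IsGeodesicD X fun x y => dist x y := hX.2.2.2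
  have hdiam : ∀ x y : X, dist x y ≤ h := fun x y => by
    have := Metric.dist_le_diam_of_mem (isCompact_univ (X := X)).isBounded (Set.mem_univ x)
      (Set.mem_univ y)
    linarith
  have hh0 : 0 ≤ h := hε.le.trans hεh
  have hwin : RobberWins (GlueSp S h) dplus k τ (ε / 3) := by
    refine hrob.of_shadow (fun x => dist_self x) hτ.1 (iotaX S h) hB
      (fun a y => ∃ p, Quot.mk _ p = y ∧ shadowGap a p = 0)
      (fun x => ⟨Sum.inl x, rfl, dist_self x⟩) ?_ ?_
    · rintro a _ y' δ hδ ⟨p, rfl, hp⟩ hmove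
      obtain ⟨q, rfl⟩ := Quot.exists_rep y'
      have hgap := shadowGap_sub_le hgeo hh0 hdiam a p q
      have hle := (hA (Quot.mk _ p) (Quot.mk _ q)).trans hmove
      obtain ⟨a', ha', hq⟩ := exists_shadowGap_eq_zero hgeo hδ.le q (by linarith)
      exact ⟨a', ha', q, rfl, hq⟩
    · rintro r a _ ⟨p, rfl, hp⟩ hfar
      have h1 := dist_le_truncDist hdiam (r := r) hp
      have h2 := truncDist_le hgeo hh0 hdiam r p
      have h3 := hA (iotaX S h r) (Quot.mk _ p)
      linarith
  exact ⟨hwin, hwin.not_copsWinWith hgame.2.1.1 hτ (by positivity)⟩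
end
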